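/- Let π be a set of primes with 2 ∈ π, and let G be a finite π-separable group with subgroup U. Suppose χ ∈ Irr(G) satisfies χ^o ∈ I_π(G), and assume ψ ∈ Irr(U) is π-factored with χ = ψ^G. If |G : U| is a π-number and the π'-special factor of ψ extends to G, then χ is π-factored. -/

import Mathlib

open scoped Classical

noncomputable section

/-- All prime divisors of `n` belong to the set of primes `σ`. -/
def IsPiNumber (σ : Set ℕ) (n : ℕ) : Prop :=
  ∀ q : ℕ, q.Prime → q ∣ n → q ∈ σ

/-- `g` is a `σ`-element: its order is a `σ`-number. -/
def IsPiElt (σ : Set ℕ) {G : Type} [Group G] (g : G) : Prop :=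
  IsPiNumber σ (orderOf g)

/-- The `p`-part of a natural number. -/
def pPart (p n : ℕ) : ℕ := p ^ (n.factorization p)

/-- `χ` is the character of a finite-dimensional complex representation of `G`. -/
def IsCharacter (G : Type) [Group G] (χ : G → ℂ) : Prop :=
  ∃ V : FDRep ℂ G, ∀ g, χ g = V.character g

/-- `χ` is an irreducible (ordinary, complex) character of `G`: a nonzero character
which is not the sum of two nonzero characters. -/
def IsIrrChar (G : Type) [Group G] (χ : G → ℂ) : Prop :=
  IsCharacter G χ ∧ χ ≠ 0 ∧
    ¬ ∃ χ₁ χ₂ : G → ℂ, IsCharacter G χ₁ ∧ χ₁ ≠ 0 ∧ IsCharacter G χ₂ ∧ χ₂ ≠ 0 ∧ χ = χ₁ + χ₂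

/-- Restriction of a class function on `G` to a subgroup `H`. -/
def resChar {G : Type} [Group G] (H : Subgroup G) (χ : G → ℂ) : ↥H → ℂ :=
  fun h => χ (h : G)

/-- Restriction of a class function between nested subgroups. -/
def resCharLe {G : Type} [Group G] {K H : Subgroup G} (hKH : K ≤ H) (χ : ↥H → ℂ) : ↥K → ℂ :=
  fun k => χ ⟨(k : G), hKH k.2⟩

/-- The induced class function from a subgroup `H` of `G`, given by the usual
induction formula. -/
def indChar {G : Type} [Group G] [Fintype G] (H : Subgroup G) (ψ : ↥H → ℂ) : G → ℂ :=
  fun g => (Nat.card ↥H : ℂ)⁻¹ *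
    ∑ x : G, if h : x * g * x⁻¹ ∈ H then ψ ⟨x * g * x⁻¹, h⟩ else 0

/-- Induction of a class function between nested subgroups. -/
def indCharLe {G : Type} [Group G] [Fintype G] {K H : Subgroup G} (_ : K ≤ H)
    (ψ : ↥K → ℂ) : ↥H → ℂ :=
  fun x => (Nat.card ↥K : ℂ)⁻¹ *
    ∑ y : ↥H, if h : (y : G) * (x : G) * (y : G)⁻¹ ∈ K then ψ ⟨(y : G) * (x : G) * (y : G)⁻¹, h⟩ else 0

/-- `θ` is an irreducible constituent of the class function `χ`. -/
def IsConstituent {G : Type} [Group G] (θ χ : G → ℂ) : Prop :=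
  IsIrrChar G θ ∧ ∃ ξ : G → ℂ, (ξ = 0 ∨ IsCharacter G ξ) ∧ χ = θ + ξ

/-- The restriction `χ^o` of a class function to the `σ`-elements of `G`
(extended by zero elsewhere). -/
def piRestrict (σ : Set ℕ) {G : Type} [Group G] (χ : G → ℂ) : G → ℂ :=
  fun g => if IsPiElt σ g then χ g else 0

/-- `φ` is a `σ`-partial character of `G`: the restriction to the `σ`-elements of an
ordinary character. -/
def IsPartialChar (σ : Set ℕ) (G : Type) [Group G] (φ : G → ℂ) : Prop :=
  ∃ χ : G → ℂ, IsCharacter G χ ∧ χ ≠ 0 ∧ φ = piRestrict σ χ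

/-- `φ ∈ I_σ(G)`: an irreducible `σ`-partial character, i.e. one which is not the
sum of two `σ`-partial characters. -/
def IsIPiChar (σ : Set ℕ) (G : Type) [Group G] (φ : G → ℂ) : Prop :=
  IsPartialChar σ G φ ∧
    ¬ ∃ φ₁ φ₂ : G → ℂ, IsPartialChar σ G φ₁ ∧ IsPartialChar σ G φ₂ ∧ φ = φ₁ + φ₂

/-- `φ ∈ IBr(G)` (at the prime `p`): irreducible Brauer characters are the irreducible
`p'`-partial characters, where the `p`-regular elements are the `{p}ᶜ`-elements. -/
def IsIBrChar (p : ℕ) (G : Type) [Group G] (φ : G → ℂ) : Prop :=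
  IsIPiChar ({p}ᶜ) G φ

/-- The restriction `χ^o` of `χ` to the `p`-regular elements of `G`. -/
def brRestrict (p : ℕ) {G : Type} [Group G] (χ : G → ℂ) : G → ℂ :=
  piRestrict ({p}ᶜ) χ

/-- `χ` is a lift of the `σ`-partial character `φ`. -/
def IsLiftOfPi (σ : Set ℕ) (G : Type) [Group G] (χ φ : G → ℂ) : Prop :=
  IsIrrChar G χ ∧ piRestrict σ χ = φ

/-- `χ` is a lift: `χ` is irreducible and `χ^o` is an irreducible `σ`-partial character. -/
def IsLiftPi (σ : Set ℕ) (G : Type) [Group G] (χ : G → ℂ) : Prop :=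
  IsIrrChar G χ ∧ IsIPiChar σ G (piRestrict σ χ)

/-- `H` is a subnormal subgroup of `G`. -/
def IsSubnormalSubgroup {G : Type} [Group G] (H : Subgroup G) : Prop :=
  ∃ (n : ℕ) (c : Fin (n + 1) → Subgroup G),
    c 0 = H ∧ c (Fin.last n) = ⊤ ∧
    ∀ i : Fin n, c i.castSucc ≤ c i.succ ∧ ((c i.castSucc).subgroupOf (c i.succ)).Normal

/-- The determinantal order `o(det θ)` of `θ` is a `σ`-number. -/
def HasPiDetOrder (σ : Set ℕ) (G : Type) [Group G] (θ : G → ℂ) : Prop :=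
  ∃ V : FDRep ℂ G, (∀ g, θ g = V.character g) ∧
    IsPiNumber σ (orderOf (fun g : G => LinearMap.det (V.ρ g)))

/-- `χ` is a `σ`-special character of `G`: `χ` is irreducible, `χ(1)` is a `σ`-number,
and for every subnormal subgroup `M` of `G`, every irreducible constituent of `χ_M`
has determinantal order a `σ`-number. -/
def IsPiSpecial (σ : Set ℕ) (G : Type) [Group G] (χ : G → ℂ) : Prop :=
  IsIrrChar G χ ∧ (∃ n : ℕ, χ 1 = (n : ℂ) ∧ IsPiNumber σ n) ∧
    ∀ M : Subgroup G, IsSubnormalSubgroup M →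
      ∀ θ : ↥M → ℂ, IsConstituent θ (resChar M χ) → HasPiDetOrder σ ↥M θ

/-- `χ` is `σ`-factored: `χ = αβ` with `α` `σ`-special and `β` `σ'`-special. -/
def IsPiFactored (σ : Set ℕ) (G : Type) [Group G] (χ : G → ℂ) : Prop :=
  ∃ α β : G → ℂ, IsPiSpecial σ G α ∧ IsPiSpecial σᶜ G β ∧ χ = α * β

/-- `G` is `σ`-separable: it has a subnormal series each of whose factors is a
`σ`-group or a `σ'`-group (equivalently, every composition factor is a `σ`-group or a
`σ'`-group). -/
def IsPiSeparable (σ : Set ℕ) (G : Type) [Group G] : Prop :=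
  ∃ (n : ℕ) (c : Fin (n + 1) → Subgroup G),
    c 0 = ⊥ ∧ c (Fin.last n) = ⊤ ∧
    ∀ i : Fin n, c i.castSucc ≤ c i.succ ∧ ((c i.castSucc).subgroupOf (c i.succ)).Normal ∧
      (IsPiNumber σ (Nat.card (↥(c i.succ) ⧸ (c i.castSucc).subgroupOf (c i.succ))) ∨
        IsPiNumber σᶜ (Nat.card (↥(c i.succ) ⧸ (c i.castSucc).subgroupOf (c i.succ))))

/-- `G` is `p`-solvable: every composition factor is a `p`-group or a `p'`-group. -/
def IsPSolvable (p : ℕ) (G : Type) [Group G] : Prop :=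
  IsPiSeparable {p} G

/-- The character `δ` of the subgroup `Q` is invariant under (conjugation by the
elements of) the subgroup `S`. -/
def InvariantUnder {G : Type} [Group G] (Q : Subgroup G) (δ : ↥Q → ℂ) (S : Subgroup G) : Prop :=
  ∀ g ∈ S, ∀ x : ↥Q, ∀ h : g * (x : G) * g⁻¹ ∈ Q, δ ⟨g * (x : G) * g⁻¹, h⟩ = δ x

/-- `(Q, δ)` is a vertex pair for `χ ∈ Irr(G)` (at the prime `p`): `Q` is a `p`-subgroup
of `G`, `δ ∈ Irr(Q)`, and there are a subgroup `U ≤ G` and an irreducible character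
`ψ = αβ` of `U` with `α` `p'`-special and `β` `p`-special, such that `ψ^G = χ`, `Q` is a
Sylow `p`-subgroup of `U`, and `β_Q = δ`. -/
def IsVertexPair (p : ℕ) {G : Type} [Group G] [Fintype G] (χ : G → ℂ)
    (Q : Subgroup G) (δ : ↥Q → ℂ) : Prop :=
  IsPGroup p ↥Q ∧ IsIrrChar ↥Q δ ∧
    ∃ (U : Subgroup G) (hQU : Q ≤ U) (α β : ↥U → ℂ),
      IsPiSpecial ({p}ᶜ) ↥U α ∧ IsPiSpecial {p} ↥U β ∧
      IsIrrChar ↥U (α * β) ∧ indChar U (α * β) = χ ∧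
      ¬ p ∣ (Q.subgroupOf U).index ∧
      ∀ x : ↥Q, δ x = β ⟨(x : G), hQU x.2⟩

/-- `(Q, δ)` is a generalized `σ`-vertex for `χ ∈ Irr(G)`: there are `U ≤ G` and an
irreducible `ψ = αβ ∈ Irr(U)` with `α` `σ`-special and `β` `σ'`-special such that
`ψ^G = χ`, `Q` is a Hall `σ'`-subgroup of `U` and `δ = β_Q`. -/
def IsGenPiVertex (σ : Set ℕ) {G : Type} [Group G] [Fintype G] (χ : G → ℂ)
    (Q : Subgroup G) (δ : ↥Q → ℂ) : Prop :=
  ∃ (U : Subgroup G) (hQU : Q ≤ U) (α β : ↥U → ℂ),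
    IsPiSpecial σ ↥U α ∧ IsPiSpecial σᶜ ↥U β ∧
    IsIrrChar ↥U (α * β) ∧ indChar U (α * β) = χ ∧
    IsPiNumber σᶜ (Nat.card ↥Q) ∧ IsPiNumber σ ((Q.subgroupOf U).index) ∧
    ∀ x : ↥Q, δ x = β ⟨(x : G), hQU x.2⟩

/-- The pair `(Q₂, δ₂)` is the conjugate of the pair `(Q₁, δ₁)` by the element `g`. -/
def IsConjPair {G : Type} [Group G] (g : G)
    (Q₁ : Subgroup G) (δ₁ : ↥Q₁ → ℂ) (Q₂ : Subgroup G) (δ₂ : ↥Q₂ → ℂ) : Prop :=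
  Q₂ = Subgroup.map (MulAut.conj g).toMonoidHom Q₁ ∧
    ∀ x : ↥Q₁, ∀ h : g * (x : G) * g⁻¹ ∈ Q₂, δ₂ ⟨g * (x : G) * g⁻¹, h⟩ = δ₁ x

/-- `Q` is a vertex (subgroup) of the irreducible `σ`-partial character `φ` of `G`:
`Q` is a Hall `σ'`-subgroup of a subgroup `U ≤ G` possessing an irreducible `σ`-partial
character `κ` of `σ`-degree with `κ^G = φ`. -/
def IsVertexSubgroup (σ : Set ℕ) {G : Type} [Group G] [Fintype G] (φ : G → ℂ)
    (Q : Subgroup G) : Prop :=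
  ∃ (U : Subgroup G) (κ : ↥U → ℂ), Q ≤ U ∧
    IsPiNumber σᶜ (Nat.card ↥Q) ∧ IsPiNumber σ ((Q.subgroupOf U).index) ∧
    IsIPiChar σ ↥U κ ∧ (∃ n : ℕ, κ 1 = (n : ℂ) ∧ IsPiNumber σ n) ∧
    indChar U κ = φ

/-- `θ ∈ I_σ(M)` is an irreducible constituent of the restriction `φ_M`. -/
def IsIPiConstituent (σ : Set ℕ) {G : Type} [Group G] (M : Subgroup G)
    (θ : ↥M → ℂ) (φ : G → ℂ) : Prop :=
  IsIPiChar σ ↥M θ ∧ ∃ ξ : ↥M → ℂ, (ξ = 0 ∨ IsPartialChar σ ↥M ξ) ∧ resChar M φ = θ + ξ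

set_option linter.unusedSectionVars false

section Basic

variable {G : Type} [Group G]

theorem IsCharacter.of_rep {V : Type} [AddCommGroup V] [Module ℂ V] [Module.Finite ℂ V]
    (ρ : Representation ℂ G V) : IsCharacter G ρ.character :=
  ⟨FDRep.of ρ, fun _ => rfl⟩

theorem IsCharacter.exists_rep {χ : G → ℂ} (h : IsCharacter G χ) :
    ∃ (V : Type) (_ : AddCommGroup V) (_ : Module ℂ V) (_ : Module.Finite ℂ V)
      (ρ : Representation ℂ G V), χ = ρ.character := by
  obtain ⟨V, hV⟩ := h
  exact ⟨V, inferInstance, inferInstance, inferInstance, V.ρ, funext hV⟩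

theorem IsCharacter.of_matrix {ι : Type} [Fintype ι] [DecidableEq ι]
    (R : G →* Matrix ι ι ℂ) : IsCharacter G (fun g => (R g).trace) := by
  have := IsCharacter.of_rep (G := G) (V := ι → ℂ)
    ((Matrix.toLinAlgEquiv' (R := ℂ) (n := ι) : Matrix ι ι ℂ →* ((ι → ℂ) →ₗ[ℂ] (ι → ℂ))).comp R)
  convert this using 2 with g
  exact (Matrix.trace_toLin'_eq (R g)).symm

theorem IsCharacter.exists_matrix {χ : G → ℂ} (h : IsCharacter G χ) :
    ∃ (n : ℕ) (R : G →* Matrix (Fin n) (Fin n) ℂ), ∀ g, χ g = (R g).trace := by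
  obtain ⟨V, _, _, _, ρ, rfl⟩ := h.exists_rep
  let b := Module.finBasis ℂ V
  refine ⟨_, ((LinearMap.toMatrixAlgEquiv b : (V →ₗ[ℂ] V) ≃ₐ[ℂ] _) :
    (V →ₗ[ℂ] V) →* Matrix (Fin (Module.finrank ℂ V)) (Fin (Module.finrank ℂ V)) ℂ).comp ρ, fun g => ?_⟩
  simp [Representation.character, LinearMap.trace_eq_matrix_trace ℂ b, LinearMap.toMatrixAlgEquiv]

theorem IsCharacter.conj {χ : G → ℂ} (h : IsCharacter G χ) (x g : G) :
    χ (x * g * x⁻¹) = χ g := by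
  obtain ⟨V, _, _, _, ρ, rfl⟩ := h.exists_rep
  exact ρ.char_conj g x

theorem IsCharacter.exists_degree {χ : G → ℂ} (h : IsCharacter G χ) :
    ∃ n : ℕ, χ 1 = n := by
  obtain ⟨V, _, _, _, ρ, rfl⟩ := h.exists_rep
  exact ⟨_, ρ.char_one⟩

theorem IsCharacter.eq_zero_of_degree {χ : G → ℂ} (h : IsCharacter G χ) (h1 : χ 1 = 0) :
    χ = 0 := by
  obtain ⟨V, _, _, _, ρ, rfl⟩ := h.exists_rep
  rw [ρ.char_one] at h1
  have : Subsingleton V := Module.finrank_zero_iff.1 (by exact_mod_cast h1)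
  funext g
  rw [Representation.character, Subsingleton.elim (ρ g) 0]
  simp

theorem isCharacter_zero : IsCharacter G (0 : G → ℂ) := by
  convert IsCharacter.of_rep (Representation.trivial ℂ G (Fin 0 → ℂ)) using 1
  funext g
  simp [Representation.character]

theorem IsCharacter.add {χ ψ : G → ℂ} (h : IsCharacter G χ) (h' : IsCharacter G ψ) :
    IsCharacter G (χ + ψ) := by
  obtain ⟨V, _, _, _, ρ, rfl⟩ := h.exists_rep
  obtain ⟨W, _, _, _, τ, rfl⟩ := h'.exists_rep
  convert IsCharacter.of_rep (ρ.prod τ) using 1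
  funext g
  exact (LinearMap.trace_prodMap' (ρ g) (τ g)).symm

theorem IsCharacter.mul {χ ψ : G → ℂ} (h : IsCharacter G χ) (h' : IsCharacter G ψ) :
    IsCharacter G (χ * ψ) := by
  obtain ⟨V, _, _, _, ρ, rfl⟩ := h.exists_rep
  obtain ⟨W, _, _, _, τ, rfl⟩ := h'.exists_rep
  rw [← Representation.char_tensor]
  exact IsCharacter.of_rep _

theorem IsCharacter.dual {χ : G → ℂ} (h : IsCharacter G χ) :
    IsCharacter G (fun g => χ g⁻¹) := by
  obtain ⟨V, _, _, _, ρ, rfl⟩ := h.exists_rep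
  convert IsCharacter.of_rep ρ.dual using 1
  funext g
  exact (ρ.char_dual g).symm

theorem IsCharacter.comp {H : Type} [Group H] {χ : G → ℂ} (h : IsCharacter G χ) (f : H →* G) :
    IsCharacter H (χ ∘ f) := by
  obtain ⟨V, _, _, _, ρ, rfl⟩ := h.exists_rep
  exact IsCharacter.of_rep (ρ.comp f)

theorem isCharacter_linear (l : G →* ℂ) : IsCharacter G (l : G → ℂ) := by
  have := IsCharacter.of_matrix (ι := Fin 1) (G := G)
    ((Matrix.scalar (Fin 1) : ℂ →+* Matrix (Fin 1) (Fin 1) ℂ).toMonoidHom.comp l)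
  convert this using 1
  funext g
  simp

theorem IsCharacter.galois {χ : G → ℂ} (h : IsCharacter G χ) (s : ℂ →+* ℂ) :
    IsCharacter G (s ∘ χ) := by
  obtain ⟨n, R, hR⟩ := h.exists_matrix
  convert IsCharacter.of_matrix (s.mapMatrix.toMonoidHom.comp R) using 1
  funext g
  simp [hR, Matrix.trace, map_sum]

theorem IsCharacter.sum {ι : Type*} (S : Finset ι) {f : ι → G → ℂ}
    (h : ∀ i ∈ S, IsCharacter G (f i)) : IsCharacter G (∑ i ∈ S, f i) := by
  induction S using Finset.induction_on with
  | empty => simpa using isCharacter_zero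
  | insert a S ha ih =>
    rw [Finset.sum_insert ha]
    exact (h _ (Finset.mem_insert_self _ _)).add
      (ih fun i hi => h i (Finset.mem_insert_of_mem hi))

theorem IsCharacter.nsmul {χ : G → ℂ} (h : IsCharacter G χ) (n : ℕ) :
    IsCharacter G (n • χ) := by
  have := IsCharacter.sum (Finset.range n) (f := fun _ => χ) (fun _ _ => h)
  simpa using this

/-- A commuting idempotent cuts out a character. -/
theorem isCharacter_of_idempotent {V : Type} [AddCommGroup V] [Module ℂ V] [Module.Finite ℂ V]
    (ρ : Representation ℂ G V) (e : V →ₗ[ℂ] V) (he : e ∘ₗ e = e)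
    (hc : ∀ g, ρ g ∘ₗ e = e ∘ₗ ρ g) :
    IsCharacter G (fun g => LinearMap.trace ℂ V (ρ g ∘ₗ e)) := by
  have hm : ∀ g, ∀ x ∈ LinearMap.range e, ρ g x ∈ LinearMap.range e := by
    rintro g _ ⟨y, rfl⟩
    exact ⟨ρ g y, (LinearMap.congr_fun (hc g) y).symm⟩
  let τ : Representation ℂ G (LinearMap.range e) :=
    { toFun := fun g => (ρ g).restrict (hm g)
      map_one' := by ext x; simp
      map_mul' := fun g h => by ext x; simp [LinearMap.restrict_apply] }
  convert IsCharacter.of_rep τ using 2 with g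
  have h1 : (LinearMap.range e).subtype ∘ₗ (τ g ∘ₗ e.rangeRestrict) = ρ g ∘ₗ e := by
    ext x; rfl
  have h2 : (τ g ∘ₗ e.rangeRestrict) ∘ₗ (LinearMap.range e).subtype = τ g := by
    ext ⟨x, y, rfl⟩
    change ρ g (e (e y)) = ρ g (e y)
    exact congrArg (ρ g) (LinearMap.congr_fun he y)
  rw [← h1, LinearMap.trace_comp_comm', h2]
  rfl

end Basic

/-- The usual bilinear form on functions of a finite group. -/
def cinner {G : Type} [Group G] (a b : G → ℂ) : ℂ :=
  (Nat.card G : ℂ)⁻¹ * ∑ᶠ g, a g * b g⁻¹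

section Inner

variable {G : Type} [Group G] 

theorem cinner_eq [Fintype G] (a b : G → ℂ) :
    cinner a b = (Nat.card G : ℂ)⁻¹ * ∑ g, a g * b g⁻¹ := by
  rw [cinner, finsum_eq_sum_of_fintype]

theorem cinner_comm [Finite G] (a b : G → ℂ) : cinner a b = cinner b a := by
  have := Fintype.ofFinite G
  rw [cinner_eq, cinner_eq]
  congr 1
  refine Fintype.sum_equiv (Equiv.inv G) _ _ fun g => ?_
  simp [mul_comm]

theorem cinner_add_left [Finite G] (a b c : G → ℂ) :
    cinner (a + b) c = cinner a c + cinner b c := by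
  have := Fintype.ofFinite G
  simp only [cinner_eq, Pi.add_apply, add_mul, Finset.sum_add_distrib, mul_add]

theorem cinner_add_right [Finite G] (a b c : G → ℂ) :
    cinner a (b + c) = cinner a b + cinner a c := by
  rw [cinner_comm, cinner_add_left, cinner_comm b, cinner_comm c]

theorem cinner_smul_left [Finite G] (z : ℂ) (a b : G → ℂ) :
    cinner (z • a) b = z * cinner a b := by
  have := Fintype.ofFinite G
  simp only [cinner_eq, Pi.smul_apply, smul_eq_mul, mul_assoc, ← Finset.mul_sum]
  ring

theorem cinner_zero_left [Finite G] (b : G → ℂ) : cinner 0 b = 0 := by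
  have := Fintype.ofFinite G
  simp [cinner_eq]

theorem cinner_zero_right [Finite G] (b : G → ℂ) : cinner b 0 = 0 := by
  rw [cinner_comm, cinner_zero_left]

theorem cinner_sum_left [Finite G] {ι : Type*} (S : Finset ι) (f : ι → G → ℂ) (b : G → ℂ) :
    cinner (∑ i ∈ S, f i) b = ∑ i ∈ S, cinner (f i) b := by
  induction S using Finset.induction_on with
  | empty => simp [cinner_zero_left]
  | insert a S ha ih => rw [Finset.sum_insert ha, cinner_add_left, ih, Finset.sum_insert ha]

theorem cinner_galois [Finite G] (s : ℂ →+* ℂ) (a b : G → ℂ) :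
    cinner (s ∘ a) (s ∘ b) = s (cinner a b) := by
  have := Fintype.ofFinite G
  simp [cinner_eq]

theorem cinner_equiv [Finite G] {H : Type} [Group H] (f : H ≃* G) (a b : G → ℂ) :
    cinner (a ∘ f) (b ∘ f) = cinner a b := by
  have := Fintype.ofFinite G
  have : Finite H := Finite.of_equiv _ f.toEquiv.symm
  have := Fintype.ofFinite H
  rw [cinner_eq, cinner_eq, Nat.card_congr f.toEquiv]
  congr 1
  refine Fintype.sum_equiv f.toEquiv _ _ fun g => ?_
  simp

theorem cinner_nat [Finite G] {a b : G → ℂ} (ha : IsCharacter G a) (hb : IsCharacter G b) :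
    ∃ n : ℕ, cinner a b = n := by
  have := Fintype.ofFinite G
  obtain ⟨V, _, _, _, ρ, rfl⟩ := ha.exists_rep
  obtain ⟨W, _, _, _, τ, rfl⟩ := hb.exists_rep
  have : Invertible (Nat.card G : ℂ) := invertibleOfNonzero (by simp)
  exact ⟨_, by rw [cinner_eq]; exact Representation.card_inv_mul_sum_char_mul_char_eq_finrank τ ρ⟩

end Inner

section Irr

variable {G : Type} [Group G]

section Compl

variable {V : Type} [AddCommGroup V] [Module ℂ V] (ρ : Representation ℂ G V)

theorem Subrepresentation.exists_conj_prodMap {p q : Subrepresentation ρ} (h : IsCompl p q) :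
    ∃ E : (p.toSubmodule × q.toSubmodule) ≃ₗ[ℂ] V, ∀ g,
      ρ g = E.conj ((p.toRepresentation g).prodMap (q.toRepresentation g)) := by
  have h' : IsCompl p.toSubmodule q.toSubmodule := by
    constructor
    · rw [disjoint_iff, ← Subrepresentation.toSubmodule_inf, h.inf_eq_bot]; rfl
    · rw [codisjoint_iff, ← Subrepresentation.toSubmodule_sup, h.sup_eq_top]; rfl
  refine ⟨Submodule.prodEquivOfIsCompl _ _ h', fun g => ?_⟩
  ext v
  obtain ⟨⟨a, b⟩, rfl⟩ := (Submodule.prodEquivOfIsCompl _ _ h').surjective v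
  simp [LinearEquiv.conj_apply, Submodule.coe_prodEquivOfIsCompl', Subrepresentation.toRepresentation]

theorem Subrepresentation.character_eq_add [Module.Finite ℂ V] {p q : Subrepresentation ρ}
    (h : IsCompl p q) :
    ρ.character = p.toRepresentation.character + q.toRepresentation.character := by
  obtain ⟨E, hE⟩ := Subrepresentation.exists_conj_prodMap ρ h
  funext g
  rw [Representation.character, hE, LinearMap.trace_conj', LinearMap.trace_prodMap']
  rfl

end Compl

theorem IsIrrChar.ne_zero {χ : G → ℂ} (h : IsIrrChar G χ) : χ ≠ 0 := h.2.1

theorem Representation.character_ne_zero {V : Type} [AddCommGroup V] [Module ℂ V]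
    [Module.Finite ℂ V] [Nontrivial V] (ρ : Representation ℂ G V) : ρ.character ≠ 0 := by
  intro h
  have := congrFun h 1
  rw [ρ.char_one, Pi.zero_apply] at this
  have h2 : Module.finrank ℂ V = 0 := by exact_mod_cast this
  exact absurd (Module.finrank_zero_iff.1 h2) (not_subsingleton V)

instance neZero_natCard [Finite G] : NeZero (Nat.card G : ℂ) :=
  ⟨Nat.cast_ne_zero.2 Nat.card_pos.ne'⟩

theorem Representation.isIrreducible_of_isIrrChar [Finite G] {V : Type} [AddCommGroup V]
    [Module ℂ V] [Module.Finite ℂ V] (ρ : Representation ℂ G V) (h : IsIrrChar G ρ.character) :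
    ρ.IsIrreducible := by
  have hV : Nontrivial V := by
    by_contra hV
    rw [not_nontrivial_iff_subsingleton] at hV
    refine h.2.1 (IsCharacter.eq_zero_of_degree h.1 ?_)
    rw [ρ.char_one, Module.finrank_zero_of_subsingleton, Nat.cast_zero]
  have hne : (⊥ : Subrepresentation ρ) ≠ ⊤ := fun hbt =>
    bot_ne_top (α := Submodule ℂ V) (congrArg Subrepresentation.toSubmodule hbt)
  have aux : ∀ p : Subrepresentation ρ, p ≠ ⊥ → p.toRepresentation.character ≠ 0 := by
    intro p hp
    have : Nontrivial p.toSubmodule := by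
      rw [Submodule.nontrivial_iff_ne_bot]
      intro hb
      exact hp (Subrepresentation.toSubmodule_injective hb)
    exact Representation.character_ne_zero _
  refine { exists_pair_ne := ⟨_, _, hne⟩, eq_bot_or_eq_top := fun p => ?_ }
  obtain ⟨q, hq⟩ := exists_isCompl p
  by_contra! hp
  have hqb : q ≠ ⊥ := by
    rintro rfl
    exact hp.2 (eq_top_of_isCompl_bot hq)
  exact h.2.2 ⟨_, _, IsCharacter.of_rep _, aux p hp.1, IsCharacter.of_rep _, aux q hqb,
    Subrepresentation.character_eq_add ρ hq⟩

theorem IsIrrChar.exists_rep [Finite G] {χ : G → ℂ} (h : IsIrrChar G χ) :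
    ∃ (V : Type) (_ : AddCommGroup V) (_ : Module ℂ V) (_ : Module.Finite ℂ V)
      (ρ : Representation ℂ G V), ρ.IsIrreducible ∧ χ = ρ.character := by
  obtain ⟨V, _, _, _, ρ, rfl⟩ := h.1.exists_rep
  exact ⟨V, inferInstance, inferInstance, inferInstance, ρ, ρ.isIrreducible_of_isIrrChar h, rfl⟩

theorem IsIrrChar.cinner_self [Finite G] {χ : G → ℂ} (h : IsIrrChar G χ) : cinner χ χ = 1 := by
  have := Fintype.ofFinite G
  obtain ⟨V, _, _, _, ρ, hρ, rfl⟩ := h.exists_rep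
  have : Invertible (Nat.card G : ℂ) := invertibleOfNonzero (NeZero.ne _)
  rw [cinner_eq]
  exact (Representation.char_orthonormal ρ ρ).trans (if_pos ⟨Representation.Equiv.refl _⟩)

theorem IsIrrChar.cinner_of_ne [Finite G] {χ ψ : G → ℂ} (h : IsIrrChar G χ) (h' : IsIrrChar G ψ)
    (hne : χ ≠ ψ) : cinner χ ψ = 0 := by
  have := Fintype.ofFinite G
  obtain ⟨V, _, _, _, ρ, hρ, rfl⟩ := h.exists_rep
  obtain ⟨W, _, _, _, τ, hτ, rfl⟩ := h'.exists_rep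
  have : Invertible (Nat.card G : ℂ) := invertibleOfNonzero (NeZero.ne _)
  rw [cinner_eq]
  exact (Representation.char_orthonormal ρ τ).trans
    (if_neg fun ⟨e⟩ => hne (Representation.char_iso e).symm)

theorem IsIrrChar.eq_of_cinner_ne_zero [Finite G] {χ ψ : G → ℂ} (h : IsIrrChar G χ)
    (h' : IsIrrChar G ψ) (hne : cinner χ ψ ≠ 0) : χ = ψ := by
  by_contra hc
  exact hne (h.cinner_of_ne h' hc)

theorem IsCharacter.exists_degree_pos {χ : G → ℂ} (h : IsCharacter G χ) (h0 : χ ≠ 0) :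
    ∃ n : ℕ, 0 < n ∧ χ 1 = n := by
  obtain ⟨n, hn⟩ := h.exists_degree
  refine ⟨n, Nat.pos_of_ne_zero ?_, hn⟩
  rintro rfl
  exact h0 (h.eq_zero_of_degree (by simpa using hn))

theorem IsCharacter.eq_irr_add {χ : G → ℂ} (h : IsCharacter G χ) (h0 : χ ≠ 0) :
    ∃ θ ξ, IsIrrChar G θ ∧ IsCharacter G ξ ∧ χ = θ + ξ := by
  obtain ⟨n, hn⟩ := h.exists_degree
  induction n using Nat.strong_induction_on generalizing χ with
  | _ n ih =>
    by_cases hi : IsIrrChar G χ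
    · exact ⟨χ, 0, hi, isCharacter_zero, by simp⟩
    · have : ∃ χ₁ χ₂ : G → ℂ, IsCharacter G χ₁ ∧ χ₁ ≠ 0 ∧ IsCharacter G χ₂ ∧ χ₂ ≠ 0 ∧
          χ = χ₁ + χ₂ := by
        by_contra hc
        exact hi ⟨h, h0, hc⟩
      obtain ⟨a, b, ha, ha0, hb, hb0, rfl⟩ := this
      obtain ⟨m, hm, hm'⟩ := ha.exists_degree_pos ha0
      obtain ⟨k, hk, hk'⟩ := hb.exists_degree_pos hb0
      have : m + k = n := by
        rw [Pi.add_apply, hm', hk'] at hn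
        exact_mod_cast hn
      obtain ⟨θ, ξ, hθ, hξ, rfl⟩ := ih m (by omega) ha ha0 hm'
      exact ⟨θ, ξ + b, hθ, hξ.add hb, by rw [add_assoc]⟩

/-- Induction on characters by peeling off irreducible constituents. -/
theorem IsCharacter.induction {P : (G → ℂ) → Prop} (h0 : P 0)
    (hadd : ∀ θ ξ, IsIrrChar G θ → IsCharacter G ξ → P ξ → P (θ + ξ))
    {χ : G → ℂ} (h : IsCharacter G χ) : P χ := by
  obtain ⟨n, hn⟩ := h.exists_degree
  induction n using Nat.strong_induction_on generalizing χ with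
  | _ n ih =>
    by_cases hχ : χ = 0
    · rwa [hχ]
    · obtain ⟨θ, ξ, hθ, hξ, rfl⟩ := h.eq_irr_add hχ
      obtain ⟨m, hm, hm'⟩ := hθ.1.exists_degree_pos hθ.2.1
      obtain ⟨k, hk⟩ := hξ.exists_degree
      have : m + k = n := by
        rw [Pi.add_apply, hm', hk] at hn
        exact_mod_cast hn
      exact hadd _ _ hθ hξ (ih k (by omega) hξ hk)

theorem IsCharacter.eq_add_of_cinner_ne_zero [Finite G] {ω χ : G → ℂ} (h : IsCharacter G ω)
    (hχ : IsIrrChar G χ) (hne : cinner ω χ ≠ 0) : ∃ ξ, IsCharacter G ξ ∧ ω = χ + ξ := by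
  revert hne
  refine IsCharacter.induction (P := fun ω => cinner ω χ ≠ 0 → ∃ ξ, IsCharacter G ξ ∧ ω = χ + ξ)
    ?_ ?_ h
  · intro h; exact absurd (cinner_zero_left _) h
  · intro θ ξ hθ hξ ih hne
    by_cases he : θ = χ
    · exact ⟨ξ, hξ, by rw [he]⟩
    · rw [cinner_add_left, hθ.cinner_of_ne hχ he, zero_add] at hne
      obtain ⟨ζ, hζ, rfl⟩ := ih hne
      exact ⟨θ + ζ, hθ.1.add hζ, by abel⟩

theorem IsCharacter.cinner_self_pos [Finite G] {χ : G → ℂ} (h : IsCharacter G χ) (h0 : χ ≠ 0) :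
    ∃ n : ℕ, 0 < n ∧ cinner χ χ = n := by
  obtain ⟨θ, ξ, hθ, hξ, rfl⟩ := h.eq_irr_add h0
  obtain ⟨a, ha⟩ := cinner_nat hθ.1 hξ
  obtain ⟨b, hb⟩ := cinner_nat hξ hξ
  refine ⟨1 + a + (a + b), by omega, ?_⟩
  rw [cinner_add_left, cinner_add_right, cinner_add_right, cinner_comm ξ θ, ha, hb,
    hθ.cinner_self]
  push_cast; ring

theorem isIrrChar_iff [Finite G] {χ : G → ℂ} :
    IsIrrChar G χ ↔ IsCharacter G χ ∧ cinner χ χ = 1 := by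
  refine ⟨fun h => ⟨h.1, h.cinner_self⟩, fun ⟨h, h1⟩ => ⟨h, ?_, ?_⟩⟩
  · rintro rfl
    rw [cinner_zero_left] at h1
    exact zero_ne_one h1
  · rintro ⟨a, b, ha, ha0, hb, hb0, rfl⟩
    obtain ⟨m, hm, hm'⟩ := ha.cinner_self_pos ha0
    obtain ⟨k, hk, hk'⟩ := hb.cinner_self_pos hb0
    obtain ⟨c, hc⟩ := cinner_nat ha hb
    rw [cinner_add_left, cinner_add_right, cinner_add_right, cinner_comm b a, hc, hm', hk'] at h1
    have : m + c + (c + k) = 1 := by exact_mod_cast h1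
    omega

theorem IsCharacter.exists_constituent [Finite G] {χ : G → ℂ} (h : IsCharacter G χ)
    (h0 : χ ≠ 0) : ∃ θ, IsIrrChar G θ ∧ cinner χ θ ≠ 0 := by
  obtain ⟨θ, ξ, hθ, hξ, rfl⟩ := h.eq_irr_add h0
  refine ⟨θ, hθ, ?_⟩
  obtain ⟨a, ha⟩ := cinner_nat hξ hθ.1
  rw [cinner_add_left, hθ.cinner_self, ha]
  norm_cast
  omega

/-- A common constituent exists when the inner product does not vanish. -/
theorem IsCharacter.exists_common [Finite G] {χ ω : G → ℂ} (h : IsCharacter G χ)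
    (h0 : cinner χ ω ≠ 0) :
    ∃ θ, IsIrrChar G θ ∧ cinner χ θ ≠ 0 ∧ cinner ω θ ≠ 0 := by
  revert h0
  refine IsCharacter.induction (P := fun χ => cinner χ ω ≠ 0 → ∃ θ, IsIrrChar G θ ∧
    cinner χ θ ≠ 0 ∧ cinner ω θ ≠ 0) (fun h => absurd (cinner_zero_left _) h) ?_ h
  intro θ ξ hθ hξ ih hne
  by_cases h1 : cinner θ ω = 0
  · rw [cinner_add_left, h1, zero_add] at hne
    obtain ⟨κ, hκ, h2, h3⟩ := ih hne
    refine ⟨κ, hκ, ?_, h3⟩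
    obtain ⟨a, ha⟩ := cinner_nat hθ.1 hκ.1
    obtain ⟨b, hb⟩ := cinner_nat hξ hκ.1
    rw [hb] at h2
    rw [cinner_add_left, ha, hb]
    norm_cast at *
    omega
  · refine ⟨θ, hθ, ?_, by rwa [cinner_comm]⟩
    obtain ⟨b, hb⟩ := cinner_nat hξ hθ.1
    rw [cinner_add_left, hθ.cinner_self, hb]
    norm_cast
    omega

theorem IsIrrChar.comp_equiv [Finite G] {H : Type} [Group H] {χ : G → ℂ} (h : IsIrrChar G χ)
    (f : H ≃* G) : IsIrrChar H (χ ∘ f) := by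
  have : Finite H := Finite.of_equiv _ f.toEquiv.symm
  rw [isIrrChar_iff] at h ⊢
  exact ⟨h.1.comp f.toMonoidHom, by rw [cinner_equiv, h.2]⟩

theorem IsIrrChar.galois [Finite G] {χ : G → ℂ} (h : IsIrrChar G χ) (s : ℂ →+* ℂ) :
    IsIrrChar G (s ∘ χ) := by
  rw [isIrrChar_iff] at h ⊢
  exact ⟨h.1.galois s, by rw [cinner_galois, h.2, map_one]⟩

theorem IsIrrChar.exists_degree {χ : G → ℂ} (h : IsIrrChar G χ) : ∃ n : ℕ, 0 < n ∧ χ 1 = n :=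
  h.1.exists_degree_pos h.2.1

theorem IsIrrChar.degree_ne_zero {χ : G → ℂ} (h : IsIrrChar G χ) : χ 1 ≠ 0 := by
  obtain ⟨n, hn, h1⟩ := h.exists_degree
  rw [h1]; exact_mod_cast hn.ne'

theorem isConstituent_iff [Finite G] {θ χ : G → ℂ} (h : IsCharacter G χ) :
    IsConstituent θ χ ↔ IsIrrChar G θ ∧ cinner χ θ ≠ 0 := by
  constructor
  · rintro ⟨hθ, ξ, hξ, rfl⟩
    refine ⟨hθ, ?_⟩
    have hξ : IsCharacter G ξ := by
      rcases hξ with rfl | hξ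
      · exact isCharacter_zero
      · exact hξ
    obtain ⟨b, hb⟩ := cinner_nat hξ hθ.1
    rw [cinner_add_left, hθ.cinner_self, hb]
    norm_cast
    omega
  · rintro ⟨hθ, hne⟩
    obtain ⟨ξ, hξ, rfl⟩ := h.eq_add_of_cinner_ne_zero hθ hne
    exact ⟨hθ, ξ, Or.inr hξ, rfl⟩

/-- A class-function equality test: irreducible character below a character of equal degree. -/
theorem IsCharacter.eq_of_degree [Finite G] {ω χ : G → ℂ} (h : IsCharacter G ω)
    (hχ : IsIrrChar G χ) (hne : cinner ω χ ≠ 0) (h1 : ω 1 = χ 1) : ω = χ := by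
  obtain ⟨ξ, hξ, rfl⟩ := h.eq_add_of_cinner_ne_zero hχ hne
  have : ξ = 0 := hξ.eq_zero_of_degree (by simpa using h1)
  simp [this]

end Irr

section Deg

variable {G : Type} [Group G]

/-- The degree of a character, as a natural number. -/
def cdeg (χ : G → ℂ) : ℕ := ⌊(χ 1).re⌋₊

theorem cdeg_eq_of {χ : G → ℂ} {n : ℕ} (h : χ 1 = n) : cdeg χ = n := by
  simp [cdeg, h]

theorem IsCharacter.apply_one {χ : G → ℂ} (h : IsCharacter G χ) : χ 1 = cdeg χ := by
  obtain ⟨n, hn⟩ := h.exists_degree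
  rw [cdeg_eq_of hn, hn]

theorem IsIrrChar.cdeg_pos {χ : G → ℂ} (h : IsIrrChar G χ) : 0 < cdeg χ := by
  obtain ⟨n, hn, h1⟩ := h.exists_degree
  rwa [cdeg_eq_of h1]

theorem IsCharacter.ext_cinner [Finite G] {ω ω' : G → ℂ} (h : IsCharacter G ω)
    (h' : IsCharacter G ω') (he : ∀ κ, IsIrrChar G κ → cinner ω κ = cinner ω' κ) : ω = ω' := by
  revert ω'
  refine IsCharacter.induction (P := fun ω => ∀ {ω'}, IsCharacter G ω' →
    (∀ κ, IsIrrChar G κ → cinner ω κ = cinner ω' κ) → ω = ω') ?_ ?_ h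
  · intro ω' h' he
    by_contra hne
    obtain ⟨θ, hθ, h1⟩ := h'.exists_constituent (Ne.symm hne)
    rw [← he θ hθ, cinner_zero_left] at h1
    exact h1 rfl
  · intro θ ξ hθ hξ ih ω' h' he
    have h1 : cinner ω' θ ≠ 0 := by
      obtain ⟨n, hn⟩ := cinner_nat hξ hθ.1
      rw [← he θ hθ, cinner_add_left, hθ.cinner_self, hn]
      norm_cast
      omega
    obtain ⟨ξ', hξ', rfl⟩ := h'.eq_add_of_cinner_ne_zero hθ h1
    rw [ih hξ' fun κ hκ => ?_]
    have := he κ hκ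
    rw [cinner_add_left, cinner_add_left] at this
    exact add_left_cancel this

/-- Constituents of a constituent. -/
theorem IsCharacter.cinner_add_ne_zero_left [Finite G] {ω ω' κ : G → ℂ} (h : IsCharacter G ω)
    (h' : IsCharacter G ω') (hκ : IsCharacter G κ) (hne : cinner ω κ ≠ 0) :
    cinner (ω + ω') κ ≠ 0 := by
  obtain ⟨a, ha⟩ := cinner_nat h hκ
  obtain ⟨b, hb⟩ := cinner_nat h' hκ
  rw [ha] at hne
  rw [cinner_add_left, ha, hb]
  norm_cast at *
  omega

theorem cinner_comp_ne_zero {A B : Type} [Group A] [Group B] [Finite A] [Finite B] (f : A →* B)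
    {ω χ : B → ℂ} {θ : A → ℂ} (h : IsCharacter B ω) (hχ : IsIrrChar B χ) (hne : cinner ω χ ≠ 0)
    (hθ : IsCharacter A θ) (h1 : cinner (χ ∘ f) θ ≠ 0) : cinner (ω ∘ f) θ ≠ 0 := by
  obtain ⟨ξ, hξ, rfl⟩ := h.eq_add_of_cinner_ne_zero hχ hne
  exact (hχ.1.comp f).cinner_add_ne_zero_left (hξ.comp f) hθ h1

theorem IsIrrChar.exists_comp {A B : Type} [Group A] [Group B] [Finite A] (f : A →* B)
    {χ : B → ℂ} (hχ : IsIrrChar B χ) : ∃ θ, IsIrrChar A θ ∧ cinner (χ ∘ f) θ ≠ 0 := by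
  refine (hχ.1.comp f).exists_constituent fun h => hχ.degree_ne_zero ?_
  simpa using congrFun h 1

/-- An irreducible character of the subgroup lies under a constituent of any character lying
above it. -/
theorem IsCharacter.exists_over {A B : Type} [Group A] [Group B] [Finite A] [Finite B]
    (f : A →* B) {ω : B → ℂ} {θ : A → ℂ} (h : IsCharacter B ω) (hne : cinner (ω ∘ f) θ ≠ 0) :
    ∃ χ, IsIrrChar B χ ∧ cinner ω χ ≠ 0 ∧ cinner (χ ∘ f) θ ≠ 0 := by
  revert hne
  refine IsCharacter.induction (P := fun ω => cinner (ω ∘ f) θ ≠ 0 → ∃ χ, IsIrrChar B χ ∧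
    cinner ω χ ≠ 0 ∧ cinner (χ ∘ f) θ ≠ 0) (fun h => absurd (cinner_zero_left _) h) ?_ h
  intro χ ξ hχ hξ ih hne
  by_cases h1 : cinner (χ ∘ f) θ = 0
  · have : (χ + ξ) ∘ f = χ ∘ f + ξ ∘ f := rfl
    rw [this, cinner_add_left, h1, zero_add] at hne
    obtain ⟨κ, hκ, h2, h3⟩ := ih hne
    refine ⟨κ, hκ, ?_, h3⟩
    rw [add_comm]
    exact hξ.cinner_add_ne_zero_left hχ.1 hκ.1 h2
  · refine ⟨χ, hχ, hχ.1.cinner_add_ne_zero_left hξ hχ.1 ?_, h1⟩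
    rw [hχ.cinner_self]
    exact one_ne_zero

end Deg

section Induction

variable {A B : Type} [Group A] [Group B]

/-- The class function induced along a homomorphism. -/
def indHom (i : A →* B) (θ : A → ℂ) : B → ℂ := fun g =>
  (Nat.card A : ℂ)⁻¹ * ∑ᶠ x : B, ∑ᶠ a : A, if i a = x * g * x⁻¹ then θ a else 0

theorem indHom_eq [Fintype A] [Fintype B] (i : A →* B) (θ : A → ℂ) (g : B) :
    indHom i θ g = (Nat.card A : ℂ)⁻¹ * ∑ x : B, ∑ a : A, if i a = x * g * x⁻¹ then θ a else 0 := by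
  simp only [indHom, finsum_eq_sum_of_fintype]

theorem indHom_subtype {G : Type} [Group G] [Fintype G] (H : Subgroup G) (ψ : ↥H → ℂ) :
    indHom H.subtype ψ = indChar H ψ := by
  funext g
  rw [indHom_eq, indChar]
  congr 1
  refine Finset.sum_congr rfl fun x _ => ?_
  split_ifs with h
  · rw [Finset.sum_eq_single ⟨x * g * x⁻¹, h⟩]
    · simp
    · intro b _ hb
      rw [if_neg]
      intro h'
      exact hb (Subtype.ext h')
    · simp
  · refine Finset.sum_eq_zero fun a _ => if_neg ?_
    rintro h'
    exact h (h' ▸ a.2)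

variable [Finite A] [Finite B]

theorem frobenius_reciprocity (i : A →* B) (θ : A → ℂ) {ω : B → ℂ}
    (hω : ∀ x g, ω (x * g * x⁻¹) = ω g) :
    cinner (indHom i θ) ω = cinner θ (ω ∘ i) := by
  have := Fintype.ofFinite A
  have := Fintype.ofFinite B
  simp only [cinner_eq, indHom_eq, Function.comp]
  have : ∑ g : B, ((Nat.card A : ℂ)⁻¹ * ∑ x : B, ∑ a : A, if i a = x * g * x⁻¹ then θ a else 0)
      * ω g⁻¹ = (Nat.card A : ℂ)⁻¹ * ∑ x : B, ∑ a : A, θ a * ω (i a)⁻¹ := by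
    simp only [mul_assoc, ← Finset.mul_sum, Finset.sum_mul]
    congr 1
    rw [Finset.sum_comm]
    refine Finset.sum_congr rfl fun x _ => ?_
    rw [Finset.sum_comm]
    refine Finset.sum_congr rfl fun a _ => ?_
    rw [Finset.sum_eq_single (x⁻¹ * i a * x)]
    · rw [if_pos (by group)]
      congr 1
      rw [← hω x⁻¹ (i a)⁻¹]
      congr 1
      group
    · intro b _ hb
      rw [if_neg, zero_mul]
      rintro h
      exact hb (by rw [h]; group)
    · simp
  rw [this]
  simp only [Finset.sum_const, Finset.card_univ, ← map_inv, nsmul_eq_mul, Fintype.card_eq_nat_card]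
  have : (Nat.card B : ℂ) ≠ 0 := NeZero.ne _
  field_simp

theorem indHom_degree (i : A →* B) (hi : Function.Injective i) (θ : A → ℂ) :
    indHom i θ 1 = (Nat.card A : ℂ)⁻¹ * (Nat.card B * θ 1) := by
  have := Fintype.ofFinite A
  have := Fintype.ofFinite B
  rw [indHom_eq]
  congr 1
  have : ∀ x : B, (∑ a : A, if i a = x * 1 * x⁻¹ then θ a else 0) = θ 1 := by
    intro x
    rw [Finset.sum_eq_single 1]
    · simp
    · intro b _ hb
      rw [if_neg]
      intro h
      exact hb (hi (by simpa using h))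
    · simp
  simp only [this]
  simp

theorem IsCharacter.indHom (i : A →* B) {θ : A → ℂ} (h : IsCharacter A θ) :
    IsCharacter B (indHom i θ) := by
  have := Fintype.ofFinite A
  have := Fintype.ofFinite B
  obtain ⟨V, _, _, _, ρ, rfl⟩ := h.exists_rep
  let τ : Representation ℂ B (B → V) :=
    { toFun := fun g => LinearMap.funLeft ℂ V (fun x => x * g)
      map_one' := by ext f x; simp [LinearMap.funLeft]
      map_mul' := fun g h => by ext f x; simp [LinearMap.funLeft, mul_assoc] }
  let e : (B → V) →ₗ[ℂ] (B → V) := LinearMap.pi fun x =>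
    (Nat.card A : ℂ)⁻¹ • ∑ a : A, ρ a ∘ₗ LinearMap.proj ((i a)⁻¹ * x)
  have he : ∀ f x, e f x = (Nat.card A : ℂ)⁻¹ • ∑ a : A, ρ a (f ((i a)⁻¹ * x)) := by
    intro f x
    simp [e]
  have hcA : (Nat.card A : ℂ) ≠ 0 := NeZero.ne _
  have hee : e ∘ₗ e = e := by
    refine LinearMap.ext fun f => funext fun x => ?_
    rw [LinearMap.comp_apply, he]
    have : ∀ a : A, ρ a (e f ((i a)⁻¹ * x)) = e f x := by
      intro a
      rw [he, he, map_smul, map_sum]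
      congr 1
      refine Fintype.sum_equiv (Equiv.mulLeft a) _ _ fun b => ?_
      simp [mul_assoc]
    simp only [this, Finset.sum_const, Finset.card_univ, Fintype.card_eq_nat_card]
    rw [← Nat.cast_smul_eq_nsmul ℂ, smul_smul, inv_mul_cancel₀ hcA, one_smul]
  have hc : ∀ g, τ g ∘ₗ e = e ∘ₗ τ g := by
    intro g
    refine LinearMap.ext fun f => funext fun x => ?_
    change e f (x * g) = e (τ g f) x
    rw [he, he]
    simp [τ, LinearMap.funLeft, mul_assoc]
  convert isCharacter_of_idempotent τ e hee hc using 2 with g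
  have h1 : τ g ∘ₗ e = ∑ x : B, ∑ a : A, (Nat.card A : ℂ)⁻¹ •
      (LinearMap.single ℂ (fun _ : B => V) x ∘ₗ (ρ a ∘ₗ LinearMap.proj ((i a)⁻¹ * (x * g)))) := by
    refine LinearMap.ext fun f => funext fun y => ?_
    change e f (y * g) = _
    rw [he]
    simp only [LinearMap.sum_apply, Finset.sum_apply, LinearMap.smul_apply, Pi.smul_apply,
      LinearMap.comp_apply, LinearMap.single_apply, LinearMap.proj_apply]
    rw [Finset.sum_eq_single y]
    · simp [Finset.smul_sum]
    · intro b _ hb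
      refine Finset.sum_eq_zero fun a _ => ?_
      rw [Pi.single_eq_of_ne (Ne.symm hb), smul_zero]
    · simp
  rw [h1, indHom_eq]
  simp only [map_sum, map_smul, smul_eq_mul, Finset.mul_sum]
  refine Finset.sum_congr rfl fun x _ => Finset.sum_congr rfl fun a _ => ?_
  congr 1
  rw [LinearMap.trace_comp_comm']
  split_ifs with hx
  · have : (LinearMap.proj ((i a)⁻¹ * (x * g)) : (B → V) →ₗ[ℂ] V) ∘ₗ
        LinearMap.single ℂ (fun _ : B => V) x = LinearMap.id := by
      have : (i a)⁻¹ * (x * g) = x := by rw [hx]; group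
      rw [this]
      ext v; simp
    rw [LinearMap.comp_assoc, this]; rfl
  · have : (LinearMap.proj ((i a)⁻¹ * (x * g)) : (B → V) →ₗ[ℂ] V) ∘ₗ
        LinearMap.single ℂ (fun _ : B => V) x = 0 := by
      have : (i a)⁻¹ * (x * g) ≠ x := by
        intro h
        exact hx (by
          rw [inv_mul_eq_iff_eq_mul] at h
          rw [h, mul_inv_cancel_right])
      ext v; simp [this]
    rw [LinearMap.comp_assoc, this]; simp

end Induction

/-- An embedding of groups with normal image. -/
structure NEmb (A B : Type) [Group A] [Group B] where
  /-- the underlying homomorphism -/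
  hom : A →* B
  inj : Function.Injective hom
  normal : hom.range.Normal

namespace NEmb

section Gen

variable {A B : Type} [Group A] [Group B] (i : NEmb A B)

/-- The automorphism of the normal subgroup induced by conjugation with `b`. -/
def cj (b : B) : A ≃* A :=
  haveI := i.normal
  (MonoidHom.ofInjective i.inj).trans
    (((MulAut.conjNormal b : MulAut i.hom.range)).trans (MonoidHom.ofInjective i.inj).symm)

theorem hom_cj (b : B) (a : A) : i.hom (i.cj b a) = b * i.hom a * b⁻¹ := by
  have := i.normal
  have h : ((MonoidHom.ofInjective i.inj) (i.cj b a) : B) = b * i.hom a * b⁻¹ := by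
    rw [cj]
    simp [MulAut.conjNormal_apply, MonoidHom.ofInjective_apply]
  rwa [MonoidHom.ofInjective_apply] at h

theorem cj_mul (b c : B) (a : A) : i.cj (b * c) a = i.cj b (i.cj c a) := by
  apply i.inj
  simp only [hom_cj]
  group

theorem cj_one (a : A) : i.cj 1 a = a := by
  apply i.inj
  simp [hom_cj]

theorem cj_hom (c a : A) : i.cj (i.hom c) a = c * a * c⁻¹ := by
  apply i.inj
  simp [hom_cj]

/-- The stabilizer in `B` of a class function of the normal subgroup. -/
def stab (θ : A → ℂ) : Subgroup B where
  carrier := {b | θ ∘ i.cj b = θ}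
  one_mem' := by
    funext a
    simp [cj_one]
  mul_mem' := by
    intro b c hb hc
    funext a
    rw [Function.comp, cj_mul, ← Function.comp_apply (f := θ) (g := i.cj b), show θ ∘ i.cj b = θ from hb]
    exact congrFun hc a
  inv_mem' := by
    intro b hb
    funext a
    have := congrFun hb (i.cj b⁻¹ a)
    rw [Function.comp_apply, ← cj_mul, mul_inv_cancel, cj_one] at this
    exact this.symm

theorem mem_stab {θ : A → ℂ} {b : B} : b ∈ i.stab θ ↔ θ ∘ i.cj b = θ := Iff.rfl

theorem range_le_stab {θ : A → ℂ} (h : IsCharacter A θ) : i.hom.range ≤ i.stab θ := by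
  rintro _ ⟨a, rfl⟩
  rw [mem_stab]
  funext c
  rw [Function.comp, cj_hom, h.conj]

theorem comp_cj {χ : B → ℂ} (h : IsCharacter B χ) (b : B) : (χ ∘ i.hom) ∘ i.cj b = χ ∘ i.hom := by
  funext a
  simp [hom_cj, h.conj]

/-- The same embedding, with target a subgroup containing its image. -/
def codRestrict (T : Subgroup B) (h : i.hom.range ≤ T) : NEmb A T where
  hom := i.hom.codRestrict T fun a => h ⟨a, rfl⟩
  inj := fun a b hab => i.inj (congrArg Subtype.val hab)
  normal := by
    refine ⟨?_⟩
    rintro _ ⟨a, rfl⟩ t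
    refine ⟨i.cj t a, Subtype.ext ?_⟩
    exact i.hom_cj t a

theorem cj_codRestrict (T : Subgroup B) (h : i.hom.range ≤ T) (t : T) :
    (i.codRestrict T h).cj t = i.cj t := by
  ext a
  apply (i.codRestrict T h).inj
  rw [hom_cj]
  refine Subtype.ext ?_
  exact (i.hom_cj t a).symm

end Gen

variable {A B : Type} [Group A] [Group B] (i : NEmb A B) [Finite A] [Finite B]

theorem indHom_comp {θ : A → ℂ} (a : A) :
    indHom i.hom θ (i.hom a) = (Nat.card A : ℂ)⁻¹ * ∑ᶠ b : B, θ (i.cj b a) := by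
  have := Fintype.ofFinite A
  have := Fintype.ofFinite B
  rw [indHom_eq, finsum_eq_sum_of_fintype]
  congr 1
  refine Finset.sum_congr rfl fun b _ => ?_
  rw [Finset.sum_eq_single (i.cj b a)]
  · rw [if_pos (i.hom_cj b a)]
  · intro c _ hc
    rw [if_neg]
    rw [← i.hom_cj b a]
    exact fun h => hc (i.inj h)
  · simp

theorem exists_conj {χ : B → ℂ} (hχ : IsIrrChar B χ) {θ κ : A → ℂ} (hθ : IsIrrChar A θ)
    (hκ : IsIrrChar A κ) (h1 : cinner (χ ∘ i.hom) θ ≠ 0) (h2 : cinner (χ ∘ i.hom) κ ≠ 0) :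
    ∃ b, κ = θ ∘ i.cj b := by
  have := Fintype.ofFinite B
  have h3 : cinner (indHom i.hom θ) χ ≠ 0 := by
    rwa [frobenius_reciprocity _ _ hχ.1.conj, cinner_comm]
  have h4 := cinner_comp_ne_zero i.hom (hθ.1.indHom i.hom) hχ h3 hκ.1 h2
  have h5 : indHom i.hom θ ∘ i.hom = (Nat.card A : ℂ)⁻¹ • ∑ b : B, θ ∘ i.cj b := by
    funext a
    simp [i.indHom_comp, finsum_eq_sum_of_fintype]
  rw [h5, cinner_smul_left, cinner_sum_left] at h4
  obtain ⟨b, -, hb⟩ := Finset.exists_ne_zero_of_sum_ne_zero (right_ne_zero_of_mul h4)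
  exact ⟨b, ((hθ.comp_equiv (i.cj b)).eq_of_cinner_ne_zero hκ hb).symm⟩

theorem cinner_conj {χ : B → ℂ} (hχ : IsCharacter B χ) (θ : A → ℂ) (b : B) :
    cinner (χ ∘ i.hom) (θ ∘ i.cj b) = cinner (χ ∘ i.hom) θ := by
  rw [← cinner_equiv (i.cj b) (χ ∘ i.hom) θ, i.comp_cj hχ]

theorem card_conj_eq (θ : A → ℂ) (c : B) [Fintype B] :
    (Finset.univ.filter fun b => θ ∘ i.cj b = θ ∘ i.cj c).card = Nat.card (i.stab θ) := by
  have : Fintype (i.stab θ) := Fintype.ofFinite _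
  rw [Nat.card_eq_fintype_card, ← Finset.card_univ]
  symm
  refine Finset.card_bij (fun s _ => (s : B) * c) ?_ ?_ ?_
  · rintro ⟨s, hs⟩ _
    rw [Finset.mem_filter]
    refine ⟨Finset.mem_univ _, ?_⟩
    funext a
    simp only [Function.comp, cj_mul]
    exact congrFun hs _
  · rintro s _ t _ h
    exact Subtype.ext (mul_right_cancel h)
  · intro b hb
    rw [Finset.mem_filter] at hb
    refine ⟨⟨b * c⁻¹, ?_⟩, Finset.mem_univ _, by simp⟩
    rw [mem_stab]
    funext a
    rw [Function.comp, cj_mul]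
    have := congrFun hb.2 (i.cj c⁻¹ a)
    simp only [Function.comp] at this
    rw [this, ← cj_mul, mul_inv_cancel, cj_one]

theorem clifford_sum [Fintype B] {χ : B → ℂ} (hχ : IsIrrChar B χ) {θ : A → ℂ} (hθ : IsIrrChar A θ)
    (h1 : cinner (χ ∘ i.hom) θ ≠ 0) {e : ℕ} (he : cinner (χ ∘ i.hom) θ = e) :
    Nat.card (i.stab θ) • (χ ∘ i.hom) = e • ∑ b : B, θ ∘ i.cj b := by
  refine IsCharacter.ext_cinner ((hχ.1.comp _).nsmul _)
    ((IsCharacter.sum _ fun b _ => (hθ.comp_equiv (i.cj b)).1).nsmul _) fun κ hκ => ?_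
  simp only [← Nat.cast_smul_eq_nsmul ℂ, cinner_smul_left, cinner_sum_left]
  have h3 : ∀ b, cinner (θ ∘ i.cj b) κ = if θ ∘ i.cj b = κ then 1 else 0 := by
    intro b
    split_ifs with h
    · rw [h, hκ.cinner_self]
    · exact (hθ.comp_equiv (i.cj b)).cinner_of_ne hκ h
  simp only [h3, Finset.sum_boole]
  by_cases h2 : cinner (χ ∘ i.hom) κ = 0
  · rw [h2, mul_zero, Finset.filter_eq_empty_iff.2]
    · simp
    · rintro b - rfl
      rw [i.cinner_conj hχ.1] at h2
      exact h1 h2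
  · obtain ⟨c, rfl⟩ := i.exists_conj hχ hθ hκ h1 h2
    rw [i.cinner_conj hχ.1, he, i.card_conj_eq, mul_comm]

theorem clifford_degree {χ : B → ℂ} (hχ : IsIrrChar B χ) {θ : A → ℂ} (hθ : IsIrrChar A θ)
    (h1 : cinner (χ ∘ i.hom) θ ≠ 0) {e : ℕ} (he : cinner (χ ∘ i.hom) θ = e) :
    cdeg χ = e * (i.stab θ).index * cdeg θ := by
  have := Fintype.ofFinite B
  have h := congrFun (i.clifford_sum hχ hθ h1 he) 1
  have h3 : Nat.card (i.stab θ) * cdeg χ = e * (Nat.card B * cdeg θ) := by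
    simp only [Pi.smul_apply, Finset.sum_apply, Function.comp, map_one, hχ.1.apply_one,
      hθ.1.apply_one, Finset.sum_const, Finset.card_univ, nsmul_eq_mul,
      ← Nat.card_eq_fintype_card] at h
    exact_mod_cast h
  rw [← (i.stab θ).card_mul_index] at h3
  have : 0 < Nat.card (i.stab θ) := Nat.card_pos
  apply Nat.eq_of_mul_eq_mul_left this
  rw [h3]
  ring

theorem exists_mult {χ : B → ℂ} (hχ : IsIrrChar B χ) {θ : A → ℂ} (hθ : IsIrrChar A θ)
    (h1 : cinner (χ ∘ i.hom) θ ≠ 0) : ∃ e : ℕ, 0 < e ∧ cinner (χ ∘ i.hom) θ = e := by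
  obtain ⟨e, he⟩ := cinner_nat (hχ.1.comp i.hom) hθ.1
  refine ⟨e, Nat.pos_of_ne_zero ?_, he⟩
  rintro rfl
  simp [he] at h1

theorem comp_eq_smul {χ : B → ℂ} (hχ : IsIrrChar B χ) {θ : A → ℂ} (hθ : IsIrrChar A θ)
    (h1 : cinner (χ ∘ i.hom) θ ≠ 0) (hinv : ∀ b, θ ∘ i.cj b = θ) {e : ℕ}
    (he : cinner (χ ∘ i.hom) θ = e) : χ ∘ i.hom = e • θ := by
  have := Fintype.ofFinite B
  have h := i.clifford_sum hχ hθ h1 he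
  have htop : i.stab θ = ⊤ := by
    rw [eq_top_iff]
    intro b _
    exact hinv b
  rw [htop, Subgroup.card_top] at h
  simp only [hinv, Finset.sum_const, Finset.card_univ, ← Nat.card_eq_fintype_card] at h
  rw [smul_comm] at h
  have hB : (Nat.card B : ℂ) ≠ 0 := NeZero.ne _
  simp only [← Nat.cast_smul_eq_nsmul ℂ] at h ⊢
  exact smul_right_injective _ hB h

/-- The Clifford correspondent over the stabilizer. -/
theorem clifford_correspondence {γ : B → ℂ} (hγ : IsIrrChar B γ) {τ : A → ℂ} (hτ : IsIrrChar A τ)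
    (h1 : cinner (γ ∘ i.hom) τ ≠ 0) :
    ∃ γ₁ : i.stab τ → ℂ, IsIrrChar (i.stab τ) γ₁ ∧ indHom (i.stab τ).subtype γ₁ = γ ∧
      cinner (γ ∘ (i.stab τ).subtype) γ₁ ≠ 0 ∧
      ∃ e : ℕ, 0 < e ∧
        γ₁ ∘ (i.codRestrict (i.stab τ) (i.range_le_stab hτ.1)).hom = e • τ := by
  set T := i.stab τ with hT
  set j := i.codRestrict T (i.range_le_stab hτ.1) with hj
  have hcomp : (γ ∘ T.subtype) ∘ j.hom = γ ∘ i.hom := rfl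
  obtain ⟨γ₁, hγ₁, h2, h3⟩ := (hγ.1.comp T.subtype).exists_over j.hom (by rwa [hcomp])
  obtain ⟨e, he0, he⟩ := i.exists_mult hγ hτ h1
  obtain ⟨e₁, he₁0, he₁⟩ := j.exists_mult hγ₁ hτ h3
  have hinv : ∀ t, τ ∘ j.cj t = τ := by
    intro t
    rw [hj, cj_codRestrict]
    exact t.2
  have h4 := j.comp_eq_smul hγ₁ hτ h3 hinv he₁
  refine ⟨γ₁, hγ₁, ?_, h2, e₁, he₁0, h4⟩
  have hle : e₁ ≤ e := by
    obtain ⟨ξ, hξ, hξ'⟩ := (hγ.1.comp T.subtype).eq_add_of_cinner_ne_zero hγ₁ h2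
    obtain ⟨n, hn⟩ := cinner_nat (hξ.comp j.hom) hτ.1
    have : cinner (γ ∘ i.hom) τ = cinner (γ₁ ∘ j.hom) τ + cinner (ξ ∘ j.hom) τ := by
      rw [← hcomp, hξ', ← cinner_add_left]
      rfl
    rw [he, he₁, hn] at this
    have : e = e₁ + n := by exact_mod_cast this
    omega
  have h5 : cinner (indHom T.subtype γ₁) γ ≠ 0 := by
    rwa [frobenius_reciprocity _ _ hγ.1.conj, cinner_comm]
  obtain ⟨ξ, hξ, hξ'⟩ := (hγ₁.1.indHom T.subtype).eq_add_of_cinner_ne_zero hγ h5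
  have hd := indHom_degree T.subtype T.subtype_injective γ₁
  have hd1 : cdeg γ₁ = e₁ * cdeg τ := by
    have := congrFun h4 1
    simp only [Pi.smul_apply, Function.comp, map_one, hγ₁.1.apply_one, hτ.1.apply_one,
      nsmul_eq_mul] at this
    exact_mod_cast this
  have hd2 := i.clifford_degree hγ hτ h1 he
  rw [hξ', Pi.add_apply, hγ.1.apply_one, hξ.apply_one, hγ₁.1.apply_one] at hd
  have hcT : (Nat.card T : ℂ) ≠ 0 := NeZero.ne _
  have hd3 : Nat.card T * (cdeg γ + cdeg ξ) = Nat.card B * cdeg γ₁ := by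
    have : (Nat.card T : ℂ) * (cdeg γ + cdeg ξ) = Nat.card B * cdeg γ₁ := by
      rw [hd, mul_inv_cancel_left₀ hcT]
    exact_mod_cast this
  rw [← T.card_mul_index, mul_assoc] at hd3
  have hd4 := Nat.eq_of_mul_eq_mul_left Nat.card_pos hd3
  rw [hd1, hd2] at hd4
  have hξ0 : cdeg ξ = 0 := by
    have : T.index * (e₁ * cdeg τ) ≤ e * T.index * cdeg τ := by
      calc T.index * (e₁ * cdeg τ) = e₁ * (T.index * cdeg τ) := by ring
        _ ≤ e * (T.index * cdeg τ) := Nat.mul_le_mul_right _ hle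
        _ = _ := by ring
    exact Nat.le_zero.1 (by linarith)
  rw [hξ', hξ.eq_zero_of_degree (by rw [hξ.apply_one, hξ0, Nat.cast_zero]), add_zero]

end NEmb

section Det

variable {G : Type} [Group G]

theorem LinearMap.det_eq_of_intertwining {V W : Type} [AddCommGroup V] [Module ℂ V]
    [AddCommGroup W] [Module ℂ W] (E : V ≃ₗ[ℂ] W) (f : V →ₗ[ℂ] V) (g : W →ₗ[ℂ] W)
    (h : ∀ v, E (f v) = g (E v)) : LinearMap.det f = LinearMap.det g := by
  have : g = E.toLinearMap ∘ₗ f ∘ₗ E.symm.toLinearMap := by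
    ext w
    simp [h]
  rw [this, LinearMap.det_conj]

theorem Representation.exists_split [Finite G] {V S : Type} [AddCommGroup V] [Module ℂ V]
    [Module.Finite ℂ V] [AddCommGroup S] [Module ℂ S] [Module.Finite ℂ S]
    (ρ : Representation ℂ G V) (σ : Representation ℂ G S) [σ.IsIrreducible]
    (h : cinner ρ.character σ.character ≠ 0) :
    ∃ (Q : Type) (_ : AddCommGroup Q) (_ : Module ℂ Q) (_ : Module.Finite ℂ Q)
      (κ : Representation ℂ G Q), ρ.character = σ.character + κ.character ∧
        ∀ g, LinearMap.det (ρ g) = LinearMap.det (σ g) * LinearMap.det (κ g) := by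
  have := Fintype.ofFinite G
  have : Invertible (Nat.card G : ℂ) := invertibleOfNonzero (NeZero.ne _)
  have h1 := Representation.card_inv_mul_sum_char_mul_char_eq_finrank σ ρ
  rw [← cinner_eq] at h1
  rw [h1, Nat.cast_ne_zero] at h
  have hnt : Nontrivial (Representation.IntertwiningMap σ ρ) := by
    by_contra hc
    rw [not_nontrivial_iff_subsingleton] at hc
    exact h Module.finrank_zero_of_subsingleton
  obtain ⟨f, hf⟩ := exists_ne (0 : Representation.IntertwiningMap σ ρ)
  have hinj : Function.Injective f := (Representation.IsIrreducible.injective_or_eq_zero f).resolve_right hf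
  let p : Subrepresentation ρ :=
    { toSubmodule := LinearMap.range f.toLinearMap
      apply_mem_toSubmodule := by
        rintro g _ ⟨s, rfl⟩
        exact ⟨σ g s, Representation.IntertwiningMap.isIntertwining σ ρ f g s⟩ }
  obtain ⟨q, hq⟩ := exists_isCompl p
  let E : S ≃ₗ[ℂ] p.toSubmodule := LinearEquiv.ofInjective f.toLinearMap hinj
  have hE : ∀ g s, E (σ g s) = p.toRepresentation g (E s) := fun g s =>
    Subtype.ext (Representation.IntertwiningMap.isIntertwining σ ρ f g s)
  have hdet : ∀ g, LinearMap.det (σ g) = LinearMap.det (p.toRepresentation g) := fun g =>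
    LinearMap.det_eq_of_intertwining E _ _ (hE g)
  have htr : σ.character = p.toRepresentation.character := by
    funext g
    have : p.toRepresentation g = E.conj (σ g) := by
      ext w
      obtain ⟨s, rfl⟩ := E.surjective w
      simp [LinearEquiv.conj_apply, hE]
    rw [Representation.character, Representation.character, this, LinearMap.trace_conj']
  refine ⟨q.toSubmodule, inferInstance, inferInstance, inferInstance, q.toRepresentation, ?_,
    fun g => ?_⟩
  · rw [htr]
    exact Subrepresentation.character_eq_add ρ hq
  · obtain ⟨E', hE'⟩ := Subrepresentation.exists_conj_prodMap ρ hq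
    rw [hE', LinearEquiv.conj_apply, LinearMap.comp_assoc, LinearMap.det_conj, LinearMap.det_prodMap,
      hdet]

theorem Representation.det_eq_of_character_eq [Finite G] {V W : Type} [AddCommGroup V]
    [Module ℂ V] [Module.Finite ℂ V] [AddCommGroup W] [Module ℂ W] [Module.Finite ℂ W]
    (ρ : Representation ℂ G V) (τ : Representation ℂ G W) (h : ρ.character = τ.character) (g : G) :
    LinearMap.det (ρ g) = LinearMap.det (τ g) := by
  obtain ⟨n, hn⟩ : ∃ n, cdeg ρ.character = n := ⟨_, rfl⟩
  induction n using Nat.strong_induction_on generalizing V W with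
  | _ n ih =>
    by_cases h0 : ρ.character = 0
    · have hs : ∀ {V : Type} [AddCommGroup V] [Module ℂ V] [Module.Finite ℂ V]
          (ρ : Representation ℂ G V), ρ.character = 0 → LinearMap.det (ρ g) = 1 := by
        intro V _ _ _ ρ h0
        have h1 := congrFun h0 1
        rw [ρ.char_one, Pi.zero_apply] at h1
        exact LinearMap.det_eq_one_of_finrank_eq_zero (by exact_mod_cast h1) _
      rw [hs ρ h0, hs τ (h ▸ h0)]
    · obtain ⟨θ, hθ, h1⟩ := (IsCharacter.of_rep ρ).exists_constituent h0
      obtain ⟨S, _, _, _, σ, hσ, rfl⟩ := hθ.exists_rep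
      obtain ⟨Q, _, _, _, κ, h2, h3⟩ := ρ.exists_split σ h1
      obtain ⟨Q', _, _, _, κ', h2', h3'⟩ := τ.exists_split σ (h ▸ h1)
      rw [h3, h3']
      congr 1
      have hpos := hθ.cdeg_pos
      refine ih (cdeg κ.character) ?_ κ κ' ?_ rfl
      · have h4 := congrFun h2 1
        rw [Pi.add_apply, (IsCharacter.of_rep ρ).apply_one, (IsCharacter.of_rep σ).apply_one,
          (IsCharacter.of_rep κ).apply_one] at h4
        have : cdeg ρ.character = cdeg σ.character + cdeg κ.character := by exact_mod_cast h4
        omega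
      · rw [h2, h2'] at h
        exact add_left_cancel h

/-- The determinant of a character. -/
def cdet (χ : G → ℂ) (g : G) : ℂ :=
  if h : IsCharacter G χ then
    LinearMap.det ((Classical.choose h).ρ g) else 1

theorem cdet_rep [Finite G] {V : Type} [AddCommGroup V] [Module ℂ V] [Module.Finite ℂ V]
    (ρ : Representation ℂ G V) (g : G) : cdet ρ.character g = LinearMap.det (ρ g) := by
  rw [cdet, dif_pos (IsCharacter.of_rep ρ)]
  have h := Classical.choose_spec (IsCharacter.of_rep ρ)
  exact Representation.det_eq_of_character_eq _ ρ (funext fun g => (h g).symm) g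

theorem cdet_matrix [Finite G] {ι : Type} [Fintype ι] [DecidableEq ι] (R : G →* Matrix ι ι ℂ)
    {χ : G → ℂ} (h : ∀ g, χ g = (R g).trace) (g : G) : cdet χ g = (R g).det := by
  let ρ : Representation ℂ G (ι → ℂ) :=
    (Matrix.toLinAlgEquiv' (R := ℂ) (n := ι) : Matrix ι ι ℂ →* ((ι → ℂ) →ₗ[ℂ] (ι → ℂ))).comp R
  have : χ = ρ.character := funext fun g => (h g).trans (Matrix.trace_toLin'_eq (R g)).symm
  rw [this, cdet_rep]
  exact LinearMap.det_toLin' (R g)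

theorem cdet_mul_apply [Finite G] (χ : G → ℂ) (g h : G) : cdet χ (g * h) = cdet χ g * cdet χ h := by
  by_cases hχ : IsCharacter G χ
  · simp [cdet, hχ]
  · simp [cdet, hχ]

theorem cdet_one_apply (χ : G → ℂ) : cdet χ 1 = 1 := by
  by_cases hχ : IsCharacter G χ
  · simp [cdet, hχ]
  · simp [cdet, hχ]

/-- The determinant of a character as a linear character. -/
def cdetHom [Finite G] (χ : G → ℂ) : G →* ℂ where
  toFun := cdet χ
  map_one' := cdet_one_apply χ
  map_mul' := cdet_mul_apply χ

theorem cdet_add [Finite G] {χ ψ : G → ℂ} (h : IsCharacter G χ) (h' : IsCharacter G ψ) (g : G) :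
    cdet (χ + ψ) g = cdet χ g * cdet ψ g := by
  obtain ⟨V, _, _, _, ρ, rfl⟩ := h.exists_rep
  obtain ⟨W, _, _, _, τ, rfl⟩ := h'.exists_rep
  have : ρ.character + τ.character = (ρ.prod τ).character := by
    funext g
    exact (LinearMap.trace_prodMap' (ρ g) (τ g)).symm
  rw [this, cdet_rep, cdet_rep, cdet_rep]
  exact LinearMap.det_prodMap _ _

theorem cdet_zero [Finite G] (g : G) : cdet (0 : G → ℂ) g = 1 := by
  have h := cdet_add (isCharacter_zero (G := G)) isCharacter_zero g
  rw [add_zero] at h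
  have hne : cdet (0 : G → ℂ) g ≠ 0 := by
    intro h0
    have := cdet_mul_apply (0 : G → ℂ) g g⁻¹
    rw [mul_inv_cancel, cdet_one_apply, h0, zero_mul] at this
    exact one_ne_zero this
  exact (mul_right_cancel₀ hne (h.symm.trans (one_mul _).symm))

theorem cdet_sum [Finite G] {ι : Type*} (S : Finset ι) {f : ι → G → ℂ}
    (h : ∀ i ∈ S, IsCharacter G (f i)) (g : G) :
    cdet (∑ i ∈ S, f i) g = ∏ i ∈ S, cdet (f i) g := by
  induction S using Finset.induction_on with
  | empty => simpa using cdet_zero g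
  | insert a S ha ih =>
    have h2 : ∀ i ∈ S, IsCharacter G (f i) := fun i hi => h i (Finset.mem_insert_of_mem hi)
    rw [Finset.sum_insert ha, Finset.prod_insert ha,
      cdet_add (h _ (Finset.mem_insert_self _ _)) (IsCharacter.sum S h2), ih h2]

theorem cdet_nsmul [Finite G] {χ : G → ℂ} (h : IsCharacter G χ) (n : ℕ) (g : G) :
    cdet (n • χ) g = cdet χ g ^ n := by
  have := cdet_sum (Finset.range n) (f := fun _ => χ) (fun _ _ => h) g
  simpa using this

theorem cdet_comp [Finite G] {H : Type} [Group H] [Finite H] (f : H →* G) {χ : G → ℂ}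
    (h : IsCharacter G χ) (x : H) : cdet (χ ∘ f) x = cdet χ (f x) := by
  obtain ⟨V, _, _, _, ρ, rfl⟩ := h.exists_rep
  rw [cdet_rep]
  exact cdet_rep (ρ.comp f : Representation ℂ H V) x

theorem cdet_mul_linear [Finite G] {χ : G → ℂ} (h : IsCharacter G χ) (l : G →* ℂ) (g : G) :
    cdet (χ * (l : G → ℂ)) g = cdet χ g * l g ^ cdeg χ := by
  obtain ⟨V, _, _, _, ρ, rfl⟩ := h.exists_rep
  let τ : Representation ℂ G V :=
    { toFun := fun g => l g • ρ g
      map_one' := by simp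
      map_mul' := fun g h => by
        simp only [map_mul, smul_mul_smul_comm] }
  have : ρ.character * (l : G → ℂ) = τ.character := by
    funext g
    change _ = LinearMap.trace ℂ V (l g • ρ g)
    simp [Representation.character, mul_comm]
  rw [this, cdet_rep, cdet_rep, cdeg_eq_of ρ.char_one, mul_comm]
  exact LinearMap.det_smul _ _

theorem cdet_galois [Finite G] {χ : G → ℂ} (h : IsCharacter G χ) (s : ℂ →+* ℂ) (g : G) :
    cdet (s ∘ χ) g = s (cdet χ g) := by
  obtain ⟨n, R, hR⟩ := h.exists_matrix
  rw [cdet_matrix R hR, cdet_matrix (s.mapMatrix.toMonoidHom.comp R) (fun g => by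
    simp [hR, Matrix.trace, map_sum])]
  simp [RingHom.map_det]

theorem cdet_pow_card [Finite G] (χ : G → ℂ) (g : G) : cdet χ g ^ Nat.card G = 1 := by
  have : cdet χ g = cdetHom χ g := rfl
  rw [this, ← map_pow, pow_card_eq_one', map_one]

/-- The determinantal order of the character divides a `σ`-number. -/
def DetPi (σ : Set ℕ) (χ : G → ℂ) : Prop :=
  ∃ k : ℕ, 0 < k ∧ IsPiNumber σ k ∧ ∀ g, cdet χ g ^ k = 1

theorem isPiNumber_of_dvd {σ : Set ℕ} {m n : ℕ} (h : IsPiNumber σ n) (hd : m ∣ n) :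
    IsPiNumber σ m := fun q hq hqm => h q hq (hqm.trans hd)

theorem isPiNumber_mul {σ : Set ℕ} {m n : ℕ} (hm : IsPiNumber σ m) (hn : IsPiNumber σ n) :
    IsPiNumber σ (m * n) := fun q hq hd => (hq.dvd_mul.1 hd).elim (hm q hq) (hn q hq)

theorem isPiNumber_one (σ : Set ℕ) : IsPiNumber σ 1 := fun _ hq hd =>
  absurd (Nat.dvd_one.1 hd) hq.ne_one

theorem isPiNumber_coprime {σ : Set ℕ} {m n : ℕ} (hm : IsPiNumber σ m) (hn : IsPiNumber σᶜ n) :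
    m.Coprime n := Nat.coprime_of_dvd fun q hq h1 h2 => hn q hq h2 (hm q hq h1)

theorem hasPiDetOrder_iff [Finite G] {σ : Set ℕ} {χ : G → ℂ} :
    HasPiDetOrder σ G χ ↔ IsCharacter G χ ∧ DetPi σ χ := by
  have key : ∀ V : FDRep ℂ G, (∀ g, χ g = V.character g) →
      (fun g : G => LinearMap.det (V.ρ g)) = cdet χ := by
    intro V hV
    funext g
    have : χ = Representation.character V.ρ := funext hV
    rw [this]
    exact (cdet_rep V.ρ g).symm
  constructor
  · rintro ⟨V, hV, ho⟩
    rw [key V hV] at ho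
    refine ⟨⟨V, hV⟩, orderOf (cdet χ), ?_, ho, fun g => ?_⟩
    · rw [orderOf_pos_iff, isOfFinOrder_iff_pow_eq_one]
      exact ⟨_, Nat.card_pos, funext fun g => cdet_pow_card χ g⟩
    · exact congrFun (pow_orderOf_eq_one (cdet χ)) g
  · rintro ⟨⟨V, hV⟩, k, hk, hk', h1⟩
    refine ⟨V, hV, ?_⟩
    rw [key V hV]
    exact isPiNumber_of_dvd hk' (orderOf_dvd_of_pow_eq_one (funext h1))

end Det

theorem Matrix.pow_eq_one_of_mem_roots {n : ℕ} {A : Matrix (Fin n) (Fin n) ℂ} {m : ℕ}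
    (h : A ^ m = 1) {r : ℂ} (hr : r ∈ A.charpoly.roots) : r ^ m = 1 := by
  have h1 : r ∈ spectrum ℂ A :=
    Matrix.mem_spectrum_iff_isRoot_charpoly.2 (Polynomial.isRoot_of_mem_roots hr)
  have h2 := spectrum.pow_mem_pow A m h1
  rw [h] at h2
  have : Nontrivial (Matrix (Fin n) (Fin n) ℂ) := by
    by_contra hc
    rw [not_nontrivial_iff_subsingleton] at hc
    simp at h1
  rwa [spectrum.one_eq, Set.mem_singleton_iff] at h2

theorem IsCharacter.isIntegral {G : Type} [Group G] [Finite G] {χ : G → ℂ} (h : IsCharacter G χ)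
    (g : G) : IsIntegral ℤ (χ g) := by
  obtain ⟨n, R, hR⟩ := h.exists_matrix
  rw [hR, Matrix.trace_eq_sum_roots_charpoly]
  refine IsIntegral.multiset_sum fun r hr => ?_
  refine IsIntegral.of_pow (n := Nat.card G) Nat.card_pos ?_
  rw [Matrix.pow_eq_one_of_mem_roots (by rw [← map_pow, pow_card_eq_one', map_one]) hr]
  exact isIntegral_one

theorem IsIrrChar.convolution {G : Type} [Group G] [Fintype G] {χ : G → ℂ} (h : IsIrrChar G χ)
    (g : G) : ∑ x, χ (g * x) * χ x⁻¹ = Nat.card G / χ 1 * χ g := by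
  obtain ⟨V, _, _, _, ρ, hρ, rfl⟩ := h.exists_rep
  let T : V →ₗ[ℂ] V := ∑ x, ρ.character x⁻¹ • ρ x
  have hT : ∀ g v, T (ρ g v) = ρ g (T v) := by
    intro g v
    simp only [T, LinearMap.sum_apply, LinearMap.smul_apply, map_sum, map_smul]
    refine Fintype.sum_equiv (MulAut.conj g⁻¹).toEquiv _ _ fun x => ?_
    have h1 : ρ g (ρ (g⁻¹ * x * g) v) = ρ x (ρ g v) := by
      rw [← Module.End.mul_apply, ← Module.End.mul_apply, ← map_mul, ← map_mul]
      congr 2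
      group
    have h2 := h.1.conj g⁻¹ x⁻¹
    simp only [MulEquiv.toEquiv_eq_coe, MulEquiv.coe_toEquiv, MulAut.conj_apply, inv_inv] at h2 ⊢
    rw [h1, ← h2]
    congr 2
    group
  obtain ⟨z, hz⟩ := (Representation.IsIrreducible.algebraMap_intertwiningMap_bijective_of_isAlgClosed
    (ρ := ρ)).2 (LinearMap.intertwiningMap_of_isIntertwiningMap ρ ρ T hT)
  have hz' : T = z • LinearMap.id := by
    ext v
    exact (congrArg (fun f : Representation.IntertwiningMap ρ ρ => f v) hz).symm
  have key : ∀ g, ∑ x, ρ.character (g * x) * ρ.character x⁻¹ = z * ρ.character g := by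
    intro g
    have : ρ g ∘ₗ T = z • ρ g := by
      rw [hz']; ext v; simp
    have h1 := congrArg (LinearMap.trace ℂ V) this
    rw [map_smul, smul_eq_mul] at h1
    change _ = z * LinearMap.trace ℂ V (ρ g)
    rw [← h1]
    have h2 : ρ g ∘ₗ T = ∑ x, ρ.character x⁻¹ • ρ (g * x) := by
      ext v
      simp [T, LinearMap.sum_apply, map_sum]
    rw [h2, map_sum]
    refine Finset.sum_congr rfl fun x _ => ?_
    rw [map_smul, smul_eq_mul, mul_comm]
    rfl
  have h1 := h.cinner_self
  rw [cinner_eq, inv_mul_eq_one₀ (NeZero.ne _)] at h1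
  have h2 := key 1
  simp only [one_mul] at h2
  rw [key, h1, h2, mul_div_assoc, div_self h.degree_ne_zero, mul_one]

theorem Matrix.isIntegral_of_mulVec {ι : Type} [Fintype ι] [DecidableEq ι] {X : Matrix ι ι ℂ}
    (hX : ∀ p q, IsIntegral ℤ (X p q)) {v : ι → ℂ} (hv : v ≠ 0) {z : ℂ}
    (h : X.mulVec v = z • v) : IsIntegral ℤ z := by
  let R := integralClosure ℤ ℂ
  let Y : Matrix ι ι R := fun p q => ⟨X p q, hX p q⟩
  have hY : Y.map (algebraMap R ℂ) = X := rfl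
  have hr : X.charpoly.IsRoot z := by
    rw [← Matrix.mem_spectrum_iff_isRoot_charpoly, ← Matrix.spectrum_toLin',
      ← Module.End.hasEigenvalue_iff_mem_spectrum]
    refine Module.End.hasEigenvalue_of_hasEigenvector (x := v) ⟨?_, hv⟩
    rw [Module.End.mem_eigenspace_iff]
    simpa using h
  have h1 : IsIntegral R z := by
    refine ⟨Y.charpoly, Y.charpoly_monic, ?_⟩
    rw [Polynomial.eval₂_eq_eval_map, ← Matrix.charpoly_map, hY]
    exact hr
  exact isIntegral_trans (A := R) z h1

namespace NEmb

variable {A B : Type} [Group A] [Group B] (i : NEmb A B) [Finite A] [Finite B]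

theorem card_range : Nat.card i.hom.range = Nat.card A :=
  (Nat.card_congr (MonoidHom.ofInjective i.inj).toEquiv).symm

/-- The degree of an irreducible character which is constant on the cosets of a normal subgroup
divides the index of this subgroup. -/
theorem cdeg_dvd {δ : B → ℂ} (hδ : IsIrrChar B δ) (hinv : ∀ b a, δ (b * i.hom a) = δ b) :
    cdeg δ ∣ i.hom.range.index := by
  have := Fintype.ofFinite B
  have := Fintype.ofFinite A
  have := i.normal
  have : Fintype (B ⧸ i.hom.range) := Fintype.ofFinite _
  let f : B ⧸ i.hom.range → ℂ := Quotient.lift δ (by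
    intro b c hbc
    obtain ⟨a, ha⟩ : b⁻¹ * c ∈ i.hom.range := QuotientGroup.leftRel_apply.1 hbc
    rw [← hinv b a, ha, mul_inv_cancel_left])
  have hf : ∀ b : B, f b = δ b := fun b => rfl
  have hsum : ∀ F : B ⧸ i.hom.range → ℂ, ∑ b : B, F b = Nat.card A * ∑ q, F q := by
    intro F
    have : Fintype i.hom.range := Fintype.ofFinite _
    rw [Fintype.sum_equiv (Subgroup.groupEquivQuotientProdSubgroup (s := i.hom.range))
      (fun b : B => F b) (fun x => F x.1) (fun b => rfl), Fintype.sum_prod_type, Finset.mul_sum]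
    refine Finset.sum_congr rfl fun q _ => ?_
    change ∑ _y : i.hom.range, F q = _
    rw [Finset.sum_const, Finset.card_univ, ← Nat.card_eq_fintype_card, i.card_range, nsmul_eq_mul]
  have hidx : (Nat.card B : ℂ) = Nat.card A * (i.hom.range.index : ℂ) := by
    rw [← i.card_range, ← Nat.cast_mul, Subgroup.card_mul_index]
  have hne : (Nat.card A : ℂ) ≠ 0 := NeZero.ne _
  have key : ∀ p, ∑ q, f (p * q⁻¹) * f q = (i.hom.range.index / δ 1) * f p := by
    intro p
    obtain ⟨g, rfl⟩ := QuotientGroup.mk_surjective p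
    have h1 := hδ.convolution g
    rw [hidx] at h1
    have h2 := hsum fun q => f (g * q) * f q⁻¹
    simp only [← QuotientGroup.mk_inv, ← QuotientGroup.mk_mul, hf] at h2
    rw [h1] at h2
    rw [Fintype.sum_equiv (Equiv.inv _) (fun q => f (g * q⁻¹) * f q) (fun q => f (g * q) * f q⁻¹)
      (fun q => by simp)]
    refine mul_left_cancel₀ hne ?_
    rw [← h2, hf]
    ring
  have hint : IsIntegral ℤ ((i.hom.range.index : ℂ) / δ 1) := by
    refine Matrix.isIntegral_of_mulVec (X := fun p q => f (p * q⁻¹)) (v := f) ?_ ?_ ?_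
    · intro p q
      obtain ⟨g, hg⟩ := QuotientGroup.mk_surjective (p * q⁻¹)
      rw [← hg, hf]
      exact hδ.1.isIntegral g
    · intro h0
      exact hδ.degree_ne_zero (congrFun h0 ((1 : B) : B ⧸ i.hom.range))
    · funext p
      exact key p
  rw [hδ.1.apply_one] at hint
  have h3 : IsIntegral ℤ ((i.hom.range.index / cdeg δ : ℚ)) := by
    rw [← isIntegral_algebraMap_iff (B := ℂ) (algebraMap ℚ ℂ).injective]
    simpa using hint
  obtain ⟨z, hz⟩ := IsIntegrallyClosed.isIntegral_iff.1 h3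
  have hpos : (cdeg δ : ℚ) ≠ 0 := by
    exact_mod_cast hδ.cdeg_pos.ne'
  rw [eq_div_iff hpos, eq_intCast] at hz
  have : (cdeg δ : ℤ) ∣ i.hom.range.index := ⟨z, by
    rw [mul_comm]
    exact_mod_cast hz.symm⟩
  exact_mod_cast this

/-- The average of a character over a normal subgroup is a character. -/
theorem isCharacter_average [Fintype A] {ω : B → ℂ} (h : IsCharacter B ω) :
    IsCharacter B (fun g => (Nat.card A : ℂ)⁻¹ * ∑ a, ω (g * i.hom a)) := by
  obtain ⟨V, _, _, _, ρ, rfl⟩ := h.exists_rep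
  have hne : (Nat.card A : ℂ) ≠ 0 := NeZero.ne _
  let e : V →ₗ[ℂ] V := (Nat.card A : ℂ)⁻¹ • ∑ a, ρ (i.hom a)
  have h1 : ∀ c, ρ (i.hom c) ∘ₗ e = e := by
    intro c
    ext v
    simp only [e, LinearMap.comp_apply, LinearMap.smul_apply, LinearMap.sum_apply, map_smul, map_sum]
    congr 1
    refine Fintype.sum_equiv (Equiv.mulLeft c) _ _ fun a => ?_
    simp
  have he : e ∘ₗ e = e := by
    ext v
    have h2 : ∀ c, ρ (i.hom c) (e v) = e v := fun c => LinearMap.congr_fun (h1 c) v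
    change ((Nat.card A : ℂ)⁻¹ • ∑ a, ρ (i.hom a)) (e v) = e v
    simp only [LinearMap.smul_apply, LinearMap.sum_apply, h2]
    simp [← Nat.cast_smul_eq_nsmul ℂ, smul_smul, ← Nat.card_eq_fintype_card, hne]
  have hc : ∀ g, ρ g ∘ₗ e = e ∘ₗ ρ g := by
    intro g
    ext v
    simp only [e, LinearMap.comp_apply, LinearMap.smul_apply, LinearMap.sum_apply, map_smul, map_sum]
    congr 1
    refine Fintype.sum_equiv (i.cj g).toEquiv _ _ fun a => ?_
    rw [← Module.End.mul_apply, ← Module.End.mul_apply, ← map_mul, ← map_mul]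
    congr 2
    change g * i.hom a = i.hom (i.cj g a) * g
    rw [hom_cj]
    group
  convert isCharacter_of_idempotent ρ e he hc using 2 with g
  have : ρ g ∘ₗ e = (Nat.card A : ℂ)⁻¹ • ∑ a, ρ (g * i.hom a) := by
    ext v
    simp [e, map_sum, LinearMap.sum_apply]
  rw [this, map_smul, map_sum]
  rfl

theorem average_mul [Fintype A] (ω : B → ℂ) (b : B) (c : A) :
    ∑ a, ω (b * i.hom c * i.hom a) = ∑ a, ω (b * i.hom a) := by
  refine Fintype.sum_equiv (Equiv.mulLeft c) _ _ fun a => ?_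
  simp [mul_assoc]

end NEmb

theorem IsCharacter.isIrrChar_of_comp {A B : Type} [Group A] [Group B] (f : A →* B) {χ : B → ℂ}
    (h : IsCharacter B χ) (hi : IsIrrChar A (χ ∘ f)) : IsIrrChar B χ := by
  have h0 : ∀ {ω : B → ℂ}, IsCharacter B ω → ω ≠ 0 → ω ∘ f ≠ 0 := by
    intro ω hω hne hc
    refine hne (hω.eq_zero_of_degree ?_)
    simpa using congrFun hc 1
  refine ⟨h, ?_, ?_⟩
  · rintro rfl
    exact hi.2.1 rfl
  · rintro ⟨χ₁, χ₂, h1, h1', h2, h2', rfl⟩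
    exact hi.2.2 ⟨χ₁ ∘ f, χ₂ ∘ f, h1.comp f, h0 h1 h1', h2.comp f, h0 h2 h2', rfl⟩

theorem cinner_mul_dual {G : Type} [Group G] [Finite G] (a b c : G → ℂ) :
    cinner (a * b) c = cinner b (fun g => c g * a g⁻¹) := by
  have := Fintype.ofFinite G
  rw [cinner_eq, cinner_eq]
  congr 1
  refine Finset.sum_congr rfl fun g _ => ?_
  simp only [Pi.mul_apply, inv_inv]
  ring

namespace NEmb

variable {A B : Type} [Group A] [Group B] (i : NEmb A B) [Finite A] [Finite B]

theorem cinner_average [Fintype A] {f : B → ℂ} (hf : ∀ a b, f (i.hom a * b) = f b) (ω : B → ℂ) :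
    cinner f (fun g => (Nat.card A : ℂ)⁻¹ * ∑ a, ω (g * i.hom a)) = cinner f ω := by
  have := Fintype.ofFinite B
  have hne : (Nat.card A : ℂ) ≠ 0 := NeZero.ne _
  rw [cinner_eq, cinner_eq]
  congr 1
  have h1 : ∀ a : A, ∑ b, f b * ω (b⁻¹ * i.hom a) = ∑ b, f b * ω b⁻¹ := by
    intro a
    refine Fintype.sum_equiv (Equiv.mulLeft (i.hom a⁻¹)) _ _ fun b => ?_
    simp only [Equiv.coe_mulLeft, mul_inv_rev, map_inv, inv_inv]
    rw [← map_inv, hf]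
  simp only [Finset.mul_sum]
  rw [Finset.sum_comm]
  have h2 : ∀ a : A, ∑ b, f b * ((Nat.card A : ℂ)⁻¹ * ω (b⁻¹ * i.hom a)) =
      (Nat.card A : ℂ)⁻¹ * ∑ b, f b * ω b⁻¹ := by
    intro a
    rw [← h1 a, Finset.mul_sum]
    exact Finset.sum_congr rfl fun b _ => by ring
  simp only [h2, Finset.sum_const, Finset.card_univ, ← Nat.card_eq_fintype_card, nsmul_eq_mul]
  rw [mul_inv_cancel_left₀ hne]

/-- Gallagher's theorem, for one character. -/
theorem gallagher {Θ : B → ℂ} (hΘ : IsCharacter B Θ) (hθ : IsIrrChar A (Θ ∘ i.hom)) {χ : B → ℂ}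
    (hχ : IsIrrChar B χ) (h1 : cinner (χ ∘ i.hom) (Θ ∘ i.hom) ≠ 0) :
    ∃ δ, IsIrrChar B δ ∧ (∀ b a, δ (b * i.hom a) = δ b) ∧ χ = Θ * δ := by
  have := Fintype.ofFinite A
  have := Fintype.ofFinite B
  obtain ⟨e, he0, he⟩ := i.exists_mult hχ hθ h1
  have h2 := i.comp_eq_smul hχ hθ h1 (fun b => i.comp_cj hΘ b) he
  set ω : B → ℂ := fun g => χ g * Θ g⁻¹ with hω
  have hωc : IsCharacter B ω := hχ.1.mul hΘ.dual
  set δ : B → ℂ := fun g => (Nat.card A : ℂ)⁻¹ * ∑ a, ω (g * i.hom a) with hδ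
  have hδc : IsCharacter B δ := i.isCharacter_average hωc
  have hinv : ∀ b a, δ (b * i.hom a) = δ b := fun b a => by
    simp only [hδ]
    rw [i.average_mul]
  have hinv' : ∀ a b, δ (i.hom a * b) = δ b := by
    intro a b
    rw [← hδc.conj (i.hom a)⁻¹, inv_inv, inv_mul_cancel_left, hinv]
  have hδ1 : δ 1 = e := by
    rw [← he, cinner_eq]
    simp [hδ, hω]
  have hδ0 : δ ≠ 0 := by
    intro h0
    rw [h0, Pi.zero_apply] at hδ1
    exact he0.ne' (by exact_mod_cast hδ1.symm)
  have h3 : cinner (Θ * δ) χ = cinner δ δ := by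
    rw [cinner_mul_dual]
    exact (i.cinner_average hinv' ω).symm
  have h4 : Θ * δ = χ := by
    refine (hΘ.mul hδc).eq_of_degree hχ ?_ ?_
    · obtain ⟨n, hn0, hn⟩ := hδc.cinner_self_pos hδ0
      rw [h3, hn]
      exact_mod_cast hn0.ne'
    · have := congrFun h2 1
      simp only [Function.comp, map_one, Pi.smul_apply, nsmul_eq_mul] at this
      rw [this, Pi.mul_apply, hδ1, mul_comm]
  refine ⟨δ, isIrrChar_iff.2 ⟨hδc, ?_⟩, hinv, h4.symm⟩
  rw [← h3, h4, hχ.cinner_self]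

end NEmb

theorem Representation.exists_intertwiner {A : Type} [Group A] [Finite A] {V : Type}
    [AddCommGroup V] [Module ℂ V] [Module.Finite ℂ V] (ρ τ : Representation ℂ A V)
    (hρ : IsIrrChar A ρ.character) (h : ρ.character = τ.character) :
    ∃ T : (Module.End ℂ V)ˣ, (∀ a, (T : Module.End ℂ V) * ρ a = τ a * T) ∧
      LinearMap.det (T : Module.End ℂ V) = 1 := by
  have := Fintype.ofFinite A
  have : Invertible (Nat.card A : ℂ) := invertibleOfNonzero (NeZero.ne _)
  have hρ' := ρ.isIrreducible_of_isIrrChar hρ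
  have hτ' := τ.isIrreducible_of_isIrrChar (h ▸ hρ)
  have h1 := Representation.card_inv_mul_sum_char_mul_char_eq_finrank ρ τ
  rw [← cinner_eq, ← h, hρ.cinner_self] at h1
  have hnt : Nontrivial (Representation.IntertwiningMap ρ τ) := by
    by_contra hc
    rw [not_nontrivial_iff_subsingleton] at hc
    rw [Module.finrank_zero_of_subsingleton] at h1
    simp at h1
  obtain ⟨f, hf⟩ := exists_ne (0 : Representation.IntertwiningMap ρ τ)
  have hb : Function.Bijective f :=
    (Representation.IsIrreducible.bijective_or_eq_zero f).resolve_right hf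
  let E : V ≃ₗ[ℂ] V := LinearEquiv.ofBijective f.toLinearMap hb
  have hd : LinearMap.det (E : V →ₗ[ℂ] V) ≠ 0 := (LinearEquiv.isUnit_det' E).ne_zero
  have hfr : Module.finrank ℂ V ≠ 0 := by
    intro h0
    refine hρ.degree_ne_zero ?_
    rw [ρ.char_one, h0, Nat.cast_zero]
  obtain ⟨z, hz⟩ := IsAlgClosed.exists_pow_nat_eq (LinearMap.det (E : V →ₗ[ℂ] V))⁻¹
    (Nat.pos_of_ne_zero hfr)
  have hz0 : z ≠ 0 := by
    rintro rfl
    rw [zero_pow hfr] at hz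
    exact inv_ne_zero hd hz.symm
  let S : V ≃ₗ[ℂ] V := E.trans (LinearEquiv.smulOfNeZero ℂ V z hz0)
  refine ⟨⟨S, S.symm, by ext; simp, by ext; simp⟩, ?_, ?_⟩
  · intro a
    ext v
    change z • f (ρ a v) = τ a (z • f v)
    rw [Representation.IntertwiningMap.isIntertwining, map_smul]
  · change LinearMap.det (z • (E : V →ₗ[ℂ] V)) = 1
    rw [LinearMap.det_smul, hz, inv_mul_cancel₀ hd]

/-- The group of pairs of an element `b` and an operator realizing the conjugation by `b`, with
determinant an `m`-th root of unity. -/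
def NEmb.extGroup {A B : Type} [Group A] [Group B] (i : NEmb A B) {V : Type} [AddCommGroup V]
    [Module ℂ V] (ρ : Representation ℂ A V) (m : ℕ) : Subgroup (B × (Module.End ℂ V)ˣ) where
  carrier := {x | (∀ a, (x.2 : Module.End ℂ V) * ρ a = ρ (i.cj x.1 a) * x.2) ∧
    LinearMap.det (x.2 : Module.End ℂ V) ^ m = 1}
  one_mem' := by simp [NEmb.cj_one]
  mul_mem' := by
    rintro ⟨b, S⟩ ⟨c, T⟩ ⟨h1, h2⟩ ⟨h3, h4⟩
    refine ⟨fun a => ?_, ?_⟩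
    · simp only [Prod.mk_mul_mk, Units.val_mul, NEmb.cj_mul] at h1 h3 ⊢
      rw [mul_assoc, h3, ← mul_assoc, h1, mul_assoc]
    · simp only [Prod.mk_mul_mk, Units.val_mul, map_mul, mul_pow] at h2 h4 ⊢
      rw [h2, h4, one_mul]
  inv_mem' := by
    rintro ⟨b, S⟩ ⟨h1, h2⟩
    refine ⟨fun a => ?_, ?_⟩
    · have h3 := h1 (i.cj b⁻¹ a)
      simp only [Prod.fst_inv, Prod.snd_inv] at h3 ⊢
      rw [← i.cj_mul, mul_inv_cancel, i.cj_one] at h3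
      rw [Units.inv_mul_eq_iff_eq_mul, ← mul_assoc, h3, mul_assoc, Units.mul_inv, mul_one]
    · have h3 : LinearMap.det (S⁻¹ : (Module.End ℂ V)ˣ).val * LinearMap.det S.val = 1 := by
        rw [← map_mul, Units.inv_mul, map_one]
      have h4 := congrArg (· ^ m) h3
      simp only [mul_pow, one_pow] at h4 h2
      rw [h2, mul_one] at h4
      exact h4

theorem Representation.eq_smul_of_commute {A : Type} [Group A] [Finite A] {V : Type}
    [AddCommGroup V] [Module ℂ V] [Module.Finite ℂ V] (ρ : Representation ℂ A V)
    (hρ : IsIrrChar A ρ.character) (T : Module.End ℂ V) (h : ∀ a, T * ρ a = ρ a * T) :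
    ∃ z : ℂ, T = algebraMap ℂ (Module.End ℂ V) z := by
  have hρ' := ρ.isIrreducible_of_isIrrChar hρ
  obtain ⟨z, hz⟩ := (Representation.IsIrreducible.algebraMap_intertwiningMap_bijective_of_isAlgClosed
    (ρ := ρ)).2 (LinearMap.intertwiningMap_of_isIntertwiningMap ρ ρ T
      fun g v => LinearMap.congr_fun (h g) v)
  refine ⟨z, ?_⟩
  ext v
  exact (congrArg (fun f : Representation.IntertwiningMap ρ ρ => f v) hz).symm

namespace NEmb

variable {A B : Type} [Group A] [Group B] (i : NEmb A B)

section

variable {V : Type} [AddCommGroup V] [Module ℂ V] (ρ : Representation ℂ A V) (m : ℕ)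

/-- The projection of the extension group. -/
def extFst : i.extGroup ρ m →* B := (MonoidHom.fst _ _).comp (i.extGroup ρ m).subtype

/-- The embedding of the normal subgroup in the extension group. -/
def extEmb (hm : ∀ a, LinearMap.det (ρ a) ^ m = 1) : A →* i.extGroup ρ m :=
  (i.hom.prod ρ.toHomUnits).codRestrict _ fun a => by
    refine ⟨fun c => ?_, hm a⟩
    change ρ a * ρ c = ρ (i.cj (i.hom a) c) * ρ a
    rw [i.cj_hom, ← map_mul, ← map_mul, inv_mul_cancel_right]

theorem extEmb_normal (hm : ∀ a, LinearMap.det (ρ a) ^ m = 1) : (i.extEmb ρ m hm).range.Normal := by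
  refine ⟨?_⟩
  rintro _ ⟨a, rfl⟩ ⟨⟨b, T⟩, hT⟩
  refine ⟨i.cj b a, Subtype.ext (Prod.ext (i.hom_cj b a) (Units.ext ?_))⟩
  change ρ (i.cj b a) = T * ρ a * (T⁻¹ : (Module.End ℂ V)ˣ)
  rw [hT.1 a, mul_assoc, Units.mul_inv, mul_one]

/-- The scalars in the extension group. -/
def extScal [Module.Finite ℂ V] : rootsOfUnity (Module.finrank ℂ V * m) ℂ →* i.extGroup ρ m :=
  ((1 : rootsOfUnity (Module.finrank ℂ V * m) ℂ →* B).prod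
    ((Units.map (algebraMap ℂ (Module.End ℂ V)).toMonoidHom).comp
      (rootsOfUnity (Module.finrank ℂ V * m) ℂ).subtype)).codRestrict _ fun z => by
    have h := congrArg Units.val z.2
    rw [Units.val_pow_eq_pow_val, Units.val_one] at h
    refine ⟨fun c => ?_, ?_⟩
    · change algebraMap ℂ (Module.End ℂ V) z.1.1 * ρ c =
        ρ (i.cj 1 c) * algebraMap ℂ (Module.End ℂ V) z.1.1
      rw [i.cj_one]
      exact Algebra.commutes _ _
    · change LinearMap.det (algebraMap ℂ (Module.End ℂ V) z.1.1) ^ m = 1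
      rw [Algebra.algebraMap_eq_smul_one, LinearMap.det_smul, map_one, mul_one, ← pow_mul, h]

theorem exists_extScal [Finite A] [Module.Finite ℂ V] (hm0 : m ≠ 0) (hρ : IsIrrChar A ρ.character)
    (x : i.extGroup ρ m) (h : i.extFst ρ m x = 1) : ∃ z, i.extScal ρ m z = x := by
  obtain ⟨⟨b, T⟩, hT⟩ := x
  obtain rfl : b = 1 := h
  obtain ⟨z, hz⟩ := ρ.eq_smul_of_commute hρ T fun a => by
    have := hT.1 a
    rwa [i.cj_one] at this
  have hfr : Module.finrank ℂ V ≠ 0 := fun h0 => hρ.degree_ne_zero (by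
    rw [ρ.char_one, h0, Nat.cast_zero])
  have h1 : z ^ (Module.finrank ℂ V * m) = 1 := by
    have := hT.2
    rwa [hz, Algebra.algebraMap_eq_smul_one, LinearMap.det_smul, map_one, mul_one, ← pow_mul] at this
  have h0 : z ≠ 0 := by
    rintro rfl
    rw [zero_pow (mul_ne_zero hfr hm0)] at h1
    exact zero_ne_one h1
  refine ⟨⟨Units.mk0 z h0, Units.ext (by simpa using h1)⟩, Subtype.ext (Prod.ext rfl (Units.ext ?_))⟩
  exact hz.symm

end

variable [Finite A] [Finite B]

/-- Extension of an invariant character under coprimality assumptions. -/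
theorem exists_extension {σ : Set ℕ} {θ : A → ℂ} (hθ : IsIrrChar A θ)
    (hinv : ∀ b, θ ∘ i.cj b = θ) (hdeg : IsPiNumber σ (cdeg θ)) (hdet : DetPi σ θ)
    (hq : IsPiNumber σᶜ i.hom.range.index) :
    ∃ Θ, IsCharacter B Θ ∧ Θ ∘ i.hom = θ ∧ DetPi σ Θ := by
  obtain ⟨m, hm0, hmσ, hm⟩ := hdet
  obtain ⟨V, _, _, _, ρ, rfl⟩ := hθ.1.exists_rep
  simp only [cdet_rep] at hm
  rw [cdeg_eq_of ρ.char_one] at hdeg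
  let E := i.extGroup ρ m
  let pr : E →* B := i.extFst ρ m
  let em : A →* E := i.extEmb ρ m hm
  have hem : em.range.Normal := i.extEmb_normal ρ m hm
  have hpe : ∀ a, pr (em a) = i.hom a := fun a => rfl
  have hsurj : Function.Surjective pr := by
    intro b
    obtain ⟨T, h1, h2⟩ := ρ.exists_intertwiner
      (ρ.comp (i.cj b).toMonoidHom : Representation ℂ A V) hθ (hinv b).symm
    exact ⟨⟨(b, T), h1, by rw [h2, one_pow]⟩, rfl⟩
  have hin := i.normal
  let M : Subgroup E := i.hom.range.comap pr
  have hM : M.Normal := Subgroup.Normal.comap hin pr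
  have hle : em.range ≤ M := by
    rintro _ ⟨a, rfl⟩
    exact ⟨a, rfl⟩
  let q := QuotientGroup.mk' em.range
  have hqs : Function.Surjective q := QuotientGroup.mk'_surjective _
  let N := M.map q
  have hN : N.Normal := Subgroup.Normal.map hM q hqs
  have hker : q.ker = em.range := QuotientGroup.ker_mk' _
  have hqe : ∀ a, q (em a) = 1 := fun a => (QuotientGroup.eq_one_iff _).2 ⟨a, rfl⟩
  have hfr : Module.finrank ℂ V ≠ 0 := fun h0 => hθ.degree_ne_zero (by
    rw [ρ.char_one, h0, Nat.cast_zero])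
  have hMN : ∀ x ∈ M, ∃ a z, x = em a * i.extScal ρ m z := by
    rintro x ⟨a, ha⟩
    obtain ⟨z, hz⟩ := i.exists_extScal ρ m hm0.ne' hθ ((em a)⁻¹ * x) (by
      change pr ((em a)⁻¹ * x) = 1
      rw [map_mul, map_inv, hpe, ha, inv_mul_cancel])
    exact ⟨a, z, by rw [hz, mul_inv_cancel_left]⟩
  have hcard : Nat.card N ∣ Module.finrank ℂ V * m := by
    have : NeZero (Module.finrank ℂ V * m) := ⟨mul_ne_zero hfr hm0.ne'⟩
    have h1 : N ≤ (q.comp (i.extScal ρ m)).range := by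
      rintro _ ⟨x, hx, rfl⟩
      obtain ⟨a, z, rfl⟩ := hMN x hx
      refine ⟨z, ?_⟩
      rw [map_mul, hqe, one_mul]
      rfl
    have h2 := Subgroup.card_range_dvd (q.comp (i.extScal ρ m))
    rw [Complex.card_rootsOfUnity] at h2
    exact (Subgroup.card_dvd_of_le h1).trans h2
  have hindex : N.index = i.hom.range.index := by
    rw [Subgroup.index_map_eq _ hqs (hker.le.trans hle), Subgroup.index_comap_of_surjective _ hsurj]
  obtain ⟨C, hC⟩ := Subgroup.exists_right_complement'_of_coprime (N := N) (by
    rw [hindex]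
    exact isPiNumber_coprime (isPiNumber_of_dvd (isPiNumber_mul hdeg hmσ) hcard) hq)
  let C' : Subgroup E := C.comap q
  have hemC : ∀ a, em a ∈ C' := by
    intro a
    change q (em a) ∈ C
    rw [hqe]
    exact C.one_mem
  have hbij : Function.Bijective (pr.comp C'.subtype) := by
    constructor
    · rw [injective_iff_map_eq_one]
      rintro ⟨x, hx⟩ h1
      change pr x = 1 at h1
      have h2 : q x ∈ N ⊓ C := ⟨⟨x, ⟨1, by rw [map_one, h1]⟩, rfl⟩, hx⟩
      rw [hC.disjoint.eq_bot, Subgroup.mem_bot, ← MonoidHom.mem_ker, hker] at h2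
      obtain ⟨a, rfl⟩ := h2
      rw [hpe, ← map_one i.hom] at h1
      refine Subtype.ext ?_
      change em a = 1
      rw [i.inj h1, map_one]
    · intro b
      obtain ⟨x, rfl⟩ := hsurj b
      obtain ⟨⟨n, c⟩, hnc⟩ := hC.2 (q x)
      obtain ⟨_, y, ⟨a, ha⟩, rfl⟩ := n
      change q y * c = q x at hnc
      have h1 : y⁻¹ * x ∈ C' := by
        change q (y⁻¹ * x) ∈ C
        rw [map_mul, map_inv, ← hnc, inv_mul_cancel_left]
        exact c.2
      refine ⟨⟨em a * (y⁻¹ * x), C'.mul_mem (hemC a) h1⟩, ?_⟩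
      change pr (em a * (y⁻¹ * x)) = pr x
      rw [map_mul, map_mul, map_inv, hpe, ha, mul_inv_cancel_left]
  let F : C' ≃* B := MulEquiv.ofBijective _ hbij
  let τ : Representation ℂ B V := (Units.coeHom _).comp ((MonoidHom.snd B (Module.End ℂ V)ˣ).comp
    (E.subtype.comp (C'.subtype.comp F.symm.toMonoidHom)))
  have hτ : ∀ a, τ (i.hom a) = ρ a := by
    intro a
    have : F.symm (i.hom a) = ⟨em a, hemC a⟩ := by
      rw [MulEquiv.symm_apply_eq]
      rfl
    change ((F.symm (i.hom a)).1.1.2 : Module.End ℂ V) = ρ a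
    rw [this]
    rfl
  refine ⟨τ.character, IsCharacter.of_rep τ, ?_, m, hm0, hmσ, fun b => ?_⟩
  · funext a
    exact congrArg (LinearMap.trace ℂ V) (hτ a)
  · rw [cdet_rep]
    exact (F.symm b).1.2.2

theorem range_le_stab_index {θ : A → ℂ} (h : IsCharacter A θ) :
    (i.stab θ).index ∣ i.hom.range.index :=
  Subgroup.index_dvd_of_le (i.range_le_stab h)

theorem stab_eq_top {σ : Set ℕ} {θ : A → ℂ} (hθ : IsIrrChar A θ)
    (hq : IsPiNumber σᶜ i.hom.range.index) {χ : B → ℂ} (hχ : IsIrrChar B χ)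
    (h1 : cinner (χ ∘ i.hom) θ ≠ 0) (hχd : IsPiNumber σ (cdeg χ)) : i.stab θ = ⊤ := by
  obtain ⟨e, -, he⟩ := i.exists_mult hχ hθ h1
  have h2 := i.clifford_degree hχ hθ h1 he
  rw [← Subgroup.index_eq_one]
  have h3 : (i.stab θ).index ∣ cdeg χ := ⟨e * cdeg θ, by rw [h2]; ring⟩
  have := isPiNumber_coprime (isPiNumber_of_dvd hχd h3)
    (isPiNumber_of_dvd hq (i.range_le_stab_index hθ.1))
  rwa [Nat.coprime_self] at this

/-- Restriction of characters of `σ`-degree to a normal subgroup with `σ'`-index. -/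
theorem comp_eq_of_coprime {σ : Set ℕ} {θ : A → ℂ} (hθ : IsIrrChar A θ)
    (hdeg : IsPiNumber σ (cdeg θ)) (hdet : DetPi σ θ)
    (hq : IsPiNumber σᶜ i.hom.range.index) {χ : B → ℂ} (hχ : IsIrrChar B χ)
    (h1 : cinner (χ ∘ i.hom) θ ≠ 0) (hχd : IsPiNumber σ (cdeg χ)) : χ ∘ i.hom = θ := by
  have htop := i.stab_eq_top hθ hq hχ h1 hχd
  obtain ⟨Θ, hΘ, rfl, -⟩ := i.exists_extension hθ
    (fun b => i.mem_stab.1 (htop ▸ Subgroup.mem_top b)) hdeg hdet hq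
  obtain ⟨δ, hδ, hδinv, rfl⟩ := i.gallagher hΘ hθ hχ h1
  have h2 : cdeg (Θ * δ) = cdeg Θ * cdeg δ := cdeg_eq_of (by
    rw [Pi.mul_apply, hΘ.apply_one, hδ.1.apply_one, Nat.cast_mul])
  have h3 : cdeg δ = 1 := by
    have := isPiNumber_coprime (isPiNumber_of_dvd hχd (h2 ▸ Dvd.intro_left _ rfl))
      (isPiNumber_of_dvd hq (i.cdeg_dvd hδ hδinv))
    rwa [Nat.coprime_self] at this
  funext a
  have h4 := hδinv 1 a
  rw [one_mul, hδ.1.apply_one, h3, Nat.cast_one] at h4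
  simp [h4]

end NEmb

theorem IsCharacter.forall_constituents {G : Type} [Group G] [Finite G]
    {Q P : (G → ℂ) → Prop} (h0 : P 0)
    (hadd : ∀ θ ξ, IsIrrChar G θ → Q θ → IsCharacter G ξ → P ξ → P (θ + ξ)) {ω : G → ℂ}
    (hω : IsCharacter G ω) (hQ : ∀ θ, IsIrrChar G θ → cinner ω θ ≠ 0 → Q θ) : P ω := by
  revert hQ
  refine IsCharacter.induction
    (P := fun ω => (∀ θ, IsIrrChar G θ → cinner ω θ ≠ 0 → Q θ) → P ω) (fun _ => h0) ?_ hω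
  intro θ ξ hθ hξ ih hQ
  refine hadd θ ξ hθ (hQ θ hθ ?_) hξ (ih fun κ hκ hne => hQ κ hκ ?_)
  · exact hθ.1.cinner_add_ne_zero_left hξ hθ.1 (by rw [hθ.cinner_self]; exact one_ne_zero)
  · rw [add_comm]
    exact hξ.cinner_add_ne_zero_left hθ.1 hκ.1 hne

namespace NEmb

variable {A B C : Type} [Group A] [Group B] [Group C]

/-- The composition with isomorphisms. -/
def congr (i : NEmb A B) {A' B' : Type} [Group A'] [Group B'] (e : A' ≃* A) (f : B ≃* B') :
    NEmb A' B' where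
  hom := f.toMonoidHom.comp (i.hom.comp e.toMonoidHom)
  inj := f.injective.comp (i.inj.comp e.injective)
  normal := by
    refine ⟨?_⟩
    rintro _ ⟨a, rfl⟩ b
    refine ⟨e.symm (i.cj (f.symm b) (e a)), ?_⟩
    change f (i.hom (e (e.symm _))) = b * f (i.hom (e a)) * b⁻¹
    rw [e.apply_symm_apply, i.hom_cj]
    simp

/-- The inclusion of a normal subgroup. -/
def ofNormal (N : Subgroup B) (h : N.Normal) : NEmb N B where
  hom := N.subtype
  inj := N.subtype_injective
  normal := by rwa [Subgroup.range_subtype]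

/-- The inclusion of nested subgroups. -/
def ofLe {H K : Subgroup B} (hle : H ≤ K) (h : (H.subgroupOf K).Normal) : NEmb H K where
  hom := Subgroup.inclusion hle
  inj := Subgroup.inclusion_injective hle
  normal := by rwa [Subgroup.inclusion_range]

variable (i : NEmb A B) (j : NEmb C B)

/-- The intersection of two normal subgroups. -/
def pb : Subgroup (A × C) :=
  (i.hom.comp (MonoidHom.fst A C)).eqLocus (j.hom.comp (MonoidHom.snd A C))

/-- The inclusion of the intersection in the first subgroup. -/
def pb₁ : NEmb (i.pb j) A where
  hom := (MonoidHom.fst A C).comp (i.pb j).subtype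
  inj := by
    rintro ⟨⟨a, c⟩, h⟩ ⟨⟨a', c'⟩, h'⟩ he
    change i.hom a = j.hom c at h
    change i.hom a' = j.hom c' at h'
    obtain rfl : a = a' := he
    obtain rfl : c = c' := j.inj (h.symm.trans h')
    rfl
  normal := by
    refine ⟨?_⟩
    rintro _ ⟨⟨⟨a, c⟩, h⟩, rfl⟩ g
    change i.hom a = j.hom c at h
    refine ⟨⟨(g * a * g⁻¹, j.cj (i.hom g) c), ?_⟩, rfl⟩
    change i.hom (g * a * g⁻¹) = j.hom (j.cj (i.hom g) c)
    rw [j.hom_cj, ← h]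
    simp

/-- The inclusion of the intersection in the second subgroup. -/
def pb₂ : NEmb (i.pb j) C where
  hom := (MonoidHom.snd A C).comp (i.pb j).subtype
  inj := by
    rintro ⟨⟨a, c⟩, h⟩ ⟨⟨a', c'⟩, h'⟩ he
    change i.hom a = j.hom c at h
    change i.hom a' = j.hom c' at h'
    obtain rfl : c = c' := he
    obtain rfl : a = a' := i.inj (h.trans h'.symm)
    rfl
  normal := by
    refine ⟨?_⟩
    rintro _ ⟨⟨⟨a, c⟩, h⟩, rfl⟩ g
    change i.hom a = j.hom c at h
    refine ⟨⟨(i.cj (j.hom g) a, g * c * g⁻¹), ?_⟩, rfl⟩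
    change i.hom (i.cj (j.hom g) a) = j.hom (g * c * g⁻¹)
    rw [i.hom_cj, h]
    simp

theorem pb_comm : i.hom.comp (i.pb₁ j).hom = j.hom.comp (i.pb₂ j).hom := by
  ext x
  exact x.2

theorem range_pb₂ : (i.pb₂ j).hom.range = i.hom.range.comap j.hom := by
  ext c
  constructor
  · rintro ⟨x, rfl⟩
    exact ⟨x.1.1, x.2⟩
  · rintro ⟨a, ha⟩
    exact ⟨⟨(a, c), ha⟩, rfl⟩

theorem index_pb₂ [Finite B] : (i.pb₂ j).hom.range.index ∣ i.hom.range.index := by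
  have := i.normal
  rw [range_pb₂, Subgroup.index_comap]
  exact Subgroup.relIndex_dvd_index_of_normal _ _

theorem cdeg_dvd_of_constituent [Finite A] [Finite B] {χ : B → ℂ} (hχ : IsIrrChar B χ)
    {θ : A → ℂ} (hθ : IsIrrChar A θ) (h : cinner (χ ∘ i.hom) θ ≠ 0) : cdeg θ ∣ cdeg χ := by
  obtain ⟨e, -, he⟩ := i.exists_mult hχ hθ h
  exact ⟨_, (i.clifford_degree hχ hθ h he).trans (mul_comm _ _)⟩

theorem finite_of_emb (i : NEmb A B) [Finite B] : Finite A := Finite.of_injective _ i.inj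

end NEmb

/-- The local conditions on a special character. -/
def PreSpec (σ : Set ℕ) (B : Type) [Group B] (χ : B → ℂ) : Prop :=
  IsIrrChar B χ ∧ IsPiNumber σ (cdeg χ) ∧ DetPi σ χ

/-- The conditions for a special character, for subnormal subgroups of bounded depth. -/
def SpecN (σ : Set ℕ) : ℕ → ∀ (B : Type) [Group B], (B → ℂ) → Prop
  | 0, B, _, χ => PreSpec σ B χ
  | n + 1, B, _, χ => PreSpec σ B χ ∧ ∀ (A : Type) [Group A] (i : NEmb A B) (θ : A → ℂ),
      IsIrrChar A θ → cinner (χ ∘ i.hom) θ ≠ 0 → SpecN σ n A θ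

/-- Special characters, defined through iterated normal subgroups. -/
def Spec (σ : Set ℕ) (B : Type) [Group B] (χ : B → ℂ) : Prop := ∀ n, SpecN σ n B χ

section

variable {σ : Set ℕ} {A B C : Type} [Group A] [Group B] [Group C] {χ : B → ℂ}

theorem SpecN.preSpec {n : ℕ} (h : SpecN σ n B χ) : PreSpec σ B χ := by
  cases n with
  | zero => exact h
  | succ n => exact h.1

theorem Spec.irr (h : Spec σ B χ) : IsIrrChar B χ := (h 0).1

theorem Spec.deg (h : Spec σ B χ) : IsPiNumber σ (cdeg χ) := (h 0).2.1

theorem Spec.det (h : Spec σ B χ) : DetPi σ χ := (h 0).2.2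

theorem Spec.constituent (h : Spec σ B χ) (i : NEmb A B) {θ : A → ℂ} (hθ : IsIrrChar A θ)
    (h1 : cinner (χ ∘ i.hom) θ ≠ 0) : Spec σ A θ := fun n => (h (n + 1)).2 A i θ hθ h1

theorem DetPi.comp [Finite A] [Finite B] (f : A →* B) (hχ : IsCharacter B χ) (h : DetPi σ χ) :
    DetPi σ (χ ∘ f) := by
  obtain ⟨k, hk, hk', h⟩ := h
  exact ⟨k, hk, hk', fun a => by rw [cdet_comp f hχ, h]⟩

theorem SpecN.comp_equiv [Finite B] {n : ℕ} (h : SpecN σ n B χ) (e : C ≃* B) :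
    SpecN σ n C (χ ∘ e) := by
  have : Finite C := Finite.of_equiv _ e.symm.toEquiv
  have hp : PreSpec σ C (χ ∘ e) := by
    refine ⟨h.preSpec.1.comp_equiv e, ?_, h.preSpec.2.2.comp e.toMonoidHom h.preSpec.1.1⟩
    have : cdeg (χ ∘ e) = cdeg χ := by simp [cdeg]
    rw [this]
    exact h.preSpec.2.1
  cases n with
  | zero => exact hp
  | succ n =>
    refine ⟨hp, fun A _ i θ hθ h1 => h.2 A (i.congr (MulEquiv.refl A) e) θ hθ h1⟩

theorem Spec.comp_equiv [Finite B] (h : Spec σ B χ) (e : C ≃* B) : Spec σ C (χ ∘ e) :=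
  fun n => (h n).comp_equiv e

theorem DetPi.of_constituents [Finite B] {ω : B → ℂ} (hω : IsCharacter B ω)
    (h : ∀ θ, IsIrrChar B θ → cinner ω θ ≠ 0 → DetPi σ θ) : DetPi σ ω := by
  refine hω.forall_constituents (Q := DetPi σ) (P := DetPi σ)
    ⟨1, one_pos, isPiNumber_one σ, fun g => by rw [cdet_zero, one_pow]⟩ ?_ h
  rintro θ ξ hθ ⟨k, hk, hk', h1⟩ hξ ⟨l, hl, hl', h2⟩
  refine ⟨k * l, Nat.mul_pos hk hl, isPiNumber_mul hk' hl', fun g => ?_⟩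
  rw [cdet_add hθ.1 hξ, mul_pow, pow_mul, h1, mul_comm k l, pow_mul, h2, one_pow, one_pow, one_mul]

theorem NEmb.pow_index_mem (i : NEmb A B) [Finite B] (b : B) :
    ∃ a, i.hom a = b ^ i.hom.range.index := by
  have := i.normal
  exact Subgroup.pow_index_mem i.hom.range b

theorem SpecN.of_index [Finite B] {n : ℕ} (i : NEmb A B) (hi : IsPiNumber σ i.hom.range.index)
    (hχ : IsIrrChar B χ) (hd : IsPiNumber σ (cdeg χ))
    (h : ∀ θ, IsIrrChar A θ → cinner (χ ∘ i.hom) θ ≠ 0 → Spec σ A θ) : SpecN σ n B χ := by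
  induction n generalizing A B with
  | zero =>
    have := i.finite_of_emb
    refine ⟨hχ, hd, ?_⟩
    obtain ⟨k, hk, hk', h1⟩ :=
      DetPi.of_constituents (hχ.1.comp i.hom) fun θ hθ hne => (h θ hθ hne).det
    refine ⟨i.hom.range.index * k, Nat.mul_pos (Nat.pos_of_ne_zero Subgroup.index_ne_zero_of_finite) hk,
      isPiNumber_mul hi hk', fun b => ?_⟩
    obtain ⟨a, ha⟩ := i.pow_index_mem b
    have h2 : cdet χ b ^ i.hom.range.index = cdet χ (i.hom a) := by
      rw [ha]
      exact (map_pow (cdetHom χ) b _).symm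
    rw [pow_mul, h2, ← cdet_comp i.hom hχ.1, h1]
  | succ n ih =>
    refine ⟨(ih i hi hχ hd h).preSpec, fun C _ j κ hκ hne => ?_⟩
    have := i.finite_of_emb
    have := j.finite_of_emb
    have := (i.pb₂ j).finite_of_emb
    refine ih (i.pb₂ j) (isPiNumber_of_dvd hi (i.index_pb₂ j)) hκ
      (isPiNumber_of_dvd hd (j.cdeg_dvd_of_constituent hχ hκ hne)) fun τ hτ h1 => ?_
    have h2 := cinner_comp_ne_zero (i.pb₂ j).hom (hχ.1.comp j.hom) hκ hne hτ.1 h1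
    have h3 : (χ ∘ j.hom) ∘ (i.pb₂ j).hom = (χ ∘ i.hom) ∘ (i.pb₁ j).hom := by
      funext x
      exact congrArg χ (DFunLike.congr_fun (i.pb_comm j) x).symm
    rw [h3] at h2
    obtain ⟨θ, hθ, h4, h5⟩ := (hχ.1.comp i.hom).exists_over _ h2
    exact (h θ hθ h4).constituent (i.pb₁ j) hτ h5

theorem Spec.of_index [Finite B] (i : NEmb A B) (hi : IsPiNumber σ i.hom.range.index)
    (hχ : IsIrrChar B χ) (hd : IsPiNumber σ (cdeg χ))
    (h : ∀ θ, IsIrrChar A θ → cinner (χ ∘ i.hom) θ ≠ 0 → Spec σ A θ) : Spec σ B χ :=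
  fun _ => SpecN.of_index i hi hχ hd h

theorem NEmb.detPi_constituent [Finite B] (i : NEmb A B) (j : NEmb C B)
    (hi : IsPiNumber σᶜ i.hom.range.index) (hχ : IsCharacter B χ) (hA : IsIrrChar A (χ ∘ i.hom))
    (hd : IsPiNumber σ (cdeg χ)) (hdet : DetPi σ χ) {κ : C → ℂ} (hκ : IsIrrChar C κ)
    (h1 : cinner (χ ∘ j.hom) κ ≠ 0) (hP : DetPi σ (κ ∘ (i.pb₂ j).hom)) : DetPi σ κ := by
  have := i.finite_of_emb
  have := j.finite_of_emb
  have := (i.pb₂ j).finite_of_emb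
  have := i.normal
  have := j.normal
  obtain ⟨k, hk, hk', h2⟩ := hP
  obtain ⟨l, hl, hl', h3⟩ := hdet
  set D : Subgroup B := i.hom.range ⊔ j.hom.range with hD
  let i' := i.codRestrict D le_sup_left
  let j' := j.codRestrict D le_sup_right
  have hν : IsIrrChar D (χ ∘ D.subtype) :=
    (hχ.comp D.subtype).isIrrChar_of_comp i'.hom hA
  have hℓ : ∀ (d : D) (c : C), cdet κ (j'.cj d c) ^ k = cdet κ c ^ k := by
    rintro ⟨d, hd⟩ c
    rw [hD, ← SetLike.mem_coe, Subgroup.normal_mul] at hd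
    obtain ⟨_, ⟨a, rfl⟩, _, ⟨x, rfl⟩, rfl⟩ := hd
    have hcj : j'.cj ⟨i.hom a * j.hom x, hd⟩ c = j.cj (i.hom a) (x * c * x⁻¹) := by
      rw [cj_codRestrict, j.cj_mul, j.cj_hom]
    have hconj : cdet κ (x * c * x⁻¹) = cdet κ c := by
      have : cdet κ x * cdet κ x⁻¹ = 1 := by
        rw [← cdet_mul_apply, mul_inv_cancel, cdet_one_apply]
      rw [cdet_mul_apply, cdet_mul_apply, mul_right_comm, this, one_mul]
    obtain ⟨y, hy⟩ : ∃ y, (i.pb₂ j).hom y = j.cj (i.hom a) (x * c * x⁻¹) * (x * c * x⁻¹)⁻¹ := by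
      refine ⟨⟨(a * i.cj (j.hom (x * c * x⁻¹)) a⁻¹, _), ?_⟩, rfl⟩
      generalize x * c * x⁻¹ = z
      change i.hom (a * i.cj (j.hom z) a⁻¹) = j.hom (j.cj (i.hom a) z * z⁻¹)
      rw [map_mul, i.hom_cj, map_mul, j.hom_cj, map_inv, map_inv]
      group
    have h4 := h2 y
    rw [cdet_comp _ hκ.1, hy, cdet_mul_apply, mul_pow] at h4
    have h5 : cdet κ (x * c * x⁻¹)⁻¹ * cdet κ (x * c * x⁻¹) = 1 := by
      rw [← cdet_mul_apply, inv_mul_cancel, cdet_one_apply]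
    have h6 := congrArg (· ^ k) h5
    simp only [mul_pow, one_pow] at h6
    rw [hcj, ← hconj]
    calc _ = cdet κ (j.cj (i.hom a) (x * c * x⁻¹)) ^ k * (cdet κ (x * c * x⁻¹)⁻¹ ^ k *
          cdet κ (x * c * x⁻¹) ^ k) := by rw [h6, mul_one]
      _ = _ := by rw [← mul_assoc, h4, one_mul]
  obtain ⟨t, ht, ht'⟩ : ∃ t, cdeg (χ ∘ j.hom) = t * cdeg κ ∧
      ∀ c, cdet (χ ∘ j.hom) c ^ k = (cdet κ c ^ k) ^ t := by
    refine (hχ.comp j.hom).forall_constituents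
      (Q := fun κ' => cdeg κ' = cdeg κ ∧ ∀ c, cdet κ' c ^ k = cdet κ c ^ k)
      (P := fun ω => ∃ t, cdeg ω = t * cdeg κ ∧ ∀ c, cdet ω c ^ k = (cdet κ c ^ k) ^ t)
      ⟨0, by rw [zero_mul]; exact cdeg_eq_of (by simp), fun c => by simp [cdet_zero]⟩ ?_ ?_
    · rintro κ' ξ hκ' ⟨h4, h5⟩ hξ ⟨t, h6, h7⟩
      refine ⟨t + 1, cdeg_eq_of ?_, fun c => ?_⟩
      · rw [Pi.add_apply, hκ'.1.apply_one, hξ.apply_one, h4, h6]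
        push_cast
        ring
      · rw [cdet_add hκ'.1 hξ, mul_pow, h5, h7, pow_succ']
    · intro κ' hκ' hne
      obtain ⟨d, rfl⟩ := j'.exists_conj hν hκ hκ' h1 hne
      refine ⟨by simp [cdeg], fun c => ?_⟩
      rw [← hℓ d c]
      congr 1
      exact cdet_comp (j'.cj d).toMonoidHom hκ.1 c
  have ht0 : cdeg (χ ∘ j.hom) = cdeg χ := by simp [cdeg]
  rw [ht0] at ht
  have htσ : IsPiNumber σ t := isPiNumber_of_dvd hd ⟨_, ht⟩
  refine ⟨k, hk, hk', fun c => ?_⟩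
  have h4 : (cdet κ c ^ k) ^ (t * l) = 1 := by
    rw [pow_mul, ← ht', cdet_comp _ hχ, ← pow_mul, mul_comm, pow_mul, h3, one_pow]
  have h5 : (cdet κ c ^ k) ^ (i.pb₂ j).hom.range.index = 1 := by
    obtain ⟨y, hy⟩ := (i.pb₂ j).pow_index_mem c
    have h6 : cdet κ c ^ (i.pb₂ j).hom.range.index = cdet κ ((i.pb₂ j).hom y) := by
      rw [hy]
      exact (map_pow (cdetHom κ) c _).symm
    rw [← pow_mul, mul_comm, pow_mul, h6, ← cdet_comp _ hκ.1, h2]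
  have h7 := isPiNumber_coprime (isPiNumber_mul htσ hl') (isPiNumber_of_dvd hi (i.index_pb₂ j))
  rw [← orderOf_dvd_iff_pow_eq_one] at h4 h5
  rw [← orderOf_eq_one_iff]
  exact Nat.dvd_one.1 (h7 ▸ Nat.dvd_gcd h4 h5)

theorem SpecN.of_comp [Finite B] {n : ℕ} (i : NEmb A B) (hi : IsPiNumber σᶜ i.hom.range.index)
    (hχ : IsCharacter B χ) (h : Spec σ A (χ ∘ i.hom)) (hdet : DetPi σ χ) : SpecN σ n B χ := by
  have hd : IsPiNumber σ (cdeg χ) := by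
    have := h.deg
    simpa [cdeg] using this
  have hirr := hχ.isIrrChar_of_comp i.hom h.irr
  induction n generalizing A B with
  | zero => exact ⟨hirr, hd, hdet⟩
  | succ n ih =>
    refine ⟨⟨hirr, hd, hdet⟩, fun C _ j κ hκ hne => ?_⟩
    have := i.finite_of_emb
    have := j.finite_of_emb
    have := (i.pb₂ j).finite_of_emb
    have hκd := isPiNumber_of_dvd hd (j.cdeg_dvd_of_constituent hirr hκ hne)
    have hcon : ∀ τ, IsIrrChar _ τ → cinner (κ ∘ (i.pb₂ j).hom) τ ≠ 0 → Spec σ _ τ := by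
      intro τ hτ h1
      have h2 := cinner_comp_ne_zero (i.pb₂ j).hom (hχ.comp j.hom) hκ hne hτ.1 h1
      have h3 : (χ ∘ j.hom) ∘ (i.pb₂ j).hom = (χ ∘ i.hom) ∘ (i.pb₁ j).hom := by
        funext x
        exact congrArg χ (DFunLike.congr_fun (i.pb_comm j) x).symm
      rw [h3] at h2
      exact h.constituent (i.pb₁ j) hτ h2
    obtain ⟨τ, hτ, h1⟩ := hκ.exists_comp (i.pb₂ j).hom
    have hτs := hcon τ hτ h1
    have hidx := isPiNumber_of_dvd hi (i.index_pb₂ j)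
    have h2 := (i.pb₂ j).comp_eq_of_coprime hτ hτs.deg hτs.det hidx hκ h1 hκd
    have h3 := i.detPi_constituent j hi hχ h.irr hd hdet hκ hne (h2 ▸ hτs.det)
    exact ih (i.pb₂ j) hidx hκ.1 (h2 ▸ hτs) h3 hκd hκ

theorem Spec.of_comp [Finite B] (i : NEmb A B) (hi : IsPiNumber σᶜ i.hom.range.index)
    (hχ : IsCharacter B χ) (h : Spec σ A (χ ∘ i.hom)) (hdet : DetPi σ χ) : Spec σ B χ :=
  fun _ => SpecN.of_comp i hi hχ h hdet

end

section

variable {G : Type} [Group G]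

theorem IsSubnormalSubgroup.top : IsSubnormalSubgroup (⊤ : Subgroup G) :=
  ⟨0, fun _ => ⊤, rfl, rfl, fun i => i.elim0⟩

theorem IsSubnormalSubgroup.step {H K : Subgroup G} (hK : IsSubnormalSubgroup K) (hle : H ≤ K)
    (h : (H.subgroupOf K).Normal) : IsSubnormalSubgroup H := by
  obtain ⟨n, c, h0, h1, h2⟩ := hK
  refine ⟨n + 1, Fin.cons H c, rfl, ?_, fun i => ?_⟩
  · rw [← Fin.succ_last, Fin.cons_succ, h1]
  · refine Fin.cases ?_ (fun i => ?_) i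
    · change H ≤ c 0 ∧ (H.subgroupOf (c 0)).Normal
      rw [h0]
      exact ⟨hle, h⟩
    · exact h2 i

theorem IsSubnormalSubgroup.induction {P : Subgroup G → Prop} (htop : P ⊤)
    (hstep : ∀ H K : Subgroup G, H ≤ K → (H.subgroupOf K).Normal → P K → P H) {H : Subgroup G}
    (h : IsSubnormalSubgroup H) : P H := by
  obtain ⟨n, c, rfl, h1, h2⟩ := h
  refine Fin.reverseInduction (motive := fun i => P (c i)) (h1 ▸ htop) (fun i ih => ?_) 0
  exact hstep _ _ (h2 i).1 (h2 i).2 ih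

variable {σ : Set ℕ} {χ : G → ℂ}

theorem Spec.isPiSpecial [Finite G] (h : Spec σ G χ) : IsPiSpecial σ G χ := by
  refine ⟨h.irr, ⟨_, h.irr.1.apply_one, h.deg⟩, fun M hM θ hθ => ?_⟩
  have key : ∀ θ : M → ℂ, IsIrrChar M θ → cinner (χ ∘ M.subtype) θ ≠ 0 → Spec σ M θ := by
    refine IsSubnormalSubgroup.induction (P := fun M => ∀ θ : M → ℂ, IsIrrChar M θ →
      cinner (χ ∘ M.subtype) θ ≠ 0 → Spec σ M θ) ?_ ?_ hM
    · intro θ hθ h1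
      exact h.constituent (NEmb.ofNormal ⊤ inferInstance) hθ h1
    · intro H K hle hn ih θ hθ h1
      obtain ⟨κ, hκ, h2, h3⟩ :=
        (h.irr.1.comp K.subtype).exists_over (NEmb.ofLe hle hn).hom (θ := θ) h1
      exact (ih κ hκ h2).constituent (NEmb.ofLe hle hn) hθ h3
  replace hθ := (isConstituent_iff (h.irr.1.comp M.subtype)).1 hθ
  exact hasPiDetOrder_iff.2 ⟨hθ.1.1, (key θ hθ.1 hθ.2).det⟩

theorem IsPiSpecial.spec [Finite G] (h : IsPiSpecial σ G χ) : Spec σ G χ := by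
  obtain ⟨hirr, ⟨d, hd, hdσ⟩, hdet⟩ := h
  have key : ∀ (n : ℕ) (A : Type) [Group A] (f : A →* G) (θ : A → ℂ), Function.Injective f →
      IsSubnormalSubgroup f.range → IsIrrChar A θ → cinner (χ ∘ f) θ ≠ 0 → IsPiNumber σ (cdeg θ) →
      SpecN σ n A θ := by
    intro n
    induction n with
    | zero =>
      intro A _ f θ hf hs hθ h1 hd
      have : Finite A := Finite.of_injective _ hf
      refine ⟨hθ, hd, ?_⟩
      let e : A ≃* f.range := MonoidHom.ofInjective hf
      have h2 : cinner (χ ∘ f.range.subtype) (θ ∘ e.symm) ≠ 0 := by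
        rw [← cinner_equiv e]
        have h3 : (χ ∘ f.range.subtype) ∘ e = χ ∘ f := rfl
        have h4 : (θ ∘ e.symm) ∘ e = θ := by
          funext a
          simp
        rwa [h3, h4]
      have h3 := (hasPiDetOrder_iff.1 (hdet _ hs (θ ∘ e.symm)
        ((isConstituent_iff (hirr.1.comp _)).2 ⟨hθ.comp_equiv e.symm, h2⟩))).2
      have h4 := h3.comp e.toMonoidHom (hθ.comp_equiv e.symm).1
      have h5 : (θ ∘ e.symm) ∘ e.toMonoidHom = θ := by
        funext a
        simp
      rwa [h5] at h4
    | succ n ih =>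
      intro A _ f θ hf hs hθ h1 hd
      have : Finite A := Finite.of_injective _ hf
      refine ⟨(ih A f θ hf hs hθ h1 hd).preSpec, fun C _ i κ hκ h2 => ?_⟩
      have := i.finite_of_emb
      refine ih C (f.comp i.hom) κ (hf.comp i.inj) ?_ hκ ?_ ?_
      · refine hs.step ?_ ?_
        · rintro _ ⟨c, rfl⟩
          exact ⟨i.hom c, rfl⟩
        · refine ⟨?_⟩
          rintro ⟨_, ⟨a, rfl⟩⟩ ⟨c, hc⟩ ⟨_, ⟨b, rfl⟩⟩
          refine ⟨i.cj b c, ?_⟩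
          change f (i.hom (i.cj b c)) = f b * f a * (f b)⁻¹
          change f (i.hom c) = f a at hc
          rw [i.hom_cj, ← hc]
          simp
      · exact cinner_comp_ne_zero i.hom (hirr.1.comp f) hθ h1 hκ.1 h2
      · exact isPiNumber_of_dvd hd (i.cdeg_dvd_of_constituent hθ hκ h2)
  intro n
  refine key n G (MonoidHom.id G) χ Function.injective_id ?_ hirr ?_ ?_
  · have : (MonoidHom.id G).range = ⊤ := MonoidHom.range_eq_top.2 Function.surjective_id
    rw [this]
    exact IsSubnormalSubgroup.top
  · have : χ ∘ MonoidHom.id G = χ := rfl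
    rw [this, hirr.cinner_self]
    exact one_ne_zero
  · rwa [cdeg_eq_of hd]

theorem cdeg_galois (s : ℂ →+* ℂ) (hχ : IsCharacter G χ) : cdeg (s ∘ χ) = cdeg χ :=
  cdeg_eq_of (by rw [Function.comp_apply, hχ.apply_one, map_natCast])

theorem SpecN.galois [Finite G] {n : ℕ} (h : SpecN σ n G χ) (s : ℂ ≃+* ℂ) :
    SpecN σ n G (s ∘ χ) := by
  have hp : ∀ (A : Type) [Group A] [Finite A] (χ : A → ℂ), PreSpec σ A χ →
      PreSpec σ A (s ∘ χ) := by
    rintro A _ _ χ ⟨h1, h2, k, hk, hk', h3⟩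
    refine ⟨h1.galois (s : ℂ →+* ℂ), ?_, k, hk, hk', fun g => ?_⟩
    · have := cdeg_galois (s : ℂ →+* ℂ) h1.1
      exact this ▸ h2
    · have := cdet_galois h1.1 (s : ℂ →+* ℂ) g
      change cdet ((s : ℂ →+* ℂ) ∘ χ) g ^ k = 1
      rw [this, ← map_pow, h3, map_one]
  induction n generalizing G with
  | zero => exact hp G χ h
  | succ n ih =>
    refine ⟨hp G χ h.preSpec, fun A _ i θ hθ h1 => ?_⟩
    have := i.finite_of_emb
    have h2 : s ∘ (s.symm ∘ θ) = θ := by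
      funext a
      simp
    rw [← h2] at h1 ⊢
    refine ih (h.2 A i _ (hθ.galois (s.symm : ℂ →+* ℂ)) fun h0 => h1 ?_)
    have := cinner_galois (s : ℂ →+* ℂ) (χ ∘ i.hom) (s.symm ∘ θ)
    change cinner ((s : ℂ →+* ℂ) ∘ (χ ∘ i.hom)) ((s : ℂ →+* ℂ) ∘ (s.symm ∘ θ)) = 0
    rw [this, h0, map_zero]

theorem Spec.galois [Finite G] (h : Spec σ G χ) (s : ℂ ≃+* ℂ) : Spec σ G (s ∘ χ) :=
  fun n => (h n).galois s

theorem Spec.conj [Finite G] {A : Type} [Group A] [Finite A] (i : NEmb A G) {θ : A → ℂ}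
    (h : Spec σ A θ) (b : G) : Spec σ A (θ ∘ i.cj b) := h.comp_equiv _

end

section Series

variable {G : Type} [Group G] [Finite G] {σ : Set ℕ}

theorem isPiNumber_card_of_pow {Q : Type} [Group Q] [Finite Q] {m : ℕ} (hm : IsPiNumber σ m)
    (h : ∀ x : Q, x ^ m = 1) : IsPiNumber σ (Nat.card Q) := by
  intro q hq hd
  have := Fact.mk hq
  obtain ⟨x, hx⟩ := exists_prime_orderOf_dvd_card' q hd
  exact hm q hq (hx ▸ orderOf_dvd_of_pow_eq_one (h x))

/-- A series of normal subgroups whose factors are `σ`-groups or `σ'`-groups. -/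
def NormalSeries (σ : Set ℕ) (G : Type) [Group G] (n : ℕ) (d : ℕ → Subgroup G) : Prop :=
  d 0 = ⊥ ∧ d n = ⊤ ∧ ∀ i, (d i).Normal ∧ d i ≤ d (i + 1) ∧
    (IsPiNumber σ ((d i).relIndex (d (i + 1))) ∨ IsPiNumber σᶜ ((d i).relIndex (d (i + 1))))

theorem isPiNumber_relIndex_normalCore {H K : Subgroup G} (h : (H.subgroupOf K).Normal)
    (hd : IsPiNumber σ (H.relIndex K)) :
    IsPiNumber σ (H.normalCore.relIndex K.normalCore) := by
  have h1 : ∀ x ∈ K, x ^ H.relIndex K ∈ H := by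
    intro x hx
    have := Subgroup.pow_index_mem (H.subgroupOf K) ⟨x, hx⟩
    exact this
  have h2 : IsPiNumber σ (Nat.card (K.normalCore ⧸ H.normalCore.subgroupOf K.normalCore)) := by
    refine isPiNumber_card_of_pow hd fun x => ?_
    obtain ⟨x, rfl⟩ := QuotientGroup.mk_surjective x
    rw [← QuotientGroup.mk_pow, QuotientGroup.eq_one_iff, Subgroup.mem_subgroupOf]
    intro g
    have h3 := h1 _ (x.2 g)
    rwa [conj_pow] at h3
  exact h2

theorem IsPiSeparable.exists_series (h : IsPiSeparable σ G) :
    ∃ n d, NormalSeries σ G n d := by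
  obtain ⟨n, c, h0, h1, h2⟩ := h
  have hc : ∀ i (hi : i < n), c (Fin.ofNat (n + 1) i) = c (Fin.castSucc ⟨i, hi⟩) ∧
      c (Fin.ofNat (n + 1) (i + 1)) = c (Fin.succ ⟨i, hi⟩) := by
    intro i hi
    constructor
    · congr 1
      ext
      simp [Fin.ofNat, Nat.mod_eq_of_lt (show i < n + 1 by omega)]
    · congr 1
      ext
      simp [Fin.ofNat, Nat.mod_eq_of_lt (show i + 1 < n + 1 by omega)]
  have hn : c (Fin.ofNat (n + 1) n) = ⊤ := by
    rw [← h1]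
    congr 1
    ext
    simp [Fin.ofNat]
  refine ⟨n, fun i => if i ≤ n then (c (Fin.ofNat (n + 1) i)).normalCore else ⊤, ?_, ?_, ?_⟩
  · have : c (Fin.ofNat (n + 1) 0) = ⊥ := h0
    simp only [zero_le, if_true, this]
    exact le_bot_iff.1 (Subgroup.normalCore_le _)
  · simp only [le_refl, if_true, hn]
    exact Subgroup.normalCore_eq_self _
  · intro i
    refine ⟨by dsimp only; split_ifs <;> infer_instance, ?_⟩
    by_cases hi : i < n
    · obtain ⟨h3, h4, h5⟩ := h2 ⟨i, hi⟩
      rw [← (hc i hi).1, ← (hc i hi).2] at h3 h4 h5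
      simp only [if_pos hi.le, if_pos (Nat.succ_le_of_lt hi)]
      refine ⟨Subgroup.normalCore_mono h3, ?_⟩
      exact h5.imp (isPiNumber_relIndex_normalCore h4) (isPiNumber_relIndex_normalCore h4)
    · have h3 : ¬ i + 1 ≤ n := by omega
      simp only [if_neg h3, le_top, true_and]
      have h4 : (if i ≤ n then (c (Fin.ofNat (n + 1) i)).normalCore else ⊤) = ⊤ := by
        split_ifs with h4
        · obtain rfl : i = n := by omega
          rw [hn, Subgroup.normalCore_eq_self]
        · rfl
      rw [h4]
      left
      rw [Subgroup.relIndex_top_left]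
      exact isPiNumber_one σ

theorem IsPiSeparable.climb (h : IsPiSeparable σ G) {P : Subgroup G → Prop} (h0 : P ⊥)
    (h1 : ∀ K L : Subgroup G, K.Normal → L.Normal → K ≤ L → IsPiNumber σ (K.relIndex L) → P K → P L)
    (h2 : ∀ K L : Subgroup G, K.Normal → L.Normal → K ≤ L → IsPiNumber σᶜ (K.relIndex L) →
      P K → P L) : P ⊤ := by
  obtain ⟨n, d, h3, h4, h5⟩ := h.exists_series
  have : ∀ i, P (d i) := by
    intro i
    induction i with
    | zero => rwa [h3]
    | succ i ih =>
      rcases (h5 i).2.2 with h6 | h6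
      · exact h1 _ _ (h5 i).1 (h5 (i + 1)).1 (h5 i).2.1 h6 ih
      · exact h2 _ _ (h5 i).1 (h5 (i + 1)).1 (h5 i).2.1 h6 ih
  exact h4 ▸ this n

theorem NormalSeries.comap {n : ℕ} {d : ℕ → Subgroup G} (h : NormalSeries σ G n d)
    {H : Type} [Group H] [Finite H] (f : H →* G) (hf : Function.Injective f) :
    NormalSeries σ H n fun i => (d i).comap f := by
  obtain ⟨h0, h1, h2⟩ := h
  refine ⟨?_, ?_, fun i => ?_⟩
  · simp only [h0]
    rw [MonoidHom.comap_bot]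
    exact (MonoidHom.ker_eq_bot_iff f).2 hf
  · simp only [h1, Subgroup.comap_top]
  · have := (h2 i).1
    refine ⟨inferInstance, Subgroup.comap_mono (h2 i).2.1, ?_⟩
    have h3 : ((d i).comap f).relIndex ((d (i + 1)).comap f) ∣ (d i).relIndex (d (i + 1)) := by
      rw [Subgroup.relIndex_comap]
      have h4 := Subgroup.relIndex_dvd_index_of_normal ((d i).subgroupOf (d (i + 1)))
        ((((d (i + 1)).comap f).map f).subgroupOf (d (i + 1)))
      rwa [Subgroup.relIndex_subgroupOf (Subgroup.map_comap_le _ _)] at h4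
    exact (h2 i).2.2.imp (isPiNumber_of_dvd · h3) (isPiNumber_of_dvd · h3)

theorem NormalSeries.isPiSeparable {n : ℕ} {d : ℕ → Subgroup G} (h : NormalSeries σ G n d) :
    IsPiSeparable σ G := by
  obtain ⟨h0, h1, h2⟩ := h
  refine ⟨n, fun i => d i, h0, by simpa using h1, fun i => ⟨(h2 i).2.1, ?_, (h2 i).2.2⟩⟩
  have : (d i).Normal := (h2 i).1
  exact this.subgroupOf _

theorem IsPiSeparable.comap (h : IsPiSeparable σ G) {H : Type} [Group H] [Finite H] (f : H →* G)
    (hf : Function.Injective f) : IsPiSeparable σ H := by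
  obtain ⟨n, d, hd⟩ := h.exists_series
  exact (hd.comap f hf).isPiSeparable

theorem IsPiSeparable.compl (h : IsPiSeparable σ G) : IsPiSeparable σᶜ G := by
  obtain ⟨n, d, h0, h1, h2⟩ := h.exists_series
  refine NormalSeries.isPiSeparable (n := n) (d := d) ⟨h0, h1, fun i => ?_⟩
  rw [compl_compl]
  exact ⟨(h2 i).1, (h2 i).2.1, (h2 i).2.2.symm⟩

end Series

/-- `H` is a Hall `σ`-subgroup. -/
def IsHall (σ : Set ℕ) {G : Type} [Group G] (H : Subgroup G) : Prop :=
  IsPiNumber σ (Nat.card H) ∧ IsPiNumber σᶜ H.index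

section

variable {σ : Set ℕ}

theorem card_comap_mk {G : Type} [Group G] [Finite G] (N : Subgroup G) [N.Normal]
    (H : Subgroup (G ⧸ N)) :
    Nat.card (H.comap (QuotientGroup.mk' N)) = Nat.card N * Nat.card H := by
  set f := QuotientGroup.mk' N
  have h0 : N ≤ H.comap f := by
    intro x hx
    have : f x = 1 := (QuotientGroup.eq_one_iff x).2 hx
    rw [Subgroup.mem_comap, this]
    exact H.one_mem
  have h1 : N.relIndex (H.comap f) = Nat.card H := by
    have h2 := Subgroup.relIndex_comap (⊥ : Subgroup (G ⧸ N)) f (H.comap f)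
    rw [Subgroup.map_comap_eq_self_of_surjective (QuotientGroup.mk'_surjective N),
      Subgroup.relIndex_bot_left, MonoidHom.comap_bot, QuotientGroup.ker_mk'] at h2
    exact h2
  rw [← h1, ← Nat.card_congr (Subgroup.subgroupOfEquivOfLe h0).toEquiv]
  exact (Subgroup.card_mul_index _).symm

theorem NormalSeries.exists_hall {n : ℕ} {G : Type} [Group G] [Finite G] {d : ℕ → Subgroup G}
    (h : NormalSeries σ G n d) : ∃ H : Subgroup G, IsHall σ H := by
  induction n generalizing G with
  | zero =>
    have h1 : (⊥ : Subgroup G) = ⊤ := h.1.symm.trans h.2.1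
    refine ⟨⊥, ?_, ?_⟩
    · rw [Subgroup.card_bot]
      exact isPiNumber_one σ
    · rw [h1, Subgroup.index_top]
      exact isPiNumber_one _
  | succ n ih =>
    obtain ⟨h0, h1, h2⟩ := h
    set N := d 1 with hN
    have := (h2 1).1
    rw [← hN] at this
    have hle : ∀ i, N ≤ d (i + 1) := by
      intro i
      induction i with
      | zero => exact le_rfl
      | succ i ih => exact ih.trans (h2 (i + 1)).2.1
    set f := QuotientGroup.mk' N with hf
    have hfs : Function.Surjective f := QuotientGroup.mk'_surjective N
    have hs : NormalSeries σ (G ⧸ N) n fun i => (d (i + 1)).map f := by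
      refine ⟨?_, ?_, fun i => ?_⟩
      · rw [Subgroup.map_eq_bot_iff, hf, QuotientGroup.ker_mk']
      · simp only [h1]
        exact Subgroup.map_top_of_surjective f hfs
      · refine ⟨(h2 (i + 1)).1.map f hfs, Subgroup.map_mono (h2 (i + 1)).2.1, ?_⟩
        have h3 : ((d (i + 1)).map f).relIndex ((d (i + 1 + 1)).map f) =
            (d (i + 1)).relIndex (d (i + 1 + 1)) := by
          rw [← Subgroup.relIndex_comap, Subgroup.comap_map_eq_self]
          rw [hf, QuotientGroup.ker_mk']
          exact hle i
        rw [h3]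
        exact (h2 (i + 1)).2.2
    obtain ⟨H, hH, hH'⟩ := ih hs
    have hc : Nat.card (H.comap f) = Nat.card N * Nat.card H := card_comap_mk N H
    have hi : (H.comap f).index = H.index := Subgroup.index_comap_of_surjective H hfs
    have h3 := (h2 0).2.2
    rw [h0, Subgroup.relIndex_bot_left] at h3
    rcases h3 with h3 | h3
    · exact ⟨H.comap f, hc ▸ isPiNumber_mul h3 hH, hi ▸ hH'⟩
    · have hNle : N ≤ H.comap f := by
        intro x hx
        have : f x = 1 := (QuotientGroup.eq_one_iff x).2 hx
        rw [Subgroup.mem_comap, this]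
        exact H.one_mem
      set L := H.comap f with hL
      have hcN : Nat.card (N.subgroupOf L) = Nat.card N :=
        Nat.card_congr (Subgroup.subgroupOfEquivOfLe hNle).toEquiv
      have hiN : (N.subgroupOf L).index = Nat.card H := by
        have := Subgroup.card_mul_index (N.subgroupOf L)
        rw [hcN, hc] at this
        exact Nat.eq_of_mul_eq_mul_left Nat.card_pos this
      obtain ⟨K, hK⟩ := Subgroup.exists_right_complement'_of_coprime (N := N.subgroupOf L)
        (by rw [hcN, hiN]; exact (isPiNumber_coprime hH h3).symm)
      have hcK : Nat.card K = Nat.card H := by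
        have := hK.card_mul_card
        rw [hcN, hc] at this
        exact Nat.eq_of_mul_eq_mul_left Nat.card_pos this
      have hcK' : Nat.card (K.map L.subtype) = Nat.card H := by
        rw [← hcK]
        exact (Nat.card_congr (K.equivMapOfInjective _ L.subtype_injective).toEquiv).symm
      refine ⟨K.map L.subtype, hcK' ▸ hH, ?_⟩
      have h4 : (K.map L.subtype).index = Nat.card N * H.index := by
        have h5 := Subgroup.card_mul_index (K.map L.subtype)
        rw [← Subgroup.card_mul_index L, hcK', hi, hc, mul_comm (Nat.card N), mul_assoc] at h5
        exact Nat.eq_of_mul_eq_mul_left Nat.card_pos h5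
      rw [h4]
      exact isPiNumber_mul h3 hH'

theorem IsPiSeparable.exists_hall {G : Type} [Group G] [Finite G] (h : IsPiSeparable σ G) :
    ∃ H : Subgroup G, IsHall σ H := by
  obtain ⟨n, d, hd⟩ := h.exists_series
  exact hd.exists_hall

namespace NEmb

variable {A B : Type} [Group A] [Group B] (i : NEmb A B) [Finite A] [Finite B] {H : Subgroup B}

theorem index_comap_dvd (H : Subgroup B) : (H.comap i.hom).index ∣ H.index := by
  have := i.normal
  rw [Subgroup.index_comap]
  generalize i.hom.range = N at this
  have h1 := Subgroup.relIndex_mul_relIndex (H ⊓ N) N (H ⊔ N) inf_le_right le_sup_right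
  rw [← Subgroup.relIndex_mul_relIndex (H ⊓ N) H (H ⊔ N) inf_le_left le_sup_left,
    Subgroup.relIndex_sup_right, Subgroup.inf_relIndex_right, Subgroup.inf_relIndex_left,
    mul_comm] at h1
  have h2 : 0 < N.relIndex H := Nat.pos_of_ne_zero Subgroup.index_ne_zero_of_finite
  rw [Nat.eq_of_mul_eq_mul_left h2 h1]
  exact ⟨_, (Subgroup.relIndex_mul_index le_sup_left).symm⟩

theorem isHall_comap (h : IsHall σ H) : IsHall σ (H.comap i.hom) :=
  ⟨isPiNumber_of_dvd h.1 (Subgroup.card_comap_dvd_of_injective _ _ i.inj),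
    isPiNumber_of_dvd h.2 (i.index_comap_dvd H)⟩

theorem exists_mul_of_index (h : IsPiNumber σᶜ H.index) (hi : IsPiNumber σ i.hom.range.index)
    (b : B) : ∃ a, ∃ x ∈ H, b = i.hom a * x := by
  have := i.normal
  have h1 : i.hom.range ⊔ H = ⊤ := by
    rw [← Subgroup.index_eq_one]
    have h2 : (i.hom.range ⊔ H).index ∣ i.hom.range.index := Subgroup.index_dvd_of_le le_sup_left
    have h3 : (i.hom.range ⊔ H).index ∣ H.index := Subgroup.index_dvd_of_le le_sup_right
    have h4 := Nat.dvd_gcd h2 h3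
    rw [isPiNumber_coprime hi h] at h4
    exact Nat.dvd_one.1 h4
  have hb : b ∈ ((i.hom.range ⊔ H : Subgroup B) : Set B) := by
    rw [h1]
    trivial
  rw [Subgroup.normal_mul] at hb
  obtain ⟨_, ⟨a, rfl⟩, x, hx, rfl⟩ := hb
  exact ⟨a, x, hx, rfl⟩

end NEmb

end

namespace NEmb

variable {A B : Type} [Group A] [Group B] (i : NEmb A B)

/-- The restriction of a normal embedding to a subgroup. -/
def comapEmb (H : Subgroup B) : NEmb (H.comap i.hom) H where
  hom := i.hom.subgroupComap H
  inj := fun _ _ h => Subtype.ext (i.inj (congrArg Subtype.val h))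
  normal := by
    refine ⟨?_⟩
    rintro _ ⟨⟨a, ha⟩, rfl⟩ ⟨x, hx⟩
    refine ⟨⟨i.cj x a, ?_⟩, Subtype.ext (i.hom_cj x a)⟩
    rw [Subgroup.mem_comap, i.hom_cj]
    exact H.mul_mem (H.mul_mem hx ha) (H.inv_mem hx)

theorem coe_comapEmb_cj (H : Subgroup B) (x : H) (d : H.comap i.hom) :
    (((i.comapEmb H).cj x d : H.comap i.hom) : A) = i.cj x d := by
  apply i.inj
  rw [i.hom_cj]
  exact congrArg Subtype.val ((i.comapEmb H).hom_cj x d)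

variable [Finite A] [Finite B]

theorem indHom_of_notMem (θ : A → ℂ) {g : B} (hg : g ∉ i.hom.range) : indHom i.hom θ g = 0 := by
  cases nonempty_fintype A
  cases nonempty_fintype B
  rw [indHom_eq, Finset.sum_eq_zero, mul_zero]
  refine fun x _ => Finset.sum_eq_zero fun a _ => if_neg fun h => hg ?_
  have := i.normal.conj_mem _ ⟨a, h⟩ x⁻¹
  simpa [mul_assoc] using this

theorem card_mul_sum {H : Subgroup B} (hgen : ∀ b, ∃ a, ∃ x ∈ H, b = i.hom a * x) [Fintype A]
    [Fintype B] {F : B → ℂ} (hF : ∀ a b, F (i.hom a * b) = F b) :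
    (Nat.card (H.comap i.hom) : ℂ) * ∑ b, F b = Nat.card A * ∑ x : H, F x := by
  have hfib : ∀ b, (Finset.univ.filter fun p : A × H => i.hom p.1 * p.2 = b).card =
      Nat.card (H.comap i.hom) := by
    intro b
    obtain ⟨a, x, hx, rfl⟩ := hgen b
    rw [Nat.card_eq_fintype_card, ← Finset.card_univ]
    symm
    refine Finset.card_bij
      (fun d _ => (a * d, ⟨(i.hom d)⁻¹ * x, H.mul_mem (H.inv_mem d.2) hx⟩)) ?_ ?_ ?_
    · intro d _
      simp
    · intro d _ d' _ h
      simpa using congrArg Prod.fst h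
    · rintro ⟨a', x', hx'⟩ h
      simp only [Finset.mem_filter, Finset.mem_univ, true_and] at h
      have h' : i.hom (a⁻¹ * a') = x * x'⁻¹ := by
        rw [map_mul, map_inv, eq_mul_inv_iff_mul_eq, mul_assoc, h, inv_mul_cancel_left]
      refine ⟨⟨a⁻¹ * a', ?_⟩, Finset.mem_univ _, ?_⟩
      · rw [Subgroup.mem_comap, h']
        exact H.mul_mem hx (H.inv_mem hx')
      · simp [h']
  have h1 : ∑ p : A × H, F (i.hom p.1 * p.2) = Nat.card A * ∑ x : H, F x := by
    rw [Fintype.sum_prod_type]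
    simp only [hF]
    rw [Finset.sum_const, Finset.card_univ, nsmul_eq_mul, Nat.card_eq_fintype_card]
  rw [← h1, ← Finset.sum_fiberwise Finset.univ (fun p : A × H => i.hom p.1 * p.2), Finset.mul_sum]
  refine Finset.sum_congr rfl fun b _ => ?_
  rw [← hfib b, ← nsmul_eq_mul, ← Finset.sum_const]
  refine Finset.sum_congr rfl fun p hp => ?_
  rw [(Finset.mem_filter.1 hp).2]

theorem indHom_comp_subtype {H : Subgroup B} (hgen : ∀ b, ∃ a, ∃ x ∈ H, b = i.hom a * x)
    {θ : A → ℂ} (hθ : IsCharacter A θ) :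
    indHom i.hom θ ∘ H.subtype =
      indHom (i.comapEmb H).hom (θ ∘ (H.comap i.hom).subtype) := by
  cases nonempty_fintype A
  cases nonempty_fintype B
  funext x
  by_cases hx : (x : B) ∈ i.hom.range
  · obtain ⟨a, ha⟩ := hx
    have hd : a ∈ H.comap i.hom := by
      rw [Subgroup.mem_comap, ha]
      exact x.2
    have h1 : (i.comapEmb H).hom ⟨a, hd⟩ = x := Subtype.ext ha
    have h2 : (indHom i.hom θ ∘ H.subtype) x = indHom i.hom θ (i.hom a) := congrArg _ ha.symm
    rw [h2, ← h1, indHom_comp, indHom_comp, finsum_eq_sum_of_fintype, finsum_eq_sum_of_fintype]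
    have h3 := i.card_mul_sum hgen (F := fun b => θ (i.cj b a)) fun c b => by
      rw [i.cj_mul, i.cj_hom, hθ.conj]
    have h4 : ∀ y : H, (θ ∘ (H.comap i.hom).subtype) ((i.comapEmb H).cj y ⟨a, hd⟩) =
        θ (i.cj y a) := fun y => congrArg θ (i.coe_comapEmb_cj H y ⟨a, hd⟩)
    simp only [h4]
    have h5 : (Nat.card A : ℂ) ≠ 0 := NeZero.ne _
    have h6 : (Nat.card (H.comap i.hom) : ℂ) ≠ 0 := NeZero.ne _
    field_simp
    linear_combination h3
  · have h1 : x ∉ (i.comapEmb H).hom.range := by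
      rintro ⟨d, rfl⟩
      exact hx ⟨d, rfl⟩
    rw [indHom_of_notMem _ _ h1]
    exact i.indHom_of_notMem θ hx

section Restriction

variable {H : Subgroup B} {θ : A → ℂ}

theorem cinner_indHom_res (hgen : ∀ b, ∃ a, ∃ x ∈ H, b = i.hom a * x)
    (hθ : IsIrrChar A θ) (hθ0 : IsIrrChar _ (θ ∘ (H.comap i.hom).subtype))
    (hstab : ∀ x : H, (θ ∘ (H.comap i.hom).subtype) ∘ (i.comapEmb H).cj x =
      θ ∘ (H.comap i.hom).subtype → θ ∘ i.cj x = θ)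
    {χ : B → ℂ} (hχ : IsIrrChar B χ) (h1 : cinner (χ ∘ i.hom) θ ≠ 0) :
    cinner (indHom i.hom θ ∘ H.subtype) (χ ∘ H.subtype) = cinner (indHom i.hom θ) χ := by
  rw [i.indHom_comp_subtype hgen hθ.1, frobenius_reciprocity _ _ hχ.1.conj,
    frobenius_reciprocity _ _ (hχ.1.comp H.subtype).conj]
  change cinner (θ ∘ (H.comap i.hom).subtype) ((χ ∘ i.hom) ∘ (H.comap i.hom).subtype) = _
  refine (hχ.1.comp i.hom).forall_constituents
    (Q := fun κ => ∃ x : H, κ = θ ∘ i.cj x)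
    (P := fun ω => cinner (θ ∘ (H.comap i.hom).subtype) (ω ∘ (H.comap i.hom).subtype) =
      cinner θ ω) ?_ ?_ ?_
  · have : (0 : A → ℂ) ∘ (H.comap i.hom).subtype = 0 := rfl
    rw [this, cinner_zero_right, cinner_zero_right]
  · rintro κ ξ hκ ⟨x, rfl⟩ hξ ih
    have : (θ ∘ i.cj x + ξ) ∘ (H.comap i.hom).subtype =
      (θ ∘ i.cj x) ∘ (H.comap i.hom).subtype + ξ ∘ (H.comap i.hom).subtype := rfl
    rw [this, cinner_add_right, cinner_add_right, ih]
    congr 1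
    by_cases h : θ ∘ i.cj x = θ
    · rw [h, hθ.cinner_self, hθ0.cinner_self]
    · have h2 : (θ ∘ i.cj x) ∘ (H.comap i.hom).subtype =
          (θ ∘ (H.comap i.hom).subtype) ∘ (i.comapEmb H).cj x := by
        funext d
        exact congrArg θ (i.coe_comapEmb_cj H x d).symm
      rw [hθ.cinner_of_ne hκ (Ne.symm h), h2,
        hθ0.cinner_of_ne (hθ0.comp_equiv _) fun h3 => h (hstab x h3.symm)]
  · intro κ hκ hne
    obtain ⟨b, rfl⟩ := i.exists_conj hχ hθ hκ h1 hne
    obtain ⟨a, x, hx, rfl⟩ := hgen b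
    refine ⟨⟨x, hx⟩, ?_⟩
    funext c
    simp only [Function.comp_apply]
    rw [i.cj_mul, i.cj_hom, hθ.1.conj]

theorem _root_.IsIrrChar.exists_cinner_comp_eq {A B : Type} [Group A] [Group B] [Finite A]
    [Finite B] (f : A →* B) {χ : B → ℂ} (hχ : IsIrrChar B χ) {ω : B → ℂ} (hω : IsCharacter B ω) :
    ∃ m : ℕ, cinner (ω ∘ f) (χ ∘ f) = cinner ω χ + m := by
  refine IsCharacter.induction (P := fun ω => ∃ m : ℕ, cinner (ω ∘ f) (χ ∘ f) = cinner ω χ + m)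
    ⟨0, ?_⟩ ?_ hω
  · have : (0 : B → ℂ) ∘ f = 0 := rfl
    rw [this, cinner_zero_left, cinner_zero_left]
    simp
  · rintro θ ξ hθ hξ ⟨m, hm⟩
    have : (θ + ξ) ∘ f = θ ∘ f + ξ ∘ f := rfl
    rw [this, cinner_add_left, cinner_add_left, hm]
    by_cases h : θ = χ
    · subst h
      obtain ⟨n, hn, hn'⟩ := (hθ.1.comp f).cinner_self_pos fun h0 => hθ.degree_ne_zero (by
        simpa using congrFun h0 1)
      refine ⟨m + (n - 1), ?_⟩
      rw [hn', hθ.cinner_self]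
      push_cast [Nat.cast_sub hn]
      ring
    · obtain ⟨n, hn⟩ := cinner_nat (hθ.1.comp f) (hχ.1.comp f)
      refine ⟨m + n, ?_⟩
      rw [hn, hθ.cinner_of_ne hχ h]
      push_cast
      ring

theorem _root_.IsIrrChar.res_of_cinner_eq {A B : Type} [Group A] [Group B] [Finite A]
    [Finite B] (f : A →* B) {χ : B → ℂ} (hχ : IsIrrChar B χ) {ω : B → ℂ} (hω : IsCharacter B ω)
    (hne : cinner ω χ ≠ 0) (h : cinner (ω ∘ f) (χ ∘ f) = cinner ω χ) :
    IsIrrChar A (χ ∘ f) ∧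
      ∀ χ', IsIrrChar B χ' → cinner ω χ' ≠ 0 → χ ∘ f = χ' ∘ f → χ = χ' := by
  obtain ⟨ξ, hξ, rfl⟩ := hω.eq_add_of_cinner_ne_zero hχ hne
  have h0 : (χ + ξ) ∘ f = χ ∘ f + ξ ∘ f := rfl
  obtain ⟨m, hm⟩ := hχ.exists_cinner_comp_eq f hξ
  obtain ⟨n, hn, hn'⟩ := (hχ.1.comp f).cinner_self_pos fun h0 => hχ.degree_ne_zero (by
    simpa using congrFun h0 1)
  rw [h0, cinner_add_left, cinner_add_left, hm, hn', hχ.cinner_self] at h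
  have h1 : ((n + m : ℕ) : ℂ) = (1 : ℕ) := by
    push_cast
    linear_combination h
  have h2 : n + m = 1 := by exact_mod_cast h1
  obtain rfl : n = 1 := by omega
  obtain rfl : m = 0 := by omega
  refine ⟨isIrrChar_iff.2 ⟨hχ.1.comp f, by rw [hn', Nat.cast_one]⟩, fun χ' hχ' h3 h4 => ?_⟩
  by_contra h5
  rw [cinner_add_left, hχ.cinner_of_ne hχ' h5, zero_add] at h3
  obtain ⟨ζ, hζ, rfl⟩ := hξ.eq_add_of_cinner_ne_zero hχ' h3
  have h6 : (χ' + ζ) ∘ f = χ' ∘ f + ζ ∘ f := rfl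
  obtain ⟨m, hm'⟩ := hχ.exists_cinner_comp_eq f hζ
  rw [h6, cinner_add_left, cinner_add_left, hm', ← h4, hn', hχ'.cinner_of_ne hχ (Ne.symm h5)] at hm
  have h7 : ((1 + m : ℕ) : ℂ) = (0 : ℕ) := by
    push_cast at hm ⊢
    linear_combination hm
  have : 1 + m = 0 := by exact_mod_cast h7
  omega

theorem irr_res (hgen : ∀ b, ∃ a, ∃ x ∈ H, b = i.hom a * x)
    (hθ : IsIrrChar A θ) (hθ0 : IsIrrChar _ (θ ∘ (H.comap i.hom).subtype))
    (hstab : ∀ x : H, (θ ∘ (H.comap i.hom).subtype) ∘ (i.comapEmb H).cj x =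
      θ ∘ (H.comap i.hom).subtype → θ ∘ i.cj x = θ)
    {χ : B → ℂ} (hχ : IsIrrChar B χ) (h1 : cinner (χ ∘ i.hom) θ ≠ 0) :
    IsIrrChar H (χ ∘ H.subtype) ∧
      ∀ χ', IsIrrChar B χ' → cinner (χ' ∘ i.hom) θ ≠ 0 →
        χ ∘ H.subtype = χ' ∘ H.subtype → χ = χ' := by
  have h2 := hχ.res_of_cinner_eq H.subtype (hθ.1.indHom i.hom)
    (by rwa [frobenius_reciprocity _ _ hχ.1.conj, cinner_comm])
    (i.cinner_indHom_res hgen hθ hθ0 hstab hχ h1)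
  refine ⟨h2.1, fun χ' hχ' h3 h4 => h2.2 χ' hχ' ?_ h4⟩
  rwa [frobenius_reciprocity _ _ hχ'.1.conj, cinner_comm]

end Restriction

end NEmb

/-- The identity embedding. -/
def NEmb.refl (G : Type) [Group G] : NEmb G G where
  hom := MonoidHom.id G
  inj := Function.injective_id
  normal := by
    rw [MonoidHom.range_eq_top.2 Function.surjective_id]
    infer_instance

theorem NEmb.range_ofLe {B : Type} [Group B] {H K : Subgroup B} (hle : H ≤ K)
    (h : (H.subgroupOf K).Normal) : (NEmb.ofLe hle h).hom.range = H.subgroupOf K :=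
  Subgroup.inclusion_range hle

theorem NEmb.range_ofNormal {B : Type} [Group B] {N : Subgroup B} (h : N.Normal) :
    (NEmb.ofNormal N h).hom.range = N :=
  N.range_subtype

theorem IsPiSeparable.induct {G : Type} [Group G] [Finite G] {σ : Set ℕ} (h : IsPiSeparable σ G)
    {P : ∀ (A : Type) [Group A], NEmb A G → Prop}
    (h0 : ∀ (A : Type) [Group A] [Subsingleton A] (k : NEmb A G), P A k)
    (h1 : ∀ (A B : Type) [Group A] [Group B] [Finite A] [Finite B] (k : NEmb A G) (i : NEmb A B)
      (j : NEmb B G), k.hom = j.hom.comp i.hom → IsPiNumber σ i.hom.range.index → P A k → P B j)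
    (h2 : ∀ (A B : Type) [Group A] [Group B] [Finite A] [Finite B] (k : NEmb A G) (i : NEmb A B)
      (j : NEmb B G), k.hom = j.hom.comp i.hom → IsPiNumber σᶜ i.hom.range.index → P A k → P B j) :
    P G (NEmb.refl G) := by
  have key : ∃ hn : (⊤ : Subgroup G).Normal, P (⊤ : Subgroup G) (NEmb.ofNormal ⊤ hn) := by
    refine h.climb (P := fun K => ∃ hn : K.Normal, P K (NEmb.ofNormal K hn))
      ⟨inferInstance, h0 _ _⟩ ?_ ?_
    · rintro K L hK hL hle hd ⟨_, hP⟩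
      refine ⟨hL, h1 K L _ (NEmb.ofLe hle (hK.subgroupOf L)) _ rfl ?_ hP⟩
      rwa [NEmb.range_ofLe]
    · rintro K L hK hL hle hd ⟨_, hP⟩
      refine ⟨hL, h2 K L _ (NEmb.ofLe hle (hK.subgroupOf L)) _ rfl ?_ hP⟩
      rwa [NEmb.range_ofLe]
  obtain ⟨hn, hP⟩ := key
  refine h1 _ G _ (NEmb.ofNormal ⊤ hn) _ rfl ?_ hP
  rw [NEmb.range_ofNormal, Subgroup.index_top]
  exact isPiNumber_one σ

section

variable {σ : Set ℕ} {A B G : Type} [Group A] [Group B] [Group G] [Finite A] [Finite B] [Finite G]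

theorem IsCharacter.eq_cdet_of_degree {χ : G → ℂ} (h : IsCharacter G χ) (h1 : χ 1 = 1) (g : G) :
    cdet χ g = χ g := by
  obtain ⟨n, R, hR⟩ := h.exists_matrix
  have hn : (n : ℂ) = (1 : ℕ) := by
    rw [hR, map_one, Matrix.trace_one, Fintype.card_fin] at h1
    rw [h1, Nat.cast_one]
  obtain rfl : n = 1 := by exact_mod_cast hn
  rw [cdet_matrix R hR, hR, Matrix.det_fin_one, Matrix.trace_fin_one]

theorem IsCharacter.eq_cdetHom {χ : G → ℂ} (h : IsCharacter G χ) (h1 : χ 1 = 1) :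
    χ = (cdetHom χ : G → ℂ) := funext fun g => (h.eq_cdet_of_degree h1 g).symm

theorem NEmb.eq_of_comp_eq (i : NEmb A B) (hi : IsPiNumber σᶜ i.hom.range.index) {χ χ' : B → ℂ}
    (hχ : IsCharacter B χ) (hχ' : IsCharacter B χ') (hirr : IsIrrChar A (χ ∘ i.hom))
    (h : χ ∘ i.hom = χ' ∘ i.hom) (hd : IsPiNumber σ (cdeg χ)) (hdet : DetPi σ χ)
    (hdet' : DetPi σ χ') : χ = χ' := by
  have h1 : χ 1 = χ' 1 := by simpa using congrFun h 1
  have hirr' : IsIrrChar A (χ' ∘ i.hom) := h ▸ hirr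
  obtain ⟨δ, hδ, hδ', hmul⟩ := i.gallagher hχ' hirr' (hχ.isIrrChar_of_comp i.hom hirr)
    (by rw [h, hirr'.cinner_self]; exact one_ne_zero)
  have h10 : χ' 1 ≠ 0 := by
    have := hirr'.degree_ne_zero
    simpa using this
  have hδ1 : δ 1 = 1 := by
    have := congrFun hmul 1
    rw [Pi.mul_apply, ← h1] at this
    rw [← h1] at h10
    exact (mul_eq_left₀ h10).1 this.symm
  set l := cdetHom δ with hl
  have hδl : δ = (l : B → ℂ) := hδ.1.eq_cdetHom hδ1
  obtain ⟨k, -, hk, hk'⟩ := hdet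
  obtain ⟨m, -, hm, hm'⟩ := hdet'
  suffices hl1 : ∀ b, l b = 1 by
    rw [hmul, hδl]
    funext b
    rw [Pi.mul_apply, hl1, mul_one]
  intro b
  have h2 : l b ^ i.hom.range.index = 1 := by
    obtain ⟨a, ha⟩ := i.pow_index_mem b
    rw [← map_pow, ← ha, ← congrFun hδl]
    have := hδ' 1 a
    rwa [one_mul, hδ1] at this
  have h3 : cdet χ b = cdet χ' b * l b ^ cdeg χ' := by
    rw [← cdet_mul_linear hχ', ← hδl, ← hmul]
  have h4 : cdeg χ' = cdeg χ := cdeg_eq_of (by rw [← h1, hχ.apply_one])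
  have h5 : l b ^ (cdeg χ * (k * m)) = 1 := by
    have h6 := congrArg (· ^ (k * m)) h3
    simp only [mul_pow] at h6
    rw [pow_mul, hk', one_pow, mul_comm k m, pow_mul, hm', one_pow, one_mul, h4] at h6
    rw [mul_comm k m, pow_mul, ← h6]
  have h7 := isPiNumber_coprime (isPiNumber_mul hd (isPiNumber_mul hk hm)) hi
  rw [← orderOf_dvd_iff_pow_eq_one] at h2 h5
  rw [← orderOf_eq_one_iff]
  exact Nat.dvd_one.1 (h7 ▸ Nat.dvd_gcd h5 h2)

/-- Special characters restrict irreducibly and injectively to `H`. -/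
def ResInj (σ : Set ℕ) (B : Type) [Group B] (H : Subgroup B) : Prop :=
  ∀ χ, Spec σ B χ → IsIrrChar H (χ ∘ H.subtype) ∧
    ∀ χ', Spec σ B χ' → χ ∘ H.subtype = χ' ∘ H.subtype → χ = χ'

theorem ResInj.of_subsingleton [Subsingleton B] (H : Subgroup B) : ResInj σ B H := by
  intro χ hχ
  let e : H ≃* B := MulEquiv.ofBijective H.subtype
    ⟨H.subtype_injective, fun b => ⟨1, Subsingleton.elim _ _⟩⟩
  refine ⟨hχ.irr.comp_equiv e, fun χ' _ h => ?_⟩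
  funext b
  rw [Subsingleton.elim b 1]
  exact congrFun h 1

theorem Spec.comp_of_coprime (i : NEmb A B) (hi : IsPiNumber σᶜ i.hom.range.index) {χ : B → ℂ}
    (hχ : Spec σ B χ) : Spec σ A (χ ∘ i.hom) := by
  obtain ⟨θ, hθ, hne⟩ := hχ.irr.exists_comp i.hom
  have hs := hχ.constituent i hθ hne
  rwa [i.comp_eq_of_coprime hθ hs.deg hs.det hi hχ.irr hne hχ.deg]

theorem ResInj.of_index (i : NEmb A B) {H : Subgroup B} (hH : IsHall σ H)
    (hi : IsPiNumber σ i.hom.range.index) (h : ResInj σ A (H.comap i.hom)) : ResInj σ B H := by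
  intro χ hχ
  have hgen := i.exists_mul_of_index hH.2 hi
  obtain ⟨θ, hθ, hne⟩ := hχ.irr.exists_comp i.hom
  have hs := hχ.constituent i hθ hne
  have hcj : ∀ x : H, (θ ∘ i.cj x) ∘ (H.comap i.hom).subtype =
      (θ ∘ (H.comap i.hom).subtype) ∘ (i.comapEmb H).cj x := fun x =>
    funext fun d => congrArg θ (i.coe_comapEmb_cj H x d).symm
  have h1 := i.irr_res hgen hθ (h θ hs).1 (fun x hx =>
    ((h θ hs).2 (θ ∘ i.cj x) (hs.comp_equiv _) ((hcj x).trans hx).symm).symm) hχ.irr hne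
  refine ⟨h1.1, fun χ' hχ' he => h1.2 χ' hχ'.irr ?_ he⟩
  obtain ⟨θ', hθ', hne'⟩ := hχ'.irr.exists_comp i.hom
  have hs' := hχ'.constituent i hθ' hne'
  have h2 : ∀ {χ : B → ℂ} {θ : A → ℂ}, Spec σ B χ → Spec σ A θ → cinner (χ ∘ i.hom) θ ≠ 0 →
      cinner ((χ ∘ H.subtype) ∘ (i.comapEmb H).hom) (θ ∘ (H.comap i.hom).subtype) ≠ 0 := by
    intro χ θ hχ hθ hne
    refine cinner_comp_ne_zero (H.comap i.hom).subtype (hχ.irr.1.comp i.hom) hθ.irr hne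
      (h θ hθ).1.1 ?_
    rw [(h θ hθ).1.cinner_self]
    exact one_ne_zero
  obtain ⟨x, hx⟩ := (i.comapEmb H).exists_conj h1.1 (h θ hs).1 (h θ' hs').1 (h2 hχ hs hne)
    (he ▸ h2 hχ' hs' hne')
  obtain rfl := (h θ' hs').2 (θ ∘ i.cj x) (hs.comp_equiv _) (hx.trans (hcj x).symm)
  rwa [i.cinner_conj hχ'.irr.1] at hne'

theorem ResInj.of_coprime (i : NEmb A B) {H : Subgroup B}
    (hi : IsPiNumber σᶜ i.hom.range.index) (h : ResInj σ A (H.comap i.hom)) :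
    ResInj σ B H := by
  intro χ hχ
  have hs := hχ.comp_of_coprime i hi
  refine ⟨(hχ.irr.1.comp H.subtype).isIrrChar_of_comp (i.comapEmb H).hom (h _ hs).1,
    fun χ' hχ' he => ?_⟩
  have hs' := hχ'.comp_of_coprime i hi
  have h1 := (h _ hs).2 _ hs' (by
    funext d
    exact congrFun he ((i.comapEmb H).hom d))
  exact i.eq_of_comp_eq hi hχ.irr.1 hχ'.irr.1 hs.irr h1 hχ.deg hχ.det hχ'.det

theorem IsPiSeparable.resInj (hG : IsPiSeparable σ G) {H : Subgroup G} (hH : IsHall σ H) :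
    ResInj σ G H := by
  refine hG.induct (P := fun A _ k => ResInj σ A (H.comap k.hom)) ?_ ?_ ?_
  · intro A _ _ k
    exact ResInj.of_subsingleton _
  · intro A B _ _ _ _ k i j hk hi h
    rw [hk] at h
    exact ResInj.of_index i (j.isHall_comap hH) hi h
  · intro A B _ _ _ _ k i j hk hi h
    rw [hk] at h
    exact ResInj.of_coprime i hi h

theorem NEmb.index_comapEmb (i : NEmb A B) (H : Subgroup B) :
    (i.comapEmb H).hom.range.index ∣ i.hom.range.index := by
  have h1 : (i.comapEmb H).hom.range = i.hom.range.comap H.subtype := by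
    ext x
    constructor
    · rintro ⟨d, rfl⟩
      exact ⟨d, rfl⟩
    · rintro ⟨a, ha⟩
      refine ⟨⟨a, ?_⟩, Subtype.ext ha⟩
      rw [Subgroup.mem_comap, ha]
      exact x.2
  have := i.normal
  rw [h1, Subgroup.index_comap]
  exact Subgroup.relIndex_dvd_index_of_normal _ _

/-- Special characters restrict to special characters of `U`. -/
def SpecRes (σ : Set ℕ) (B : Type) [Group B] (U : Subgroup B) : Prop :=
  ∀ χ, Spec σ B χ → Spec σ U (χ ∘ U.subtype)

theorem SpecRes.of_subsingleton [Subsingleton B] (U : Subgroup B) : SpecRes σ B U := fun _ hχ =>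
  hχ.comp_equiv (MulEquiv.ofBijective U.subtype
    ⟨U.subtype_injective, fun _ => ⟨1, Subsingleton.elim _ _⟩⟩)

theorem SpecRes.of_index (i : NEmb A B) {U : Subgroup B} (hi : IsPiNumber σ i.hom.range.index)
    (h : SpecRes σ A (U.comap i.hom)) {H : Subgroup B} (hHU : H ≤ U) (hH : ResInj σ B H) :
    SpecRes σ B U := by
  intro χ hχ
  have hirr : IsIrrChar U (χ ∘ U.subtype) :=
    (hχ.irr.1.comp U.subtype).isIrrChar_of_comp (Subgroup.inclusion hHU) (hH χ hχ).1
  refine Spec.of_index (i.comapEmb U) (isPiNumber_of_dvd hi (i.index_comapEmb U)) hirr ?_ ?_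
  · have := hχ.deg
    simpa [cdeg] using this
  · intro τ hτ h1
    obtain ⟨θ, hθ, h2, h3⟩ :=
      (hχ.irr.1.comp i.hom).exists_over (U.comap i.hom).subtype (θ := τ) h1
    have h4 := h θ (hχ.constituent i hθ h2)
    rwa [← h4.irr.eq_of_cinner_ne_zero hτ h3]

theorem SpecRes.of_coprime (i : NEmb A B) {U : Subgroup B} (hi : IsPiNumber σᶜ i.hom.range.index)
    (h : SpecRes σ A (U.comap i.hom)) : SpecRes σ B U := fun _ hχ =>
  Spec.of_comp (i.comapEmb U) (isPiNumber_of_dvd hi (i.index_comapEmb U))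
    (hχ.irr.1.comp U.subtype) (h _ (hχ.comp_of_coprime i hi)) (hχ.det.comp U.subtype hχ.irr.1)

theorem IsPiSeparable.specRes (hG : IsPiSeparable σ G) {H U : Subgroup G} (hH : IsHall σ H)
    (hHU : H ≤ U) : SpecRes σ G U := by
  refine hG.induct (P := fun A _ k => SpecRes σ A (U.comap k.hom)) ?_ ?_ ?_
  · intro A _ _ k
    exact SpecRes.of_subsingleton _
  · intro A B _ _ _ _ k i j hk hi h
    rw [hk] at h
    exact SpecRes.of_index i hi h (Subgroup.comap_mono hHU)
      ((hG.comap j.hom j.inj).resInj (j.isHall_comap hH))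
  · intro A B _ _ _ _ k i j hk hi h
    rw [hk] at h
    exact SpecRes.of_coprime i hi h

end

theorem Spec.of_subsingleton {σ : Set ℕ} {A : Type} [Group A] [Subsingleton A] {θ : A → ℂ}
    (hθ : IsIrrChar A θ) : Spec σ A θ := by
  have key : ∀ n (B : Type) [Group B] [Subsingleton B] (κ : B → ℂ), IsIrrChar B κ →
      SpecN σ n B κ := by
    intro n
    induction n with
    | zero =>
      intro B _ _ κ hκ
      refine ⟨hκ, ?_, 1, one_pos, isPiNumber_one σ, fun g => ?_⟩
      · have h := (NEmb.refl B).cdeg_dvd hκ fun b a => congrArg κ (Subsingleton.elim _ _)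
        rw [Subgroup.index_eq_one.2 (MonoidHom.range_eq_top.2 Function.surjective_id)] at h
        exact isPiNumber_of_dvd (isPiNumber_one σ) h
      · rw [Subsingleton.elim g 1, cdet_one_apply, one_pow]
    | succ n ih =>
      intro B _ _ κ hκ
      refine ⟨(ih B κ hκ).preSpec, fun A _ i ϑ hϑ _ => ?_⟩
      have : Subsingleton A := i.inj.subsingleton
      exact ih A ϑ hϑ
  exact fun n => key n A θ hθ

section Partial

variable {σ : Set ℕ} {A G : Type} [Group A] [Group G] [Finite A] [Finite G]

theorem isPiElt_one : IsPiElt σ (1 : G) := by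
  rw [IsPiElt, orderOf_one]
  exact isPiNumber_one σ

theorem piRestrict_one_apply (χ : G → ℂ) : piRestrict σ χ 1 = χ 1 := if_pos isPiElt_one

theorem piRestrict_add (χ χ' : G → ℂ) :
    piRestrict σ (χ + χ') = piRestrict σ χ + piRestrict σ χ' := by
  funext g
  by_cases h : IsPiElt σ g <;> simp [piRestrict, h]

theorem piRestrict_eq_iff {χ χ' : G → ℂ} :
    piRestrict σ χ = piRestrict σ χ' ↔ ∀ g, IsPiElt σ g → χ g = χ' g := by
  refine ⟨fun h g hg => ?_, fun h => funext fun g => ?_⟩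
  · simpa [piRestrict, hg] using congrFun h g
  · by_cases hg : IsPiElt σ g
    · simp [piRestrict, hg, h g hg]
    · simp [piRestrict, hg]

/-- A character with irreducible restriction to the `σ`-elements is irreducible. -/
theorem IsIPiChar.isIrrChar {χ : G → ℂ} (h : IsIPiChar σ G (piRestrict σ χ))
    (hχ : IsCharacter G χ) : IsIrrChar G χ := by
  refine ⟨hχ, ?_, ?_⟩
  · rintro rfl
    obtain ⟨ψ, hψ, hne, hψ'⟩ := h.1
    refine hne (hψ.eq_zero_of_degree ?_)
    rw [← piRestrict_one_apply (σ := σ) ψ, ← hψ', piRestrict_one_apply, Pi.zero_apply]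
  · rintro ⟨χ₁, χ₂, h1, h1', h2, h2', rfl⟩
    exact h.2 ⟨_, _, ⟨χ₁, h1, h1', rfl⟩, ⟨χ₂, h2, h2', rfl⟩, piRestrict_add χ₁ χ₂⟩

theorem indHom_congr_of_isPiElt {i : A →* G} (hi : Function.Injective i) {θ θ' : A → ℂ}
    (h : ∀ a, IsPiElt σ a → θ a = θ' a) {g : G} (hg : IsPiElt σ g) :
    indHom i θ g = indHom i θ' g := by
  have := Fintype.ofFinite A
  have := Fintype.ofFinite G
  rw [indHom_eq, indHom_eq]
  congr 1
  refine Finset.sum_congr rfl fun x _ => Finset.sum_congr rfl fun a _ => ?_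
  split_ifs with hx
  · refine h a ?_
    have : orderOf a = orderOf g := by
      rw [← orderOf_injective i hi, hx, ← MulAut.conj_apply, MulEquiv.orderOf_eq]
    rwa [IsPiElt, this]
  · rfl

end Partial

section Twist

variable {σ : Set ℕ} {A B C : Type} [Group A] [Group B] [Group C] [Finite A] [Finite B] [Finite C]

/-- The exponents of the determinant of `γ` which invert a given linear character. -/
theorem exists_det_pow_twist {τ Θ : B → ℂ} (l : B →* ℂ) (hΘ : IsCharacter B Θ)
    (hτ : τ = Θ * (l : B → ℂ)) (hdet : DetPi σ Θ) {b : ℕ} (hb0 : b ≠ 0) (hb : IsPiNumber σᶜ b)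
    (hl : ∀ x, l x ^ b = 1) (f : B →* C) {γ : C → ℂ} (hγ : IsCharacter C γ)
    (hd : IsPiNumber σ (cdeg γ)) {e : ℕ} (he : γ ∘ f = e • τ) :
    ∃ N : ℕ, (∀ x, l x * cdet γ (f x) ^ N = 1) ∧ ∀ c, IsPiElt σ c → cdet γ c ^ N = 1 := by
  have := Fintype.ofFinite C
  obtain ⟨k, hk0, hk, hdet⟩ := hdet
  set S := Finset.univ.filter fun c : C => IsPiElt σ c with hS
  set M := k * ∏ c ∈ S, orderOf c with hM
  have hMpi : IsPiNumber σ M := by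
    refine isPiNumber_mul hk ?_
    refine Finset.prod_induction _ (IsPiNumber σ) (fun _ _ => isPiNumber_mul) (isPiNumber_one σ) ?_
    intro c hc
    exact (Finset.mem_filter.1 hc).2
  obtain ⟨c, -, hc⟩ := Nat.exists_mul_mod_eq_of_coprime (b - 1)
    (isPiNumber_coprime (isPiNumber_mul hMpi hd) hb) hb0
  have hcard : cdeg γ = e * cdeg τ := by
    have h1 := congrFun he 1
    have hτc : IsCharacter B τ := hτ ▸ hΘ.mul (isCharacter_linear l)
    rw [Function.comp_apply, map_one, hγ.apply_one, Pi.smul_apply, hτc.apply_one,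
      nsmul_eq_mul] at h1
    exact_mod_cast h1
  have hτd : cdeg τ = cdeg Θ := by
    refine cdeg_eq_of ?_
    rw [hτ, Pi.mul_apply, map_one, mul_one, hΘ.apply_one]
  refine ⟨M * c, fun x => ?_, fun g hg => ?_⟩
  · have h1 : cdet γ (f x) = (cdet Θ x * l x ^ cdeg Θ) ^ e := by
      rw [← cdet_comp f hγ, he, cdet_nsmul (hτ ▸ hΘ.mul (isCharacter_linear l)), hτ,
        cdet_mul_linear hΘ]
    have h2 : cdet Θ x ^ (e * (M * c)) = 1 := by
      have : e * (M * c) = k * (e * (∏ c ∈ S, orderOf c) * c) := by rw [hM]; ring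
      rw [this, pow_mul, hdet, one_pow]
    have h3 : l x ^ (cdeg Θ * (e * (M * c))) = l x ^ (b - 1) := by
      refine pow_eq_pow_of_modEq ?_ (hl x)
      have : cdeg Θ * (e * (M * c)) = M * cdeg γ * c := by rw [hcard, hτd]; ring
      rw [this]
      exact hc
    rw [h1, ← pow_mul, mul_pow, h2, one_mul, ← pow_mul, h3, ← pow_succ',
      Nat.sub_add_cancel (Nat.one_le_iff_ne_zero.2 hb0), hl]
  · obtain ⟨q, hq⟩ : orderOf g ∣ M * c :=
      ((Finset.dvd_prod_of_mem _ (Finset.mem_filter.2 ⟨Finset.mem_univ g, hg⟩)).mul_left k).mul_right c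
    have h1 : cdet γ g ^ orderOf g = 1 := by
      have := map_pow (cdetHom γ) g (orderOf g)
      rw [pow_orderOf_eq_one, map_one] at this
      exact this.symm
    rw [hq, pow_mul, h1, one_pow]

end Twist

section

variable {σ : Set ℕ} {A B G : Type} [Group A] [Group B] [Group G] [Finite A] [Finite B] [Finite G]

/-- The induction hypothesis for lifting partial characters to special characters. -/
def HasSpecialLift (σ : Set ℕ) {G : Type} [Group G] (γ : G → ℂ) (A : Type) [Group A]
    (k : NEmb A G) : Prop :=
  ∃ γ' θ, IsIrrChar G γ' ∧ (∀ g, IsPiElt σ g → γ g = γ' g) ∧ Spec σ A θ ∧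
    cinner (γ' ∘ k.hom) θ ≠ 0

theorem IsIrrChar.exists_spec_of_index {γ : G → ℂ} (hγ : IsIrrChar G γ)
    (hd : IsPiNumber σ (cdeg γ)) {k : NEmb A G} {i : NEmb A B} {j : NEmb B G}
    (hk : k.hom = j.hom.comp i.hom) (hi : IsPiNumber σ i.hom.range.index) {θ : A → ℂ}
    (hθ : Spec σ A θ) (h1 : cinner (γ ∘ k.hom) θ ≠ 0) :
    ∃ τ, Spec σ B τ ∧ cinner (γ ∘ j.hom) τ ≠ 0 := by
  rw [hk] at h1
  obtain ⟨τ, hτ, h2, h3⟩ := (hγ.1.comp j.hom).exists_over i.hom (θ := θ) h1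
  refine ⟨τ, ?_, h2⟩
  refine Spec.of_index i hi hτ (isPiNumber_of_dvd hd (j.cdeg_dvd_of_constituent hγ hτ h2)) ?_
  intro κ hκ h4
  obtain ⟨b, rfl⟩ := i.exists_conj hτ hθ.irr hκ h3 h4
  exact hθ.conj i b

theorem IsIrrChar.exists_of_coprime {γ : G → ℂ} (hγ : IsIrrChar G γ)
    (hd : IsPiNumber σ (cdeg γ)) {k : NEmb A G} {i : NEmb A B} {j : NEmb B G}
    (hk : k.hom = j.hom.comp i.hom) (hi : IsPiNumber σᶜ i.hom.range.index) {θ : A → ℂ}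
    (hθ : Spec σ A θ) (h1 : cinner (γ ∘ k.hom) θ ≠ 0) :
    ∃ τ, IsIrrChar B τ ∧ cinner (γ ∘ j.hom) τ ≠ 0 ∧ Spec σ A (τ ∘ i.hom) := by
  rw [hk] at h1
  obtain ⟨τ, hτ, h2, h3⟩ := (hγ.1.comp j.hom).exists_over i.hom (θ := θ) h1
  have hτd := isPiNumber_of_dvd hd (j.cdeg_dvd_of_constituent hγ hτ h2)
  exact ⟨τ, hτ, h2, i.comp_eq_of_coprime hθ.irr hθ.deg hθ.det hi hτ h3 hτd ▸ hθ⟩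

theorem HasSpecialLift.of_index {γ : G → ℂ} (hd : IsPiNumber σ (cdeg γ)) {k : NEmb A G}
    {i : NEmb A B} {j : NEmb B G} (hk : k.hom = j.hom.comp i.hom)
    (hi : IsPiNumber σ i.hom.range.index) (h : HasSpecialLift σ γ A k) :
    HasSpecialLift σ γ B j := by
  obtain ⟨γ', θ, hγ', hag, hθ, h1⟩ := h
  have hd' : IsPiNumber σ (cdeg γ') := by
    rwa [cdeg, ← hag 1 isPiElt_one]
  obtain ⟨τ, hτ, h2⟩ := hγ'.exists_spec_of_index hd' hk hi hθ h1
  exact ⟨γ', τ, hγ', hag, hτ, h2⟩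

/-- A character which restricts to a special character on a normal subgroup of coprime index is
a linear twist of a special character. -/
theorem Spec.exists_twist (i : NEmb A B) (hi : IsPiNumber σᶜ i.hom.range.index) {τ : B → ℂ}
    (hτ : IsIrrChar B τ) (h : Spec σ A (τ ∘ i.hom)) :
    ∃ Θ : B → ℂ, Spec σ B Θ ∧ ∃ l : B →* ℂ, (∀ x, l x ^ i.hom.range.index = 1) ∧
      τ = Θ * (l : B → ℂ) := by
  obtain ⟨Θ, hΘ, hΘr, hΘd⟩ := i.exists_extension h.irr (i.comp_cj hτ.1) h.deg h.det hi
  have hS : Spec σ B Θ := Spec.of_comp i hi hΘ (hΘr ▸ h) hΘd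
  obtain ⟨δ, hδ, hinv, hτδ⟩ := i.gallagher hΘ (hΘr ▸ h.irr) hτ (by
    rw [hΘr, h.irr.cinner_self]; exact one_ne_zero)
  have hδ1 : δ 1 = 1 := by
    have h1 : Θ 1 = τ 1 := by simpa using congrFun hΘr 1
    have h2 := congrFun hτδ 1
    rw [Pi.mul_apply, h1] at h2
    exact (mul_right_eq_self₀.1 h2.symm).resolve_right hτ.degree_ne_zero
  refine ⟨Θ, hS, cdetHom δ, fun x => ?_, ?_⟩
  · rw [← map_pow]
    obtain ⟨a, ha⟩ := i.pow_index_mem x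
    have h1 := hinv 1 a
    rw [one_mul, hδ1, hδ.1.eq_cdetHom hδ1] at h1
    rw [← ha, h1]
  · rw [← hδ.1.eq_cdetHom hδ1]
    exact hτδ

theorem HasSpecialLift.of_coprime {γ : G → ℂ} (hd : IsPiNumber σ (cdeg γ))
    (hγ : IsIPiChar σ G (piRestrict σ γ)) {k : NEmb A G}
    {i : NEmb A B} {j : NEmb B G} (hk : k.hom = j.hom.comp i.hom)
    (hi : IsPiNumber σᶜ i.hom.range.index) (h : HasSpecialLift σ γ A k) :
    HasSpecialLift σ γ B j := by
  obtain ⟨γ', θ, hγ', hag, hθ, h1⟩ := h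
  have hd' : IsPiNumber σ (cdeg γ') := by
    rwa [cdeg, ← hag 1 isPiElt_one]
  obtain ⟨τ, hτ, h2, hτθ⟩ := hγ'.exists_of_coprime hd' hk hi hθ h1
  obtain ⟨Θ, hΘ, l, hl, hτl⟩ := Spec.exists_twist i hi hτ hτθ
  obtain ⟨T, c, hc, γ₁, hγ₁, hind, e, he⟩ : ∃ (T : Subgroup G) (c : NEmb B T)
      (_ : T.subtype.comp c.hom = j.hom) (γ₁ : T → ℂ), IsIrrChar T γ₁ ∧
      indHom T.subtype γ₁ = γ' ∧ ∃ e : ℕ, γ₁ ∘ c.hom = e • τ := by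
    obtain ⟨γ₁, hγ₁, hind, -, e, -, he⟩ := j.clifford_correspondence hγ' hτ h2
    exact ⟨_, _, rfl, γ₁, hγ₁, hind, e, he⟩
  have hdγ₁ : IsPiNumber σ (cdeg γ₁) := by
    refine isPiNumber_of_dvd hd' ⟨T.index, ?_⟩
    have h5 := congrFun hind 1
    rw [indHom_degree _ T.subtype_injective, hγ'.1.apply_one, hγ₁.1.apply_one,
      ← T.card_mul_index] at h5
    push_cast at h5
    rw [mul_assoc, inv_mul_cancel_left₀ (NeZero.ne _)] at h5
    rw [mul_comm]
    exact_mod_cast h5.symm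
  have hb0 : i.hom.range.index ≠ 0 := Subgroup.index_ne_zero_of_finite
  obtain ⟨N, hN1, hN2⟩ := exists_det_pow_twist l hΘ.irr.1 hτl hΘ.det hb0 hi hl c.hom hγ₁.1 hdγ₁ he
  set γ₂ : T → ℂ := γ₁ * ((cdetHom γ₁ ^ N : T →* ℂ) : T → ℂ) with hγ₂
  have hγ₂c : IsCharacter T γ₂ := hγ₁.1.mul (isCharacter_linear _)
  have hres : γ₂ ∘ c.hom = e • Θ := by
    funext x
    have h6 := congrFun he x
    have h7 := congrFun hτl x
    have h8 := hN1 x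
    simp only [hγ₂, Function.comp_apply, Pi.mul_apply, Pi.smul_apply, MonoidHom.pow_apply] at h6 h7 h8 ⊢
    rw [h6, h7, smul_mul_assoc, mul_assoc]
    change e • (Θ x * (l x * cdet γ₁ (c.hom x) ^ N)) = _
    rw [h8, mul_one]
  have hag2 : ∀ g, IsPiElt σ g → γ g = indHom T.subtype γ₂ g := by
    intro g hg
    rw [hag g hg, ← hind]
    refine indHom_congr_of_isPiElt T.subtype_injective (fun t ht => ?_) hg
    change γ₁ t = γ₁ t * cdet γ₁ t ^ N
    rw [hN2 t ht, mul_one]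
  have hγ'' : IsIrrChar G (indHom T.subtype γ₂) := by
    refine IsIPiChar.isIrrChar (σ := σ) ?_ (hγ₂c.indHom _)
    rwa [← piRestrict_eq_iff.2 hag2]
  refine ⟨_, Θ, hγ'', hag2, hΘ, ?_⟩
  have h9 : cinner γ₂ (indHom T.subtype γ₂ ∘ T.subtype) ≠ 0 := by
    rw [← frobenius_reciprocity _ _ hγ''.1.conj, hγ''.cinner_self]
    exact one_ne_zero
  obtain ⟨κ, hκ, h10, h11⟩ := hγ₂c.exists_common h9
  obtain ⟨ϑ, hϑ, h12⟩ := hκ.exists_comp c.hom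
  have h13 := cinner_comp_ne_zero c.hom hγ₂c hκ h10 hϑ.1 h12
  rw [hres, ← Nat.cast_smul_eq_nsmul ℂ, cinner_smul_left] at h13
  have h14 := hΘ.irr.eq_of_cinner_ne_zero hϑ (right_ne_zero_of_mul h13)
  subst h14
  rw [← hc]
  exact cinner_comp_ne_zero c.hom (hγ''.1.comp T.subtype) hκ h11 hϑ.1 h12

/-- A character of `σ`-degree which remains irreducible on the `σ`-elements agrees there with a
`σ`-special character. -/
theorem IsPiSeparable.exists_spec_lift (hG : IsPiSeparable σ G) {γ : G → ℂ}
    (hc : IsCharacter G γ) (hd : IsPiNumber σ (cdeg γ)) (hγ : IsIPiChar σ G (piRestrict σ γ)) :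
    ∃ ρ, Spec σ G ρ ∧ ∀ g, IsPiElt σ g → γ g = ρ g := by
  have h := hG.induct (P := fun A _ k => HasSpecialLift σ γ A k) ?_ ?_ ?_
  · obtain ⟨γ', θ, hγ', hag, hθ, h1⟩ := h
    have h2 : γ' = θ := hγ'.eq_of_cinner_ne_zero hθ.irr h1
    exact ⟨γ', h2 ▸ hθ, hag⟩
  · intro A _ _ k
    have hi := hγ.isIrrChar hc
    obtain ⟨θ, hθ, h1⟩ := hi.exists_comp k.hom
    exact ⟨γ, θ, hi, fun _ _ => rfl, Spec.of_subsingleton hθ, h1⟩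
  · intro A B _ _ _ _ k i j hk hi h
    exact h.of_index hd hk hi
  · intro A B _ _ _ _ k i j hk hi h
    exact h.of_coprime hd hγ hk hi

end

/-- An automorphism of a field extends to an algebraically closed extension. -/
theorem IsAlgClosed.exists_ringEquiv_extension {K L : Type*} [Field K] [Field L] [Algebra K L]
    [IsAlgClosed L] (t : K ≃+* K) :
    ∃ s : L ≃+* L, ∀ x, s (algebraMap K L x) = algebraMap K L (t x) := by
  obtain ⟨S, hS⟩ := exists_isTranscendenceBasis K L
  have := IsAlgClosed.isAlgClosure_of_transcendence_basis _ hS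
  let e : Algebra.adjoin K (Set.range ((↑) : S → L)) ≃+* Algebra.adjoin K (Set.range ((↑) : S → L)) :=
    (hS.1.aevalEquiv.symm.toRingEquiv.trans (MvPolynomial.mapEquiv S t)).trans
      hS.1.aevalEquiv.toRingEquiv
  refine ⟨IsAlgClosure.equivOfEquiv L L e, fun x => ?_⟩
  have h1 : e (algebraMap K _ x) = algebraMap K _ (t x) := by
    change hS.1.aevalEquiv (MvPolynomial.mapEquiv S t (hS.1.aevalEquiv.symm (algebraMap K _ x))) = _
    rw [AlgEquiv.commutes, MvPolynomial.algebraMap_eq, MvPolynomial.mapEquiv_apply,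
      MvPolynomial.map_C]
    exact hS.1.aevalEquiv.commutes (t x)
  have h2 := IsAlgClosure.equivOfEquiv_algebraMap L L e (algebraMap K _ x)
  rw [h1] at h2
  exact h2

theorem exists_ringEquiv_pow {n m : ℕ} (hn : 0 < n) (h : m.Coprime n) :
    ∃ s : ℂ ≃+* ℂ, ∀ z, z ^ n = 1 → s z = z ^ m := by
  have hω := Complex.isPrimitiveRoot_exp n hn.ne'
  set ω := Complex.exp (2 * Real.pi * Complex.I / n)
  let K := algebraicClosure ℚ ℂ
  have hint : IsIntegral ℚ ω := (hω.isIntegral hn).tower_top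
  let w : K := ⟨ω, mem_algebraicClosure_iff.2 hint.isAlgebraic⟩
  have hw : IsPrimitiveRoot w n := by
    refine IsPrimitiveRoot.of_map_of_injective (f := algebraMap K ℂ) hω (algebraMap K ℂ).injective
  have hconj : IsConjRoot ℚ w (w ^ m) := by
    rw [isConjRoot_def, ← Polynomial.cyclotomic_eq_minpoly_rat hw hn,
      ← Polynomial.cyclotomic_eq_minpoly_rat (hw.pow_of_coprime m h) hn]
  have : IsAlgClosure ℚ K := algebraicClosure.isAlgClosure ℚ ℂ
  have : Normal ℚ K := IsAlgClosure.normal ℚ K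
  obtain ⟨t, ht⟩ := hconj.symm.exists_algEquiv
  obtain ⟨s, hs⟩ := IsAlgClosed.exists_ringEquiv_extension (L := ℂ) t.toRingEquiv
  refine ⟨s, fun z hz => ?_⟩
  have : NeZero n := ⟨hn.ne'⟩
  obtain ⟨k, -, rfl⟩ := hω.eq_pow_of_pow_eq_one hz
  have h1 : s ω = ω ^ m := by
    have h2 := hs w
    change s ω = ((t w : K) : ℂ) at h2
    rw [h2, ht]
    rfl
  rw [map_pow, h1, ← pow_mul, ← pow_mul, mul_comm]

/-- A field automorphism of `ℂ` which fixes the `a`-th roots of unity and inverts the `b`-th roots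
of unity, for coprime `a` and `b`. -/
theorem exists_ringEquiv_fix_inv {a b : ℕ} (ha : 0 < a) (hb : 0 < b) (h : a.Coprime b) :
    ∃ s : ℂ ≃+* ℂ, (∀ z, z ^ a = 1 → s z = z) ∧ ∀ z, z ^ b = 1 → s z = z⁻¹ := by
  obtain ⟨m, hm1, hm2⟩ := Nat.chineseRemainder h 1 (b - 1)
  have hmb : m + 1 ≡ 0 [MOD b] := by
    have := hm2.add_right 1
    rw [Nat.sub_add_cancel hb] at this
    exact this.trans ((Nat.modEq_zero_iff_dvd).2 dvd_rfl)
  have hc : m.Coprime (a * b) := by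
    refine Nat.Coprime.mul_right ?_ ?_
    · exact (Nat.ModEq.gcd_eq hm1).trans (Nat.gcd_one_left a)
    · have h1 : b ∣ m + 1 := Nat.modEq_zero_iff_dvd.1 hmb
      exact Nat.Coprime.coprime_dvd_right h1 (by simp)
  obtain ⟨s, hs⟩ := exists_ringEquiv_pow (Nat.mul_pos ha hb) hc
  refine ⟨s, fun z hz => ?_, fun z hz => ?_⟩
  · rw [hs z (by rw [pow_mul, hz, one_pow])]
    simpa using pow_eq_pow_of_modEq hm1 hz
  · rw [hs z (by rw [mul_comm, pow_mul, hz, one_pow])]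
    have h1 := pow_eq_pow_of_modEq hmb hz
    rw [pow_zero, pow_succ] at h1
    exact eq_inv_of_mul_eq_one_left h1

/-- Characters of groups of exponent dividing `a` are fixed by automorphisms which fix the `a`-th
roots of unity. -/
theorem IsCharacter.galois_eq {H : Type} [Group H] {a : ℕ} (s : ℂ →+* ℂ)
    (hs : ∀ z, z ^ a = 1 → s z = z) (hH : ∀ x : H, x ^ a = 1) {χ : H → ℂ} (h : IsCharacter H χ) :
    s ∘ χ = χ := by
  obtain ⟨n, R, hR⟩ := h.exists_matrix
  funext x
  rw [Function.comp_apply, hR, Matrix.trace_eq_sum_roots_charpoly, map_multiset_sum]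
  congr 1
  refine (Multiset.map_congr rfl fun r hr => hs r ?_).trans (Multiset.map_id _)
  exact Matrix.pow_eq_one_of_mem_roots (by rw [← map_pow, hH, map_one]) hr

section

variable {σ : Set ℕ} {A B G : Type} [Group A] [Group B] [Group G] [Finite A] [Finite B] [Finite G]

theorem Subgroup.relIndex_eq_of_coprime {T H : Subgroup G} (h : T.index.Coprime H.index) :
    T.relIndex H = T.index := by
  refine le_antisymm ?_ (Nat.le_of_dvd ?_ ?_)
  · rw [← T.relIndex_top_right]
    refine Subgroup.relIndex_le_of_le_right le_top ?_
    rw [Subgroup.relIndex_top_right]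
    exact Subgroup.index_ne_zero_of_finite
  · exact Nat.pos_of_ne_zero Subgroup.index_ne_zero_of_finite
  · refine h.dvd_of_dvd_mul_right ?_
    rw [← Subgroup.inf_relIndex_right, Subgroup.relIndex_mul_index inf_le_right]
    exact Subgroup.index_dvd_of_le inf_le_left

theorem cdeg_indHom (H : Subgroup G) {θ : H → ℂ} (h : IsCharacter H θ) :
    cdeg (indHom H.subtype θ) = H.index * cdeg θ := by
  refine cdeg_eq_of ?_
  rw [indHom_degree _ H.subtype_injective, h.apply_one, ← H.card_mul_index]
  push_cast
  rw [mul_assoc, inv_mul_cancel_left₀ (NeZero.ne _)]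

/-- Field automorphisms which fix an irreducible character and the characters of a Hall subgroup to
which it restricts irreducibly also fix its constituents on normal subgroups. -/
theorem NEmb.galois_constituent (j : NEmb A G) {γ : G → ℂ} (hγ : IsIrrChar G γ)
    (hd : IsPiNumber σ (cdeg γ)) {H : Subgroup G} (hH : IsHall σ H)
    (hirr : IsIrrChar H (γ ∘ H.subtype)) (s : ℂ →+* ℂ)
    (hs : ∀ z, z ^ Nat.card H = 1 → s z = z) (hsγ : s ∘ γ = γ) {τ : A → ℂ} (hτ : IsIrrChar A τ)
    (h1 : cinner (γ ∘ j.hom) τ ≠ 0) : s ∘ τ = τ := by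
  obtain ⟨T, c, hc, γ₁, hγ₁, hind, hne, e, he0, he⟩ : ∃ (T : Subgroup G) (c : NEmb A T)
      (_ : T.subtype.comp c.hom = j.hom) (γ₁ : T → ℂ), IsIrrChar T γ₁ ∧
      indHom T.subtype γ₁ = γ ∧ cinner (γ ∘ T.subtype) γ₁ ≠ 0 ∧
      ∃ e : ℕ, 0 < e ∧ γ₁ ∘ c.hom = e • τ := by
    obtain ⟨γ₁, hγ₁, hind, hne, e, he0, he⟩ := j.clifford_correspondence hγ hτ h1
    exact ⟨_, _, rfl, γ₁, hγ₁, hind, hne, e, he0, he⟩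
  by_contra hsτ
  have hdγ : cdeg γ = T.index * cdeg γ₁ := by rw [← cdeg_indHom T hγ₁.1, hind]
  have hrel : T.relIndex H = T.index := by
    refine Subgroup.relIndex_eq_of_coprime (isPiNumber_coprime ?_ hH.2)
    exact isPiNumber_of_dvd hd ⟨_, hdγ⟩
  set D := T.subgroupOf H with hD
  let f : D →* T := (H.subtype.comp D.subtype).codRestrict T fun x => x.2
  have hfix : s ∘ (γ₁ ∘ f) = γ₁ ∘ f := by
    refine IsCharacter.galois_eq (a := Nat.card H) s hs (fun x => ?_) (hγ₁.1.comp f)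
    exact Subtype.ext (pow_card_eq_one')
  have hsγ₁ : IsIrrChar T (s ∘ γ₁) := hγ₁.galois s
  have hne₁ : γ₁ ≠ s ∘ γ₁ := by
    intro h
    refine hsτ (funext fun x => ?_)
    have h2 := congrFun h (c.hom x)
    have h3 : γ₁ (c.hom x) = e • τ x := congrFun he x
    rw [Function.comp_apply, h3, map_nsmul] at h2
    have he' : (e : ℂ) ≠ 0 := by exact_mod_cast he0.ne'
    simp only [nsmul_eq_mul] at h2
    exact (mul_left_cancel₀ he' h2).symm
  obtain ⟨ζ, hζ, h3⟩ := (hγ.1.comp T.subtype).eq_add_of_cinner_ne_zero hγ₁ hne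
  have h4 : cinner (γ ∘ T.subtype) (s ∘ γ₁) ≠ 0 := by
    have h5 : γ ∘ T.subtype = s ∘ (γ ∘ T.subtype) := by
      rw [← Function.comp_assoc, hsγ]
    rw [h5, cinner_galois]
    exact fun h => hne (s.injective (h.trans s.map_zero.symm))
  rw [h3, cinner_add_left, hγ₁.cinner_of_ne hsγ₁ hne₁, zero_add] at h4
  obtain ⟨ζ', hζ', h5⟩ := hζ.eq_add_of_cinner_ne_zero hsγ₁ h4
  set ξ := γ₁ ∘ f with hξ
  have hξc : IsCharacter D ξ := hγ₁.1.comp f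
  have hξ0 : ξ ≠ 0 := by
    intro h
    have := congrFun h 1
    rw [hξ, Function.comp_apply, map_one] at this
    exact hγ₁.degree_ne_zero this
  have hres : (γ ∘ H.subtype) ∘ D.subtype = ξ + (ξ + ζ' ∘ f) := by
    funext x
    have h6 := congrFun h3 (f x)
    have h7 := congrFun h5 (f x)
    have h8 := congrFun hfix x
    simp only [Pi.add_apply, Function.comp_apply, hξ] at h6 h7 h8 ⊢
    rw [h7, h8] at h6
    exact h6
  obtain ⟨p, hp0, hp⟩ := hξc.cinner_self_pos hξ0
  obtain ⟨q, hq⟩ := cinner_nat (hζ'.comp f) hξc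
  have h9 : cinner ((γ ∘ H.subtype) ∘ D.subtype) ξ = ((p + (p + q) : ℕ) : ℂ) := by
    rw [hres, cinner_add_left, cinner_add_left, hp, hq]
    push_cast
    rfl
  have h10 : cinner (indHom D.subtype ξ) (γ ∘ H.subtype) = ((p + (p + q) : ℕ) : ℂ) := by
    rw [frobenius_reciprocity _ _ hirr.1.conj, cinner_comm, h9]
  have h11 : indHom D.subtype ξ = γ ∘ H.subtype := by
    refine (hξc.indHom _).eq_of_degree hirr ?_ ?_
    · rw [h10]
      exact_mod_cast (by omega : p + (p + q) ≠ 0)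
    · rw [(hξc.indHom _).apply_one, hirr.1.apply_one, cdeg_indHom D hξc]
      have h12 : cdeg ξ = cdeg γ₁ := by simp [cdeg, hξ]
      have h13 : cdeg (γ ∘ H.subtype) = cdeg γ := by simp [cdeg]
      rw [h12, h13, hdγ, ← hrel]
      rfl
  rw [h11, hirr.cinner_self] at h10
  have : 1 = p + (p + q) := by exact_mod_cast h10
  omega

/-- If `2 ∈ σ`, a character of `σ`-degree which is irreducible on a Hall `σ`-subgroup and fixed by
the automorphism inverting the roots of unity of `σ'`-order is special. -/
theorem IsPiSeparable.spec_of_galois (hG : IsPiSeparable σ G) (h2 : 2 ∈ σ) {γ : G → ℂ}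
    (hγ : IsIrrChar G γ) (hd : IsPiNumber σ (cdeg γ)) {H : Subgroup G} (hH : IsHall σ H)
    (hirr : IsIrrChar H (γ ∘ H.subtype)) (s : ℂ ≃+* ℂ)
    (hs : ∀ z, z ^ Nat.card H = 1 → s z = z) (hs' : ∀ z, z ^ H.index = 1 → s z = z⁻¹)
    (hsγ : s ∘ γ = γ) : Spec σ G γ := by
  have h := hG.induct (P := fun A _ k => ∃ θ, Spec σ A θ ∧ cinner (γ ∘ k.hom) θ ≠ 0) ?_ ?_ ?_
  · obtain ⟨θ, hθ, h1⟩ := h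
    have h2 : γ = θ := hγ.eq_of_cinner_ne_zero hθ.irr h1
    exact h2 ▸ hθ
  · intro A _ _ k
    obtain ⟨θ, hθ, h1⟩ := hγ.exists_comp k.hom
    exact ⟨θ, Spec.of_subsingleton hθ, h1⟩
  · rintro A B _ _ _ _ k i j hk hi ⟨θ, hθ, h1⟩
    exact hγ.exists_spec_of_index hd hk hi hθ h1
  · rintro A B _ _ _ _ k i j hk hi ⟨θ, hθ, h1⟩
    obtain ⟨τ, hτ, h3, hτθ⟩ := hγ.exists_of_coprime hd hk hi hθ h1
    refine ⟨τ, Spec.of_comp i hi hτ.1 hτθ ⟨2 * Nat.card H, ?_, ?_, fun g => ?_⟩, h3⟩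
    · exact Nat.mul_pos two_pos Nat.card_pos
    · refine isPiNumber_mul (fun q hq hq2 => ?_) hH.1
      rwa [(Nat.prime_dvd_prime_iff_eq hq Nat.prime_two).1 hq2]
    · have hsτ := j.galois_constituent hγ hd hH hirr (s : ℂ →+* ℂ) hs hsγ hτ h3
      have h4 : s (cdet τ g) = cdet τ g := by
        have := cdet_galois hτ.1 (s : ℂ →+* ℂ) g
        rw [hsτ] at this
        exact this.symm
      have h5 : cdet τ g ^ (Nat.card H * H.index) = 1 := by
        have h6 : Nat.card B ∣ Nat.card H * H.index := by
          rw [H.card_mul_index]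
          exact Subgroup.card_dvd_of_injective j.hom j.inj
        obtain ⟨m, hm⟩ := h6
        rw [hm, pow_mul, cdet_pow_card, one_pow]
      have h7 := hs' _ ((pow_mul _ _ _).symm.trans h5)
      rw [map_pow, h4] at h7
      have h8 : cdet τ g ^ Nat.card H ≠ 0 := by
        intro h0
        rw [pow_mul, h0, zero_pow Subgroup.index_ne_zero_of_finite] at h5
        exact zero_ne_one h5
      rw [mul_comm, pow_mul, pow_two]
      nth_rewrite 1 [h7]
      exact inv_mul_cancel₀ h8

end

section

variable {σ : Set ℕ} {A G : Type} [Group A] [Group G] [Finite A] [Finite G]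

theorem indHom_mul_comp (i : A →* G) (θ : A → ℂ) {ω : G → ℂ} (hω : IsCharacter G ω) :
    indHom i (θ * (ω ∘ i)) = indHom i θ * ω := by
  have := Fintype.ofFinite A
  have := Fintype.ofFinite G
  funext g
  rw [Pi.mul_apply, indHom_eq, indHom_eq, mul_assoc, Finset.sum_mul]
  congr 1
  refine Finset.sum_congr rfl fun x _ => ?_
  rw [Finset.sum_mul]
  refine Finset.sum_congr rfl fun a _ => ?_
  split_ifs with h
  · rw [Pi.mul_apply, Function.comp_apply, h, hω.conj]
  · rw [zero_mul]

theorem galois_indHom (s : ℂ →+* ℂ) (i : A →* G) (θ : A → ℂ) :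
    s ∘ indHom i θ = indHom i (s ∘ θ) := by
  have := Fintype.ofFinite A
  have := Fintype.ofFinite G
  funext g
  rw [Function.comp_apply, indHom_eq, indHom_eq, map_mul, map_inv₀, map_natCast, map_sum]
  congr 1
  refine Finset.sum_congr rfl fun x _ => ?_
  rw [map_sum]
  refine Finset.sum_congr rfl fun a _ => ?_
  split_ifs
  · rfl
  · exact map_zero s

theorem piRestrict_mul (χ χ' : G → ℂ) :
    piRestrict σ (χ * χ') = piRestrict σ χ * piRestrict σ χ' := by
  funext g
  by_cases h : IsPiElt σ g <;> simp [piRestrict, h]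

theorem IsCharacter.ne_zero_of_apply_one {χ : G → ℂ} (h : IsCharacter G χ) (h0 : χ ≠ 0) :
    χ 1 ≠ 0 := fun h1 => h0 (h.eq_zero_of_degree h1)

theorem IsCharacter.mul_ne_zero {χ ω : G → ℂ} (h : IsCharacter G χ) (h0 : χ ≠ 0)
    (hω : IsCharacter G ω) (hω0 : ω ≠ 0) : χ * ω ≠ 0 := fun h1 =>
  _root_.mul_ne_zero (h.ne_zero_of_apply_one h0) (hω.ne_zero_of_apply_one hω0) (congrFun h1 1)

theorem IsIPiChar.of_mul {γ ω : G → ℂ} (hγ : IsCharacter G γ) (hγ0 : γ ≠ 0)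
    (hω : IsCharacter G ω) (hω0 : ω ≠ 0) (h : IsIPiChar σ G (piRestrict σ (γ * ω))) :
    IsIPiChar σ G (piRestrict σ γ) := by
  refine ⟨⟨γ, hγ, hγ0, rfl⟩, ?_⟩
  rintro ⟨_, _, ⟨γ₁, h1, h1', rfl⟩, ⟨γ₂, h2, h2', rfl⟩, h3⟩
  refine h.2 ⟨_, _, ⟨γ₁ * ω, h1.mul hω, h1.mul_ne_zero h1' hω hω0, rfl⟩,
    ⟨γ₂ * ω, h2.mul hω, h2.mul_ne_zero h2' hω hω0, rfl⟩, ?_⟩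
  rw [piRestrict_mul, h3, piRestrict_mul, piRestrict_mul, add_mul]

/-- A character which is irreducible on a `σ`-subgroup is irreducible on the `σ`-elements. -/
theorem IsIPiChar.of_comp (f : A →* G) (hf : Function.Injective f) (hA : IsPiNumber σ (Nat.card A))
    {η : G → ℂ} (hη : IsCharacter G η) (hirr : IsIrrChar A (η ∘ f)) :
    IsIPiChar σ G (piRestrict σ η) := by
  have helt : ∀ a, IsPiElt σ (f a) := fun a => by
    rw [IsPiElt, orderOf_injective f hf]
    exact isPiNumber_of_dvd hA (orderOf_dvd_natCard a)
  have hne : ∀ {κ : G → ℂ}, IsCharacter G κ → κ ≠ 0 → κ ∘ f ≠ 0 := fun hκ h0 h => by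
    have := congrFun h 1
    rw [Function.comp_apply, map_one] at this
    exact hκ.ne_zero_of_apply_one h0 this
  refine ⟨⟨η, hη, ?_, rfl⟩, ?_⟩
  · rintro rfl
    exact hirr.ne_zero rfl
  · rintro ⟨_, _, ⟨γ₁, h1, h1', rfl⟩, ⟨γ₂, h2, h2', rfl⟩, h3⟩
    refine hirr.2.2 ⟨γ₁ ∘ f, γ₂ ∘ f, h1.comp f, hne h1 h1', h2.comp f, hne h2 h2', ?_⟩
    rw [← piRestrict_add, piRestrict_eq_iff] at h3
    exact funext fun a => h3 (f a) (helt a)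

theorem IsHall.map {σ : Set ℕ} {U : Subgroup G} (hU : IsPiNumber σᶜ U.index) {H : Subgroup U}
    (h : IsHall σ H) : IsHall σ (H.map U.subtype) := by
  refine ⟨?_, ?_⟩
  · rw [Subgroup.card_map_of_injective U.subtype_injective]
    exact h.1
  · rw [Subgroup.index_map_subtype]
    exact isPiNumber_mul h.2 hU

/-- A special character of a subgroup containing a Hall subgroup which extends to the whole group
has a special extension. -/
theorem IsPiSeparable.exists_spec_extension (hG : IsPiSeparable σ G) {U : Subgroup G}
    (hU : IsPiNumber σᶜ U.index) {η : G → ℂ} (hη : IsCharacter G η)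
    (hβ : Spec σ U (η ∘ U.subtype)) : ∃ ρ, Spec σ G ρ ∧ ρ ∘ U.subtype = η ∘ U.subtype := by
  have hUs : IsPiSeparable σ U := hG.comap U.subtype U.subtype_injective
  obtain ⟨H, hH⟩ := hUs.exists_hall
  obtain ⟨hirr, hinj⟩ := hUs.resInj hH _ hβ
  obtain ⟨ρ, hρ, hag⟩ := hG.exists_spec_lift hη (by simpa [cdeg] using hβ.deg)
    (IsIPiChar.of_comp (U.subtype.comp H.subtype)
      (U.subtype_injective.comp H.subtype_injective) hH.1 hη hirr)
  refine ⟨ρ, hρ, ?_⟩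
  refine (hinj _ (hG.specRes (hH.map hU) (Subgroup.map_subtype_le H) ρ hρ) ?_).symm
  funext x
  refine hag _ ?_
  rw [IsPiElt, Subgroup.coe_subtype, Subgroup.coe_subtype, Subgroup.orderOf_coe,
    Subgroup.orderOf_coe]
  exact isPiNumber_of_dvd hH.1 (orderOf_dvd_natCard x)

theorem IsPiSeparable.galois_eq_of_spec (hG : IsPiSeparable σ G) {a : ℕ} (s : ℂ ≃+* ℂ)
    (hs : ∀ z, z ^ a = 1 → s z = z) (ha : ∀ H : Subgroup G, IsHall σ H → Nat.card H ∣ a) {α : G → ℂ}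
    (hα : Spec σ G α) : s ∘ α = α := by
  obtain ⟨H, hH⟩ := hG.exists_hall
  refine ((hG.resInj hH _ hα).2 _ (hα.galois s) ?_).symm
  refine (IsCharacter.galois_eq (a := a) (s : ℂ →+* ℂ) hs (fun x => ?_)
    (hα.irr.1.comp H.subtype)).symm
  exact orderOf_dvd_iff_pow_eq_one.1 ((orderOf_dvd_natCard x).trans (ha H hH))

/-- Special characters induced from a subgroup of `σ`-index which stay irreducible on the
`σ`-elements are special when `2 ∈ σ`. -/
theorem IsPiSeparable.spec_indHom (hG : IsPiSeparable σ G) (h2 : 2 ∈ σ) {U : Subgroup G}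
    (hU : IsPiNumber σ U.index) {α : U → ℂ} (hα : Spec σ U α)
    (hγ : IsIPiChar σ G (piRestrict σ (indHom U.subtype α))) :
    Spec σ G (indHom U.subtype α) := by
  have hc := hα.irr.1.indHom U.subtype
  have hd : IsPiNumber σ (cdeg (indHom U.subtype α)) := by
    rw [cdeg_indHom U hα.irr.1]
    exact isPiNumber_mul hU hα.deg
  obtain ⟨ρ, hρ, hag⟩ := hG.exists_spec_lift hc hd hγ
  obtain ⟨H, hH⟩ := hG.exists_hall
  have hirr : IsIrrChar H (indHom U.subtype α ∘ H.subtype) := by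
    have h1 : indHom U.subtype α ∘ H.subtype = ρ ∘ H.subtype := by
      funext x
      refine hag _ ?_
      rw [H.subtype_apply, IsPiElt, Subgroup.orderOf_coe]
      exact isPiNumber_of_dvd hH.1 (orderOf_dvd_natCard x)
    rw [h1]
    exact (hG.resInj hH ρ hρ).1
  obtain ⟨s, hs, hs'⟩ := exists_ringEquiv_fix_inv (a := Nat.card H) (b := H.index) Nat.card_pos
    (Nat.pos_of_ne_zero Subgroup.index_ne_zero_of_finite) (isPiNumber_coprime hH.1 hH.2)
  refine hG.spec_of_galois h2 (hγ.isIrrChar hc) hd hH hirr s hs hs' ?_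
  have hsα : s ∘ α = α := by
    refine (hG.comap U.subtype U.subtype_injective).galois_eq_of_spec s hs (fun K hK => ?_) hα
    refine (isPiNumber_coprime hK.1 hH.2).dvd_of_dvd_mul_right ?_
    rw [H.card_mul_index]
    exact (Subgroup.card_subgroup_dvd_card K).trans (Subgroup.card_subgroup_dvd_card U)
  have h3 := galois_indHom (s : ℂ →+* ℂ) U.subtype α
  change s ∘ _ = indHom _ (s ∘ α) at h3
  rw [h3, hsα]

end

/-- **Theorem (Statement 13).** Let `π` be a set of primes with `2 ∈ π` and let `G` be a
finite `π`-separable group with subgroup `U`.  Suppose `χ ∈ Irr(G)` satisfies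
`χ^o ∈ I_π(G)` and `ψ ∈ Irr(U)` is `π`-factored with `χ = ψ^G`.  If `|G : U|` is a
`π`-number and the `π'`-special factor of `ψ` extends to `G`, then `χ` is `π`-factored. -/
theorem induced_factored_of_extension
    (π : Set ℕ) (h2 : 2 ∈ π)
    (G : Type) [Group G] [Fintype G] (hG : IsPiSeparable π G)
    (U : Subgroup G)
    (χ : G → ℂ) (hχ : IsIrrChar G χ) (hχo : IsIPiChar π G (piRestrict π χ))
    (ψ : ↥U → ℂ) (hψirr : IsIrrChar ↥U ψ)
    (α β : ↥U → ℂ) (hα : IsPiSpecial π ↥U α) (hβ : IsPiSpecial πᶜ ↥U β)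
    (hψfac : ψ = α * β) (hind : indChar U ψ = χ)
    (hidx : IsPiNumber π U.index)
    (hext : ∃ η : G → ℂ, IsCharacter G η ∧ resChar U η = β) :
    IsPiFactored π G χ := by
  obtain ⟨η, hη, rfl⟩ := hext
  obtain ⟨ρ, hρ, hρη⟩ := hG.compl.exists_spec_extension (by rwa [compl_compl]) hη hβ.spec
  have hχ' : χ = indHom U.subtype α * ρ := by
    rw [← indHom_mul_comp _ _ hρ.irr.1, hρη, indHom_subtype, ← hind, hψfac]
    rfl
  have hα0 : indHom U.subtype α ≠ 0 := by
    intro h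
    rw [hχ', h, zero_mul] at hχ
    exact hχ.ne_zero rfl
  refine ⟨indHom U.subtype α, ρ, ?_, hρ.isPiSpecial, hχ'⟩
  rw [hχ'] at hχo
  exact (hG.spec_indHom h2 hidx hα.spec (IsIPiChar.of_mul (hα.spec.irr.1.indHom _) hα0
    hρ.irr.1 hρ.irr.ne_zero hχo)).isPiSpecial
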